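/- arXiv:2504.00346 — 2 statements merged into one kernel-verified Lean document; each statement's English description precedes it below -/
import Mathlib

section
/- There exists a constant τ ∈ (0, 1/20) such that the following holds. Let F_q ⊆ F_{q'} be finite fields, let d < q, and let ε ≥ (d/q)^τ. If f : F_q³ → F_{q'} satisfies agr(f, RM_{q'}[d, F_q³]) ≤ ε, then Pr_P[agr(f|_P, RM_{q'}[d, F_q²]) ≥ 1.2·ε] ≤ 100/(ε²·q), where P is a uniformly random affine plane in F_q³. -/
namespace Paper

/-- Fractional agreement between two functions on a finite domain. -/
noncomputable def agr {U V : Type*} [Fintype U] (f g : U → V) : ℝ :=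
  (Nat.card {x : U // f x = g x} : ℝ) / Fintype.card U

/-- `F : F_q^m → F_{q'}` has (total) degree at most `d`. -/
def IsDegLE {Fq Fq' : Type} [Field Fq] [Field Fq'] (ι : Fq →+* Fq') (m d : ℕ)
    (F : (Fin m → Fq) → Fq') : Prop :=
  ∃ p : MvPolynomial (Fin m) Fq', p.totalDegree ≤ d ∧
    ∀ x, F x = MvPolynomial.eval (fun i => ι (x i)) p

/-- `agrRM2 ι d g`: the maximal fractional agreement of `g : F_q² → F_{q'}` (in curried
form) with a bivariate function of total degree at most `d`. -/
noncomputable def agrRM2 {Fq Fq' : Type} [Field Fq] [Fintype Fq] [Field Fq']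
    (ι : Fq →+* Fq') (d : ℕ) (g : Fq → Fq → Fq') : ℝ :=
  sSup {r : ℝ | ∃ p : MvPolynomial (Fin 2) Fq', p.totalDegree ≤ d ∧
    r = agr (fun st : Fq × Fq => g st.1 st.2)
      fun st : Fq × Fq => MvPolynomial.eval ![ι st.1, ι st.2] p}

end Paper

namespace Paper
section Helpers
open Classical

lemma second_moment {α β : Type*} [Fintype β] (S : Finset α) (I : α → β → Prop) (r l : ℝ)
    (hr : ∀ s ∈ S, ((Finset.univ.filter (fun x => I s x)).card : ℝ) = r)
    (hl : ∀ s ∈ S, ∀ s' ∈ S, s ≠ s' →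
      ((Finset.univ.filter (fun x => I s x ∧ I s' x)).card : ℝ) ≤ l)
    (h : r ^ 2 = l * Fintype.card β) (hβ : 0 < Fintype.card β) :
    ∑ x, (((S.filter (fun s => I s x)).card : ℝ) - S.card * r / Fintype.card β) ^ 2
      ≤ r * S.card := by
  have hβ' : (0 : ℝ) < Fintype.card β := by exact_mod_cast hβ
  have hl0 : 0 ≤ l := by
    by_contra hneg
    push Not at hneg
    nlinarith [sq_nonneg r, mul_pos_of_neg_of_neg hneg hneg]
  have hdeg : ∀ x, ((S.filter (fun s => I s x)).card : ℝ) = ∑ s ∈ S, if I s x then (1:ℝ) else 0 := by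
    intro x
    rw [Finset.card_filter]; push_cast; rfl
  have h1 : ∑ x, ((S.filter (fun s => I s x)).card : ℝ) = S.card * r := by
    simp_rw [hdeg]
    rw [Finset.sum_comm]
    rw [← nsmul_eq_mul, ← Finset.sum_const]
    apply Finset.sum_congr rfl
    intro s hs
    rw [← hr s hs, Finset.card_filter]; push_cast; rfl
  have h2 : ∑ x, ((S.filter (fun s => I s x)).card : ℝ) ^ 2 ≤ r * S.card + l * S.card ^ 2 := by
    have : ∑ x, ((S.filter (fun s => I s x)).card : ℝ) ^ 2
        = ∑ s ∈ S, ∑ s' ∈ S, ((Finset.univ.filter (fun x => I s x ∧ I s' x)).card : ℝ) := by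
      simp_rw [hdeg, sq, Finset.sum_mul_sum]
      rw [Finset.sum_comm]
      apply Finset.sum_congr rfl
      intro s _
      rw [Finset.sum_comm]
      apply Finset.sum_congr rfl
      intro s' _
      rw [Finset.card_filter]; push_cast
      apply Finset.sum_congr rfl
      intro x _
      by_cases h1 : I s x <;> by_cases h2 : I s' x <;> simp [h1, h2]
    rw [this]
    calc _ ≤ ∑ s ∈ S, ∑ s' ∈ S, ((if s = s' then r else 0) + l) := by
          apply Finset.sum_le_sum; intro s hs
          apply Finset.sum_le_sum; intro s' hs'
          by_cases he : s = s'
          · subst he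
            simp only [and_self, if_true]
            rw [hr s hs]; linarith
          · simp only [he, if_false, zero_add]
            exact hl s hs s' hs' he
      _ = r * S.card + l * S.card ^ 2 := by
          simp only [Finset.sum_add_distrib, Finset.sum_ite_eq, Finset.sum_const, nsmul_eq_mul]
          rw [Finset.sum_congr rfl (fun x hx => if_pos hx)]
          simp only [Finset.sum_const, nsmul_eq_mul]
          ring
  set D : ℝ := S.card * r / Fintype.card β with hD
  have hDb : D * Fintype.card β = S.card * r := by rw [hD]; field_simp
  have h3 : ∑ x, (((S.filter (fun s => I s x)).card : ℝ) - D) ^ 2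
      = ∑ x, ((S.filter (fun s => I s x)).card : ℝ) ^ 2 - 2 * D * (S.card * r)
        + Fintype.card β * D ^ 2 := by
    rw [← h1, Finset.mul_sum, ← Finset.sum_sub_distrib]
    have : (Fintype.card β : ℝ) * D ^ 2 = ∑ x : β, D ^ 2 := by simp
    rw [this, ← Finset.sum_add_distrib]
    apply Finset.sum_congr rfl; intro x _; ring
  rw [h3]
  have h4 : D * (S.card * r) = l * S.card ^ 2 := by
    rw [hD]
    have : (S.card * r / Fintype.card β) * (S.card * r) = S.card ^ 2 * r ^ 2 / Fintype.card β := by ring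
    rw [this, h]; field_simp
  have h5 : Fintype.card β * D ^ 2 = l * S.card ^ 2 := by
    rw [← h4, ← hDb]; ring
  nlinarith

lemma uncovered {α β : Type*} [Fintype β] (S : Finset α) (I : α → β → Prop) (r l : ℝ)
    (hr : ∀ s ∈ S, ((Finset.univ.filter (fun x => I s x)).card : ℝ) = r)
    (hl : ∀ s ∈ S, ∀ s' ∈ S, s ≠ s' →
      ((Finset.univ.filter (fun x => I s x ∧ I s' x)).card : ℝ) ≤ l)
    (h : r ^ 2 = l * Fintype.card β) (hβ : 0 < Fintype.card β) (hr0 : 0 < r) :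
    ((Finset.univ.filter (fun x => ∀ s ∈ S, ¬ I s x)).card : ℝ) * S.card * r
      ≤ (Fintype.card β : ℝ) ^ 2 := by
  have hβ' : (0 : ℝ) < Fintype.card β := by exact_mod_cast hβ
  have key := second_moment S I r l hr hl h hβ
  set D : ℝ := S.card * r / Fintype.card β with hD
  have hDb : D * Fintype.card β = S.card * r := by rw [hD]; field_simp
  have h1 : ((Finset.univ.filter (fun x => ∀ s ∈ S, ¬ I s x)).card : ℝ) * D ^ 2 ≤ r * S.card := by
    refine le_trans ?_ key
    rw [← nsmul_eq_mul, ← Finset.sum_const]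
    calc _ ≤ ∑ x ∈ Finset.univ.filter (fun x => ∀ s ∈ S, ¬ I s x),
          (((S.filter (fun s => I s x)).card : ℝ) - D) ^ 2 := by
          apply Finset.sum_le_sum
          intro x hx
          rw [Finset.mem_filter] at hx
          have : S.filter (fun s => I s x) = ∅ := by
            apply Finset.filter_false_of_mem
            intro s hs; exact hx.2 s hs
          rw [this]; simp
      _ ≤ _ := by
          apply Finset.sum_le_sum_of_subset_of_nonneg (Finset.filter_subset _ _)
          intro _ _ _; positivity
  rcases Nat.eq_zero_or_pos S.card with h0 | hpos
  · rw [h0]; simp; 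
  · have hS : (0:ℝ) < S.card := by exact_mod_cast hpos
    set U := ((Finset.univ.filter (fun x => ∀ s ∈ S, ¬ I s x)).card : ℝ)
    have : U * (S.card * r) ^ 2 ≤ r * S.card * (Fintype.card β : ℝ) ^ 2 := by
      rw [← hDb]
      have := mul_le_mul_of_nonneg_right h1 (sq_nonneg (Fintype.card β : ℝ))
      linarith [this]
    have hp : 0 < r * S.card := by positivity
    have h6 : (r * S.card) * (U * S.card * r) ≤ (r * S.card) * (Fintype.card β : ℝ) ^ 2 := by
      linarith
    exact le_of_mul_le_mul_left h6 hp

end Helpers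
end Paper

namespace Paper
section Helpers
open Classical

/-- Bilinear pairing on `F³`. -/
def dot {F : Type*} [Field F] (w v : F × F × F) : F :=
  w.1 * v.1 + w.2.1 * v.2.1 + w.2.2 * v.2.2

variable {F : Type*} [Field F]

lemma dot_add_right (w v v' : F × F × F) : dot w (v + v') = dot w v + dot w v' := by
  simp only [dot, Prod.fst_add, Prod.snd_add]; ring

lemma dot_sub_right (w v v' : F × F × F) : dot w (v - v') = dot w v - dot w v' := by
  simp only [dot, Prod.fst_sub, Prod.snd_sub]; ring

lemma dot_sub_left (w w' v : F × F × F) : dot (w - w') v = dot w v - dot w' v := by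
  simp only [dot, Prod.fst_sub, Prod.snd_sub]; ring

lemma dot_smul_right (c : F) (w v : F × F × F) : dot w (c • v) = c * dot w v := by
  simp only [dot, Prod.smul_fst, Prod.smul_snd, smul_eq_mul]; ring

lemma dot_comm (w v : F × F × F) : dot w v = dot v w := by
  simp only [dot]; ring

variable [Fintype F]

lemma card_pos_F : 0 < Fintype.card F := Fintype.card_pos

lemma card_dot (w : F × F × F) (hw : w ≠ 0) (t : F) :
    (Finset.univ.filter (fun v => dot w v = t)).card = Fintype.card F ^ 2 := by
  have hc : Fintype.card F ^ 2 = Fintype.card (F × F) := by rw [Fintype.card_prod, sq]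
  rw [hc, ← Finset.card_univ]
  obtain ⟨a, b, c⟩ := w
  by_cases ha : a = 0
  · by_cases hb : b = 0
    · have hcne : c ≠ 0 := by
        rintro rfl; apply hw; subst ha; subst hb; rfl
      symm
      apply Finset.card_bij' (fun (p : F × F) _ => ((p.1, p.2, (t - a * p.1 - b * p.2) / c) : F × F × F))
        (fun v _ => (v.1, v.2.1))
      · intro p _; rw [Finset.mem_filter]; refine ⟨Finset.mem_univ _, ?_⟩; simp only [dot]; field_simp; ring
      · intro p _; simp
      · intro p _; simp
      · rintro ⟨x, y, z⟩ hv
        rw [Finset.mem_filter] at hv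
        replace hv := hv.2
        simp [dot] at hv ⊢
        field_simp; rw [← hv]; ring
    · symm
      apply Finset.card_bij' (fun (p : F × F) _ => ((p.1, (t - a * p.1 - c * p.2) / b, p.2) : F × F × F))
        (fun v _ => (v.1, v.2.2))
      · intro p _; rw [Finset.mem_filter]; refine ⟨Finset.mem_univ _, ?_⟩; simp only [dot]; field_simp; ring
      · intro p _; simp
      · intro p _; simp
      · rintro ⟨x, y, z⟩ hv
        rw [Finset.mem_filter] at hv
        replace hv := hv.2
        simp [dot] at hv ⊢
        field_simp; rw [← hv]; ring
  · symm
    apply Finset.card_bij' (fun (p : F × F) _ => (((t - b * p.1 - c * p.2) / a, p.1, p.2) : F × F × F))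
      (fun v _ => (v.2.1, v.2.2))
    · intro p _; rw [Finset.mem_filter]; refine ⟨Finset.mem_univ _, ?_⟩; simp only [dot]; field_simp; ring
    · intro p _; simp
    · intro p _; simp
    · rintro ⟨x, y, z⟩ hv
      rw [Finset.mem_filter] at hv
      replace hv := hv.2
      simp [dot] at hv ⊢
      field_simp; rw [← hv]; ring

lemma card_dot' (v : F × F × F) (hv : v ≠ 0) (t : F) :
    (Finset.univ.filter (fun w => dot w v = t)).card = Fintype.card F ^ 2 := by
  simp_rw [dot_comm _ v]; exact card_dot v hv t

lemma card_inc (w : F × F × F) :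
    (Finset.univ.filter (fun u : (F × F × F) × F => dot w u.1 = u.2)).card
      = Fintype.card F ^ 3 := by
  have : Fintype.card F ^ 3 = (Finset.univ : Finset (F × F × F)).card := by
    rw [Finset.card_univ, Fintype.card_prod, Fintype.card_prod]; ring
  rw [this]
  apply Finset.card_bij' (fun u _ => u.1) (fun v _ => (v, dot w v))
  · intro u _; simp
  · intro u _; simp
  · rintro ⟨v, t⟩ h; simp at h ⊢; exact h
  · intro u _; simp

lemma card_inc2 (w w' : F × F × F) (h : w ≠ w') :
    (Finset.univ.filter (fun u : (F × F × F) × F => dot w u.1 = u.2 ∧ dot w' u.1 = u.2)).card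
      = Fintype.card F ^ 2 := by
  rw [← card_dot (w - w') (sub_ne_zero.mpr h) 0]
  apply Finset.card_bij' (fun u _ => u.1) (fun v _ => (v, dot w v))
  · rintro ⟨v, t⟩ hu; simp at hu ⊢; rw [dot_sub_left, hu.1, hu.2, sub_self]
  · intro v hv; simp at hv ⊢; rw [dot_sub_left] at hv; exact (sub_eq_zero.mp hv).symm
  · rintro ⟨v, t⟩ hu; simp at hu ⊢; exact hu.1
  · intro v _; simp

lemma card_ker2 (w w' v₁ : F × F × F) (hw : w ≠ 0) (h1 : dot w v₁ = 0) (h2 : dot w' v₁ ≠ 0) :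
    (Finset.univ.filter (fun v => dot w v = 0 ∧ dot w' v = 0)).card ≤ Fintype.card F := by
  set K := Finset.univ.filter (fun v => dot w v = 0 ∧ dot w' v = 0) with hK
  have key : ((Finset.univ : Finset F) ×ˢ K).card
      ≤ (Finset.univ.filter (fun v => dot w v = 0)).card := by
    apply Finset.card_le_card_of_injOn (fun p => p.1 • v₁ + p.2)
    · rintro ⟨c, k⟩ hk
      simp [hK] at hk ⊢
      rw [dot_add_right, dot_smul_right, h1, hk.1]; simp
    · rintro ⟨c, k⟩ hk ⟨c', k'⟩ hk' he
      simp [hK] at hk hk' he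
      have h3 := congrArg (dot w') he
      rw [dot_add_right, dot_add_right, dot_smul_right, dot_smul_right, hk.2, hk'.2] at h3
      simp [h2] at h3
      subst h3
      simpa using he
  rw [card_dot w hw 0, Finset.card_product, Finset.card_univ, sq] at key
  exact Nat.le_of_mul_le_mul_left key card_pos_F

lemma card_span (w : F × F × F) (hw : w ≠ 0) :
    (Finset.univ.filter (fun w' : F × F × F => ∀ v, dot w v = 0 → dot w' v = 0)).card
      ≤ Fintype.card F := by
  obtain ⟨a, b, c⟩ := w
  rw [← Finset.card_univ]
  by_cases ha : a = 0
  · by_cases hb : b = 0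
    · have hcne : c ≠ 0 := by
        rintro rfl; apply hw; subst ha; subst hb; rfl
      apply Finset.card_le_card_of_injOn (fun p => p.2.2) (by intro _ _; simp)
      rintro ⟨x, y, z⟩ h ⟨x', y', z'⟩ h' he
      simp only [Finset.coe_filter, Finset.mem_univ, true_and, Set.mem_ofPred_eq] at h h' he
      have e1 := h (c, 0, -a) (by simp [dot]; ring)
      have e2 := h (0, c, -b) (by simp [dot]; ring)
      have e1' := h' (c, 0, -a) (by simp [dot]; ring)
      have e2' := h' (0, c, -b) (by simp [dot]; ring)
      simp [dot] at e1 e2 e1' e2'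
      subst he
      have : x * c = x' * c := by linear_combination e1 - e1'
      have h2 : y * c = y' * c := by linear_combination e2 - e2'
      simp [mul_left_inj' hcne] at this h2
      simp [this, h2]
    · apply Finset.card_le_card_of_injOn (fun p => p.2.1) (by intro _ _; simp)
      rintro ⟨x, y, z⟩ h ⟨x', y', z'⟩ h' he
      simp only [Finset.coe_filter, Finset.mem_univ, true_and, Set.mem_ofPred_eq] at h h' he
      have e1 := h (b, -a, 0) (by simp [dot]; ring)
      have e2 := h (0, -c, b) (by simp [dot]; ring)
      have e1' := h' (b, -a, 0) (by simp [dot]; ring)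
      have e2' := h' (0, -c, b) (by simp [dot]; ring)
      simp [dot] at e1 e2 e1' e2'
      subst he
      have : x * b = x' * b := by linear_combination e1 - e1'
      have h2 : z * b = z' * b := by linear_combination e2 - e2'
      rw [mul_left_inj' hb] at this h2
      simp [this, h2]
  · apply Finset.card_le_card_of_injOn (fun p => p.1) (by intro _ _; simp)
    rintro ⟨x, y, z⟩ h ⟨x', y', z'⟩ h' he
    simp only [Finset.coe_filter, Finset.mem_univ, true_and, Set.mem_ofPred_eq] at h h' he
    have e1 := h (-b, a, 0) (by simp [dot]; ring)
    have e2 := h (-c, 0, a) (by simp [dot]; ring)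
    have e1' := h' (-b, a, 0) (by simp [dot]; ring)
    have e2' := h' (-c, 0, a) (by simp [dot]; ring)
    simp [dot] at e1 e2 e1' e2'
    subst he
    have : y * a = y' * a := by linear_combination e1 - e1'
    have h2 : z * a = z' * a := by linear_combination e2 - e2'
    rw [mul_left_inj' ha] at this h2
    simp [this, h2]

lemma exists_ker (w w' : F × F × F) : ∃ v : F × F × F, v ≠ 0 ∧ dot w v = 0 ∧ dot w' v = 0 := by
  have hc : Fintype.card (F × F) < Fintype.card (F × F × F) := by
    simp only [Fintype.card_prod]
    have := Fintype.one_lt_card (α := F)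
    nlinarith [mul_pos (card_pos_F (F := F)) (card_pos_F (F := F))]
  obtain ⟨v, v', hne, he⟩ := Fintype.exists_ne_map_eq_of_card_lt
    (fun v : F × F × F => (dot w v, dot w' v)) hc
  refine ⟨v - v', sub_ne_zero.mpr hne, ?_, ?_⟩
  · rw [dot_sub_right, sub_eq_zero]; exact (Prod.ext_iff.mp he).1
  · rw [dot_sub_right, sub_eq_zero]; exact (Prod.ext_iff.mp he).2

/-- Degree deviation over the (unnormalised) projective points. -/
lemma deg_dev (S : Finset (F × F × F)) :
    ∑ u : (F × F × F) × F, (((S.filter (fun w => dot w u.1 = u.2)).card : ℝ)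
      - S.card / Fintype.card F) ^ 2 ≤ (Fintype.card F : ℝ) ^ 3 * S.card := by
  have hq : (0:ℝ) < Fintype.card F := by exact_mod_cast card_pos_F
  have hX : (Fintype.card ((F × F × F) × F) : ℝ) = (Fintype.card F : ℝ) ^ 4 := by
    simp only [Fintype.card_prod]; push_cast; ring
  have := second_moment S (fun w (u : (F × F × F) × F) => dot w u.1 = u.2)
    ((Fintype.card F : ℝ) ^ 3) ((Fintype.card F : ℝ) ^ 2)
    (by intro s _; rw [card_inc]; push_cast; rfl)
    (by intro s _ s' _ h; rw [card_inc2 s s' h]; push_cast; rfl)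
    (by rw [hX]; ring) Fintype.card_pos
  rw [hX] at this
  have e : (S.card : ℝ) * (Fintype.card F : ℝ) ^ 3 / (Fintype.card F : ℝ) ^ 4
      = S.card / Fintype.card F := by field_simp
  rw [e] at this
  exact this

end Helpers
end Paper

namespace Paper
set_option linter.unusedSectionVars false
section Helpers
open Classical

variable {F K : Type*} [Field F] [Fintype F]

/-- Consistency of the plane functions over the intersection of two planes. -/
def Cons (G : F × F × F → F → F → K) (w w' : F × F × F) : Prop :=
  ∀ x y, dot w (x, y, 1) = dot w' (x, y, 1) → G w x y = G w' x y

lemma Cons.symm {G : F × F × F → F → F → K} {w w' : F × F × F} (h : Cons G w w') :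
    Cons G w' w := fun x y e => (h x y e.symm).symm

lemma Cons.rfl' {G : F × F × F → F → F → K} {w : F × F × F} : Cons G w w := fun _ _ _ => rfl

/-- Agreement set of two plane functions (projected to the first two coordinates). -/
noncomputable def Agset (G : F × F × F → F → F → K) (w w' : F × F × F) : Finset (F × F) :=
  Finset.univ.filter (fun p => dot w (p.1, p.2, 1) = dot w' (p.1, p.2, 1) ∧
    G w p.1 p.2 = G w' p.1 p.2)

/-- Unnormalised projective points of the intersection where the two functions agree,
together with the points at infinity. -/
noncomputable def Bset (G : F × F × F → F → F → K) (w w' : F × F × F) : Finset (F × F × F) :=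
  Finset.univ.filter (fun v => v ≠ 0 ∧ dot w v = dot w' v ∧
    (v.2.2 = 0 ∨ G w (v.1 / v.2.2) (v.2.1 / v.2.2) = G w' (v.1 / v.2.2) (v.2.1 / v.2.2)))

lemma ne_of_not_cons {G : F × F × F → F → F → K} {w w' : F × F × F} (h : ¬ Cons G w w') :
    w - w' ≠ 0 := by
  intro h0
  rw [sub_eq_zero] at h0
  subst h0
  exact h Cons.rfl'

lemma dot_norm (w v : F × F × F) (h : v.2.2 ≠ 0) :
    dot w (v.1 / v.2.2, v.2.1 / v.2.2, 1) = dot w v / v.2.2 := by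
  simp only [dot]; field_simp

lemma card_Bset (G : F × F × F → F → F → K) (w w' : F × F × F) (d : ℕ) (h : ¬ Cons G w w')
    (hd : (Agset G w w').card ≤ d) : (Bset G w w').card ≤ (d + 1) * Fintype.card F := by
  have h0 := ne_of_not_cons h
  obtain ⟨x, y, hxy, -⟩ : ∃ x y, dot w (x, y, 1) = dot w' (x, y, 1) ∧ G w x y ≠ G w' x y := by
    unfold Cons at h; push Not at h; exact h
  have h1 : (Finset.univ.filter (fun v => dot (w - w') v = 0 ∧ dot (0, 0, 1) v = 0)).card
      ≤ Fintype.card F := by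
    apply card_ker2 (w - w') (0, 0, 1) (x, y, 1) h0
    · rw [dot_sub_left, hxy, sub_self]
    · simp [dot]
  have h2 : ((Bset G w w').filter (fun v => v.2.2 ≠ 0)).card ≤ d * Fintype.card F := by
    calc _ ≤ (Agset G w w' ×ˢ (Finset.univ : Finset F)).card := by
          apply Finset.card_le_card_of_injOn
            (fun v => ((v.1 / v.2.2, v.2.1 / v.2.2), v.2.2))
          · intro v hv
            rw [Finset.mem_coe, Finset.mem_filter, Bset, Finset.mem_filter] at hv
            obtain ⟨⟨-, -, hv1, hv2⟩, hv3⟩ := hv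
            rw [Finset.mem_coe, Finset.mem_product]
            refine ⟨?_, Finset.mem_univ _⟩
            rw [Agset, Finset.mem_filter]
            refine ⟨Finset.mem_univ _, ?_, ?_⟩
            · simp only [dot_norm _ _ hv3, hv1]
            · exact hv2.resolve_left hv3
          · rintro ⟨a, b, c⟩ hv ⟨a', b', c'⟩ hv' he
            rw [Finset.mem_coe, Finset.mem_filter] at hv hv'
            simp only [Prod.mk.injEq] at he
            obtain ⟨⟨e1, e2⟩, e3⟩ := he
            have hc := hv.2
            simp only at hc
            subst e3
            rw [div_left_inj' hc] at e1 e2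
            rw [e1, e2]
      _ ≤ _ := by
          rw [Finset.card_product, Finset.card_univ]
          exact Nat.mul_le_mul_right _ hd
  have h3 : (Bset G w w').filter (fun v => ¬ v.2.2 ≠ 0) ⊆
      Finset.univ.filter (fun v => dot (w - w') v = 0 ∧ dot (0, 0, 1) v = 0) := by
    intro v hv
    rw [Finset.mem_filter, Bset, Finset.mem_filter] at hv
    rw [Finset.mem_filter]
    refine ⟨Finset.mem_univ _, ?_, ?_⟩
    · rw [dot_sub_left, hv.1.2.2.1, sub_self]
    · have := hv.2
      push Not at this
      simp [dot, this]
  have h4 := Finset.card_filter_add_card_filter_not (s := Bset G w w') (fun v => v.2.2 ≠ 0)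
  have h5 := Finset.card_le_card h3
  linarith

lemma common_nbr (G : F × F × F → F → F → K) (w₁ w₂ w₃ : F × F × F)
    (h1 : Cons G w₁ w₃) (h2 : Cons G w₂ w₃) :
    Fintype.card F - 1 ≤ ((Bset G w₁ w₂).filter (fun v => dot w₃ v = dot w₁ v)).card := by
  obtain ⟨v, hv0, hv1, hv2⟩ := exists_ker (w₁ - w₂) (w₃ - w₁)
  rw [dot_sub_left, sub_eq_zero] at hv1 hv2
  have : Fintype.card F - 1 = (Finset.univ.filter (fun c : F => c ≠ 0)).card := by
    rw [Finset.filter_ne', Finset.card_erase_of_mem (Finset.mem_univ _), Finset.card_univ]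
  rw [this]
  apply Finset.card_le_card_of_injOn (fun c => c • v)
  · intro c hc
    rw [Finset.mem_coe, Finset.mem_filter] at hc
    rw [Finset.mem_coe, Finset.mem_filter, Bset, Finset.mem_filter]
    refine ⟨⟨Finset.mem_univ _, smul_ne_zero hc.2 hv0, ?_, ?_⟩, ?_⟩
    · rw [dot_smul_right, dot_smul_right, hv1]
    · by_cases h3 : v.2.2 = 0
      · left; simp [h3]
      · right
        have e1 : (c • v).1 / (c • v).2.2 = v.1 / v.2.2 := by
          simp only [Prod.smul_fst, Prod.smul_snd, smul_eq_mul]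
          exact mul_div_mul_left _ _ hc.2
        have e2 : (c • v).2.1 / (c • v).2.2 = v.2.1 / v.2.2 := by
          simp only [Prod.smul_fst, Prod.smul_snd, smul_eq_mul]
          exact mul_div_mul_left _ _ hc.2
        rw [e1, e2, h1 _ _ (by rw [dot_norm _ _ h3, dot_norm _ _ h3, hv2]),
          h2 _ _ (by rw [dot_norm _ _ h3, dot_norm _ _ h3, hv2, hv1])]
    · rw [dot_smul_right, dot_smul_right, hv2]
  · intro c _ c' _ he
    exact smul_left_injective F hv0 he

lemma deg_le (S : Finset (F × F × F)) (v : F × F × F) (hv : v ≠ 0) (t : F) :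
    (S.filter (fun w => dot w v = t)).card ≤ Fintype.card F ^ 2 := by
  rw [← card_dot' v hv t]
  exact Finset.card_le_card (Finset.filter_subset_filter _ (Finset.subset_univ _))

/-- Weighted common neighbour count. -/
lemma common_nbr_sum (G : F × F × F → F → F → K) (S : Finset (F × F × F)) (w₁ w₂ : F × F × F) :
    (Fintype.card F - 1) * (S.filter (fun w => Cons G w₁ w ∧ Cons G w₂ w)).card ≤
      ∑ v ∈ Bset G w₁ w₂, (S.filter (fun w => dot w v = dot w₁ v)).card := by
  calc _ = ∑ w ∈ S.filter (fun w => Cons G w₁ w ∧ Cons G w₂ w), (Fintype.card F - 1) := by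
        rw [Finset.sum_const, smul_eq_mul, mul_comm]
    _ ≤ ∑ w ∈ S.filter (fun w => Cons G w₁ w ∧ Cons G w₂ w),
          ((Bset G w₁ w₂).filter (fun v => dot w v = dot w₁ v)).card := by
        apply Finset.sum_le_sum
        intro w hw
        rw [Finset.mem_filter] at hw
        exact common_nbr G w₁ w₂ w hw.2.1 hw.2.2
    _ ≤ ∑ w ∈ S, ((Bset G w₁ w₂).filter (fun v => dot w v = dot w₁ v)).card :=
        Finset.sum_le_sum_of_subset (Finset.filter_subset _ _)
    _ = _ := by
        simp_rw [Finset.card_filter]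
        exact Finset.sum_comm

/-- pairwise intersections of the `Bset`s -/
lemma sum_inter (G : F × F × F → F → F → K) (V : Finset (F × F × F)) (π : F × F × F → F × F × F)
    (d : ℕ) (w : F × F × F) (hw : ¬ Cons G w (π w)) (hd : (Agset G w (π w)).card ≤ d) :
    ∑ w' ∈ V, ((Bset G w (π w)).filter (fun v => dot w' v = dot w v)).card ≤
      V.card * Fintype.card F + Fintype.card F * ((d + 1) * Fintype.card F) := by
  set E := V.filter (fun w' => ∀ v, dot (w - π w) v = 0 → dot (w - w') v = 0) with hE
  have hEc : E.card ≤ Fintype.card F := by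
    refine le_trans ?_ (card_span (w - π w) (ne_of_not_cons hw))
    apply Finset.card_le_card_of_injOn (fun w' => w - w')
    · intro w' h
      rw [Finset.mem_coe, hE, Finset.mem_filter] at h
      rw [Finset.mem_coe, Finset.mem_filter]
      exact ⟨Finset.mem_univ _, h.2⟩
    · intro a _ b _ he; simpa using he
  calc _ ≤ ∑ w' ∈ V, (Fintype.card F + if w' ∈ E then (d + 1) * Fintype.card F else 0) := by
        apply Finset.sum_le_sum
        intro w' hw'
        by_cases h : w' ∈ E
        · rw [if_pos h]
          have := card_Bset G w (π w) d hw hd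
          have h2 := Finset.card_filter_le (Bset G w (π w)) (fun v => dot w' v = dot w v)
          linarith
        · rw [if_neg h, add_zero]
          rw [hE, Finset.mem_filter] at h
          push Not at h
          obtain ⟨v₁, hv1, hv2⟩ := h hw'
          refine le_trans ?_ (card_ker2 (w - π w) (w - w') v₁ (ne_of_not_cons hw) hv1 hv2)
          apply Finset.card_le_card
          intro v hv
          rw [Finset.mem_filter, Bset, Finset.mem_filter] at hv
          rw [Finset.mem_filter]
          refine ⟨Finset.mem_univ _, ?_, ?_⟩
          · rw [dot_sub_left, hv.1.2.2.1, sub_self]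
          · rw [dot_sub_left, hv.2, sub_self]
    _ ≤ _ := by
        rw [Finset.sum_add_distrib, Finset.sum_const, smul_eq_mul, ← Finset.sum_filter,
          Finset.sum_const, smul_eq_mul]
        apply Nat.add_le_add_left
        apply Nat.mul_le_mul_right
        refine le_trans (Finset.card_le_card ?_) hEc
        intro x hx
        exact (Finset.mem_filter.mp hx).2

end Helpers
end Paper

namespace Paper
set_option linter.unusedSectionVars false
section Helpers
open Classical

variable {F K : Type*} [Field F] [Fintype F]

lemma card_line (w w' : F × F × F) (h : w ≠ w') :
    (Finset.univ.filter (fun p : F × F => dot w (p.1, p.2, 1) = dot w' (p.1, p.2, 1))).card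
      ≤ Fintype.card F := by
  obtain ⟨a, b, c⟩ := w
  obtain ⟨a', b', c'⟩ := w'
  rw [← Finset.card_univ]
  by_cases hb : b = b'
  · by_cases ha : a = a'
    · subst ha; subst hb
      have hc : c ≠ c' := by rintro rfl; exact h rfl
      rw [Finset.filter_false_of_mem]
      · simp
      · intro p _ he
        simp [dot] at he
        exact hc he
    · apply Finset.card_le_card_of_injOn (fun p => p.2) (by intro _ _; simp)
      rintro ⟨x, y⟩ h1 ⟨x', y'⟩ h2 he
      simp only [Finset.coe_filter, Finset.mem_univ, true_and, Set.mem_ofPred_eq] at h1 h2 he; simp only [dot] at h1 h2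
      subst he
      have : (a - a') * x = (a - a') * x' := by linear_combination h1 - h2
      rw [mul_right_inj' (sub_ne_zero.mpr ha)] at this
      rw [this]
  · apply Finset.card_le_card_of_injOn (fun p => p.1) (by intro _ _; simp)
    rintro ⟨x, y⟩ h1 ⟨x', y'⟩ h2 he
    simp only [Finset.coe_filter, Finset.mem_univ, true_and, Set.mem_ofPred_eq] at h1 h2 he; simp only [dot] at h1 h2
    subst he
    have : (b - b') * y = (b - b') * y' := by linear_combination h1 - h2
    rw [mul_right_inj' (sub_ne_zero.mpr hb)] at this
    rw [this]

lemma pairs_lower (G : F × F × F → F → F → K) (S : Finset (F × F × F)) (f : F → F → F → K)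
    (e : ℝ) (he : 0 ≤ e) (d : ℕ)
    (hA : ∀ w ∈ S, e ≤ ((Finset.univ.filter (fun p : F × F =>
      f p.1 p.2 (dot w (p.1, p.2, 1)) = G w p.1 p.2)).card : ℝ))
    (hLL : ∀ w ∈ S, ∀ w' ∈ S, ¬ Cons G w w' → (Agset G w w').card ≤ d) :
    (e * S.card) ^ 2 ≤ (Fintype.card F : ℝ) ^ 3 * (S.card * (Fintype.card F : ℝ) ^ 2
      + d * (S.card : ℝ) ^ 2 + Fintype.card F *
        ∑ w ∈ S, ((S.filter (fun w' => Cons G w w')).card : ℝ)) := by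
  set J : F × F × F → F × F × F → Prop :=
    fun w p => dot w (p.1, p.2.1, 1) = p.2.2 ∧ f p.1 p.2.1 p.2.2 = G w p.1 p.2.1 with hJ
  have hdeg : ∀ x, ((S.filter (fun s => J s x)).card : ℝ) = ∑ s ∈ S, if J s x then (1:ℝ) else 0 := by
    intro x
    rw [Finset.card_filter]; push_cast; rfl
  have h1 : e * S.card ≤ ∑ x, ((S.filter (fun s => J s x)).card : ℝ) := by
    simp_rw [hdeg]
    rw [Finset.sum_comm, mul_comm, ← nsmul_eq_mul, ← Finset.sum_const]
    apply Finset.sum_le_sum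
    intro w hw
    refine le_trans (hA w hw) ?_
    have : ∑ x, (if J w x then (1:ℝ) else 0) = ((Finset.univ.filter (fun x => J w x)).card : ℝ) := by
      rw [Finset.card_filter]; push_cast; rfl
    rw [this]
    norm_cast
    apply Finset.card_le_card_of_injOn (fun p => (p.1, p.2, dot w (p.1, p.2, 1)))
    · intro p hp
      rw [Finset.mem_coe, Finset.mem_filter] at hp ⊢
      exact ⟨Finset.mem_univ _, rfl, hp.2⟩
    · rintro ⟨x, y⟩ _ ⟨x', y'⟩ _ h
      simp only [Prod.mk.injEq] at h
      rw [h.1, h.2.1]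
  have h2 : ∑ x, ((S.filter (fun s => J s x)).card : ℝ) ^ 2
        = ∑ s ∈ S, ∑ s' ∈ S, ((Finset.univ.filter (fun x => J s x ∧ J s' x)).card : ℝ) := by
    simp_rw [hdeg, sq, Finset.sum_mul_sum]
    rw [Finset.sum_comm]
    apply Finset.sum_congr rfl
    intro s _
    rw [Finset.sum_comm]
    apply Finset.sum_congr rfl
    intro s' _
    rw [Finset.card_filter]; push_cast
    apply Finset.sum_congr rfl
    intro x _
    by_cases h1 : J s x <;> by_cases h2 : J s' x <;> simp [h1, h2]
  have hproj : ∀ w w', ((Finset.univ.filter (fun x => J w x ∧ J w' x)).card) ≤ (Agset G w w').card := by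
    intro w w'
    apply Finset.card_le_card_of_injOn (fun p => (p.1, p.2.1))
    · intro p hp
      rw [Finset.mem_coe, Finset.mem_filter] at hp
      rw [Finset.mem_coe, Agset, Finset.mem_filter]
      exact ⟨Finset.mem_univ _, by rw [hp.2.1.1, hp.2.2.1], by rw [← hp.2.1.2, hp.2.2.2]⟩
    · rintro ⟨x, y, z⟩ hp ⟨x', y', z'⟩ hp' h
      rw [Finset.mem_coe, Finset.mem_filter] at hp hp'
      simp only [Prod.mk.injEq] at h
      obtain ⟨rfl, rfl⟩ := h
      have a1 := hp.2.1.1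
      have a2 := hp'.2.1.1
      simp only at a1 a2
      rw [← a1, ← a2]
  have hterm : ∀ w ∈ S, ∀ w' ∈ S, ((Finset.univ.filter (fun x => J w x ∧ J w' x)).card : ℝ) ≤
      (if w = w' then (Fintype.card F : ℝ) ^ 2 else 0) + d +
        Fintype.card F * (if Cons G w w' then 1 else 0) := by
    intro w hw w' hw'
    have hp : ((Finset.univ.filter (fun x => J w x ∧ J w' x)).card : ℝ) ≤ (Agset G w w').card := by
      exact_mod_cast hproj w w'
    by_cases heq : w = w'
    · subst heq
      have : ((Agset G w w).card : ℝ) ≤ (Fintype.card F : ℝ) ^ 2 := by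
        have := Finset.card_le_univ (Agset G w w)
        rw [Fintype.card_prod, ← sq] at this
        exact_mod_cast this
      rw [if_pos rfl]
      have : (0:ℝ) ≤ Fintype.card F * (if Cons G w w then 1 else 0) := by positivity
      have : (0:ℝ) ≤ d := by positivity
      linarith
    · rw [if_neg heq]
      by_cases hc : Cons G w w'
      · rw [if_pos hc]
        have : ((Agset G w w').card : ℝ) ≤ Fintype.card F := by
          have := card_line w w' heq
          have h3 : (Agset G w w').card ≤ Fintype.card F := by
            refine le_trans (Finset.card_le_card ?_) this
            intro p hp
            rw [Agset, Finset.mem_filter] at hp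
            rw [Finset.mem_filter]
            exact ⟨hp.1, hp.2.1⟩
          exact_mod_cast h3
        have : (0:ℝ) ≤ d := by positivity
        linarith
      · rw [if_neg hc]
        have : ((Agset G w w').card : ℝ) ≤ d := by exact_mod_cast hLL w hw w' hw' hc
        linarith
  have h3 : ∑ x, ((S.filter (fun s => J s x)).card : ℝ) ^ 2 ≤ S.card * (Fintype.card F : ℝ) ^ 2
      + d * (S.card : ℝ) ^ 2 + Fintype.card F *
        ∑ w ∈ S, ((S.filter (fun w' => Cons G w w')).card : ℝ) := by
    rw [h2]
    refine le_trans (Finset.sum_le_sum fun w hw => Finset.sum_le_sum fun w' hw' => hterm w hw w' hw') ?_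
    simp only [Finset.sum_add_distrib, Finset.sum_ite_eq, Finset.sum_const, nsmul_eq_mul,
      ← Finset.mul_sum]
    rw [Finset.sum_congr rfl (fun x hx => if_pos hx)]
    simp only [Finset.sum_const, nsmul_eq_mul, Finset.sum_boole]
    apply le_of_eq; ring
  have h4 := sq_sum_le_card_mul_sum_sq (s := (Finset.univ : Finset (F × F × F)))
    (f := fun x => ((S.filter (fun s => J s x)).card : ℝ))
  have hX : ((Finset.univ : Finset (F × F × F)).card : ℝ) = (Fintype.card F : ℝ) ^ 3 := by
    rw [Finset.card_univ]; simp only [Fintype.card_prod]; push_cast; ring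
  rw [hX] at h4
  calc (e * S.card) ^ 2 ≤ (∑ x, ((S.filter (fun s => J s x)).card : ℝ)) ^ 2 := by
        apply pow_le_pow_left₀ (by positivity) h1
    _ ≤ _ := h4
    _ ≤ _ := by apply mul_le_mul_of_nonneg_left h3; positivity


end Helpers
end Paper

namespace Paper
set_option linter.unusedSectionVars false
section Helpers
open Classical

variable {F K : Type*} [Field F] [Fintype F]

/-- Bound on the number of bad triples. -/
lemma bad_triples (G : F × F × F → F → F → K) (S : Finset (F × F × F)) (d : ℕ)
    (hLL : ∀ w ∈ S, ∀ w' ∈ S, ¬ Cons G w w' → (Agset G w w').card ≤ d) :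
    ((Fintype.card F - 1 : ℕ) : ℝ) * ∑ w₁ ∈ S, ∑ w₂ ∈ S,
      (if Cons G w₁ w₂ then (0:ℝ) else
        ((S.filter (fun w => Cons G w₁ w ∧ Cons G w₂ w)).card : ℝ)) ≤
      2 * (d + 1) * (S.card : ℝ) ^ 3 + 4 * (Fintype.card F : ℝ) ^ 5 * S.card := by
  have hq : (0:ℝ) < Fintype.card F := by exact_mod_cast card_pos_F
  set q : ℝ := ((Fintype.card F : ℕ) : ℝ) with hqdef
  set D : ℝ := S.card / q with hD
  have hD0 : 0 ≤ D := by positivity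
  obtain ⟨deg, hdeg⟩ : ∃ deg : (F × F × F) × F → ℝ, ∀ u, deg u =
      ((S.filter (fun w => dot w u.1 = u.2)).card : ℝ) := ⟨_, fun _ => rfl⟩
  have hdeg0 : ∀ u, 0 ≤ deg u := by intro u; rw [hdeg]; exact Nat.cast_nonneg _
  obtain ⟨E, hE⟩ : ∃ E : (F × F × F) × F → ℝ, ∀ u, E u =
      if 2 * D < deg u ∧ u.1 ≠ 0 then deg u else 0 := ⟨_, fun _ => rfl⟩
  have hE0 : ∀ u, 0 ≤ E u := by
    intro u; rw [hE]; split_ifs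
    · exact hdeg0 u
    · exact le_rfl
  have step1 : ∀ w₁ ∈ S, ∀ w₂ ∈ S, ((Fintype.card F - 1 : ℕ) : ℝ) *
      (if Cons G w₁ w₂ then (0:ℝ) else
        ((S.filter (fun w => Cons G w₁ w ∧ Cons G w₂ w)).card : ℝ)) ≤
      (d + 1) * q * (2 * D) + ∑ v, if dot w₂ v = dot w₁ v then E (v, dot w₁ v) else 0 := by
    intro w₁ hw1 w₂ hw2
    have hnn : (0:ℝ) ≤ ∑ v, if dot w₂ v = dot w₁ v then E (v, dot w₁ v) else 0 := by
      apply Finset.sum_nonneg; intro v _; split_ifs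
      · exact hE0 _
      · exact le_rfl
    by_cases hc : Cons G w₁ w₂
    · rw [if_pos hc, mul_zero]
      have : 0 ≤ ((d:ℝ) + 1) * q * (2 * D) := by positivity
      linarith
    · rw [if_neg hc]
      have h1 := common_nbr_sum G S w₁ w₂
      have h1' : ((Fintype.card F - 1 : ℕ) : ℝ) *
          ((S.filter (fun w => Cons G w₁ w ∧ Cons G w₂ w)).card : ℝ) ≤
          ∑ v ∈ Bset G w₁ w₂, deg (v, dot w₁ v) := by
        simp only [hdeg]; exact_mod_cast h1
      refine le_trans h1' ?_
      have h2 : ∀ v ∈ Bset G w₁ w₂, deg (v, dot w₁ v) ≤ 2 * D + E (v, dot w₁ v) := by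
        intro v hv
        rw [Bset, Finset.mem_filter] at hv
        rw [hE]
        by_cases h : 2 * D < deg (v, dot w₁ v)
        · rw [if_pos ⟨h, hv.2.1⟩]; linarith
        · rw [if_neg (fun h' => h h'.1)]; push Not at h; linarith
      refine le_trans (Finset.sum_le_sum h2) ?_
      rw [Finset.sum_add_distrib, Finset.sum_const, nsmul_eq_mul]
      apply add_le_add
      · apply mul_le_mul_of_nonneg_right _ (by positivity)
        have := card_Bset G w₁ w₂ d hc (hLL w₁ hw1 w₂ hw2 hc)
        rw [hqdef]; exact_mod_cast this
      · rw [← Finset.sum_filter]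
        apply Finset.sum_le_sum_of_subset_of_nonneg
        · intro v hv
          rw [Bset, Finset.mem_filter] at hv
          rw [Finset.mem_filter]
          exact ⟨Finset.mem_univ _, hv.2.2.1.symm⟩
        · intro _ _ _; exact hE0 _
  rw [Finset.mul_sum]
  simp_rw [Finset.mul_sum]
  refine le_trans (Finset.sum_le_sum fun w hw => Finset.sum_le_sum fun w' hw' => step1 w hw w' hw') ?_
  simp only [Finset.sum_add_distrib, Finset.sum_const, nsmul_eq_mul]
  have e1 : (S.card : ℝ) * (S.card * ((d + 1) * q * (2 * D))) = 2 * (d + 1) * (S.card : ℝ) ^ 3 := by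
    rw [hD]; field_simp
  rw [e1]
  apply add_le_add le_rfl
  have e2 : ∑ w₁ ∈ S, ∑ w₂ ∈ S, ∑ v, (if dot w₂ v = dot w₁ v then E (v, dot w₁ v) else 0)
      = ∑ u : (F × F × F) × F, E u * (deg u) ^ 2 := by
    have : ∀ w₁ w₂ v, (if dot w₂ v = dot w₁ v then E (v, dot w₁ v) else 0) =
        ∑ t, (if dot w₁ v = t then (1:ℝ) else 0) * (if dot w₂ v = t then 1 else 0) * E (v, t) := by
      intro w₁ w₂ v
      rw [Finset.sum_eq_single (dot w₁ v)]
      · by_cases h : dot w₂ v = dot w₁ v <;> simp [h]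
      · intro t _ ht; rw [if_neg ht.symm]; ring
      · intro h; exact absurd (Finset.mem_univ _) h
    simp_rw [this]
    rw [Fintype.sum_prod_type]
    have hdeg' : ∀ u, deg u = ∑ s ∈ S, if dot s u.1 = u.2 then (1:ℝ) else 0 := by
      intro x
      simp only [hdeg]
      rw [Finset.card_filter]; push_cast; rfl
    calc _ = ∑ w₁ ∈ S, ∑ v, ∑ t, ∑ w₂ ∈ S, (if dot w₁ v = t then (1:ℝ) else 0) * (if dot w₂ v = t then 1 else 0) * E (v, t) := by
          apply Finset.sum_congr rfl; intro w₁ _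
          rw [Finset.sum_comm]
          apply Finset.sum_congr rfl; intro v _
          rw [Finset.sum_comm]
      _ = ∑ v, ∑ t, ∑ w₁ ∈ S, ∑ w₂ ∈ S, (if dot w₁ v = t then (1:ℝ) else 0) * (if dot w₂ v = t then 1 else 0) * E (v, t) := by
          rw [Finset.sum_comm]
          apply Finset.sum_congr rfl; intro v _
          rw [Finset.sum_comm]
      _ = _ := by
          apply Finset.sum_congr rfl; intro v _
          apply Finset.sum_congr rfl; intro t _
          rw [hdeg' (v, t), sq, Finset.sum_mul_sum, Finset.mul_sum]
          apply Finset.sum_congr rfl; intro w₁ _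
          rw [Finset.mul_sum]
          apply Finset.sum_congr rfl; intro w₂ _
          ring
  rw [e2]
  have hdev : ∑ u, (deg u - D) ^ 2 ≤ q ^ 3 * S.card := by
    have := deg_dev S
    simp only [hdeg]; exact this
  calc _ ≤ ∑ u, 4 * q ^ 2 * (deg u - D) ^ 2 := by
        apply Finset.sum_le_sum
        intro u _
        rw [hE]
        split_ifs with h
        · have hdq : deg u ≤ q ^ 2 := by
            simp only [hdeg, hqdef]; exact_mod_cast deg_le S u.1 h.2 u.2
          have hd0 := hdeg0 u
          have h3 : deg u ^ 2 ≤ 4 * (deg u - D) ^ 2 := by nlinarith [h.1]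
          have := mul_le_mul hdq h3 (by positivity) (by positivity)
          linarith
        · rw [zero_mul]; exact mul_nonneg (by positivity) (sq_nonneg _)
    _ = 4 * q ^ 2 * ∑ u, (deg u - D) ^ 2 := by rw [Finset.mul_sum]
    _ ≤ 4 * q ^ 2 * (q ^ 3 * S.card) := by
        apply mul_le_mul_of_nonneg_left (hdev); positivity
    _ = _ := by ring




end Helpers
end Paper

namespace Paper
set_option linter.unusedSectionVars false
section Helpers
open Classical

/-- Some neighbourhood is large and nearly a clique. -/
lemma graph_step {α : Type*} (S : Finset α) (R : α → α → Prop) (hsym : ∀ a b, R a b → R b a)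
    (κ γ : ℝ) (hκ : 0 ≤ κ) (hS : 0 < S.card)
    (h1 : κ * (S.card : ℝ) ^ 2 ≤ ∑ w ∈ S, ((S.filter (fun w' => R w w')).card : ℝ))
    (h2 : ∑ w₁ ∈ S, ∑ w₂ ∈ S, (if R w₁ w₂ then (0:ℝ) else
        ((S.filter (fun w => R w₁ w ∧ R w₂ w)).card : ℝ)) ≤ γ * (S.card : ℝ) ^ 3) :
    ∃ v ∈ S, (κ ^ 2 - 1000 * γ) * (S.card : ℝ) ^ 2 ≤
      ((S.filter (fun w' => R v w')).card : ℝ) ^ 2 - 1000 *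
        ∑ w₁ ∈ S.filter (fun w' => R v w'), ∑ w₂ ∈ S.filter (fun w' => R v w'),
          (if R w₁ w₂ then (0:ℝ) else 1) := by
  by_contra hcon
  push Not at hcon
  have hn : (0:ℝ) < S.card := by exact_mod_cast hS
  have hne : S.Nonempty := Finset.card_pos.mp hS
  have h3 := Finset.sum_lt_sum_of_nonempty hne hcon
  rw [Finset.sum_sub_distrib, ← Finset.mul_sum, Finset.sum_const, nsmul_eq_mul] at h3
  have h4 := sq_sum_le_card_mul_sum_sq (s := S)
    (f := fun w => ((S.filter (fun w' => R w w')).card : ℝ))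
  have h5 : (κ * (S.card : ℝ) ^ 2) ^ 2 ≤ S.card * ∑ w ∈ S, ((S.filter (fun w' => R w w')).card : ℝ) ^ 2 :=
    le_trans (pow_le_pow_left₀ (by positivity) h1 2) h4
  have h6 : κ ^ 2 * (S.card : ℝ) ^ 3 ≤ ∑ w ∈ S, ((S.filter (fun w' => R w w')).card : ℝ) ^ 2 := by
    refine le_of_mul_le_mul_left ?_ hn
    refine le_trans (le_of_eq ?_) h5
    ring
  have h7 : ∑ v ∈ S, ∑ w₁ ∈ S.filter (fun w' => R v w'), ∑ w₂ ∈ S.filter (fun w' => R v w'),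
          (if R w₁ w₂ then (0:ℝ) else 1) = ∑ w₁ ∈ S, ∑ w₂ ∈ S, (if R w₁ w₂ then (0:ℝ) else
        ((S.filter (fun w => R w₁ w ∧ R w₂ w)).card : ℝ)) := by
    simp only [Finset.sum_filter]
    rw [Finset.sum_comm]
    apply Finset.sum_congr rfl; intro w₁ _
    have : ∀ v, (if R v w₁ then ∑ w₂ ∈ S, (if R v w₂ then (if R w₁ w₂ then (0:ℝ) else 1) else 0) else 0)
        = ∑ w₂ ∈ S, if R v w₁ then (if R v w₂ then (if R w₁ w₂ then (0:ℝ) else 1) else 0) else 0 := by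
      intro v; by_cases h : R v w₁ <;> simp [h]
    simp_rw [this]
    rw [Finset.sum_comm]
    apply Finset.sum_congr rfl; intro w₂ _
    by_cases h : R w₁ w₂
    · simp [h]
    · simp only [h, if_false]
      rw [Finset.card_filter]
      push_cast
      apply Finset.sum_congr rfl; intro v _
      by_cases ha : R v w₁ <;> by_cases hb : R v w₂
      · simp [ha, hb, hsym _ _ ha, hsym _ _ hb]
      · have : ¬ R w₂ v := fun h => hb (hsym _ _ h)
        simp [ha, hb, this]
      · have : ¬ R w₁ v := fun h => ha (hsym _ _ h)
        simp [ha, this]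
      · have : ¬ R w₁ v := fun h => ha (hsym _ _ h)
        simp [ha, this]
  rw [h7] at h3
  have e : (S.card : ℝ) * ((κ ^ 2 - 1000 * γ) * (S.card : ℝ) ^ 2) = κ ^ 2 * (S.card:ℝ) ^ 3 - 1000 * (γ * (S.card:ℝ) ^ 3) := by ring
  linarith

variable {F K : Type*} [Field F] [Fintype F]

/-- The total multiplicity estimate behind the clique step. -/
lemma V_bound (G : F × F × F → F → F → K) (S V : Finset (F × F × F)) (d : ℕ)
    (π : F × F × F → F × F × F)
    (hV : ∀ w ∈ V, ¬ Cons G w (π w) ∧ (Agset G w (π w)).card ≤ d)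
    (hc : ∀ w ∈ V, (0.9:ℝ) * S.card ≤ ((S.filter (fun w' => Cons G w w' ∧ Cons G (π w) w')).card : ℝ))
    (hd : 100 * ((d:ℝ) + 1) ≤ Fintype.card F)
    (hS : 118 * (Fintype.card F : ℝ) ^ 2 ≤ S.card) :
    74 * (V.card : ℝ) ≤ Fintype.card F * (d + 1) := by
  have hq : (0:ℝ) < Fintype.card F := by exact_mod_cast card_pos_F
  have hq1 : (((Fintype.card F - 1 : ℕ)) : ℝ) = Fintype.card F - 1 := by
    rw [Nat.cast_sub (Nat.succ_le_of_lt card_pos_F)]; simp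
  obtain ⟨deg, hdeg⟩ : ∃ deg : (F × F × F) × F → ℝ, ∀ u, deg u =
      ((S.filter (fun w => dot w u.1 = u.2)).card : ℝ) := ⟨_, fun _ => rfl⟩
  obtain ⟨m, hm⟩ : ∃ m : (F × F × F) × F → ℝ, ∀ u, m u =
      ∑ w ∈ V, (if u.1 ∈ Bset G w (π w) ∧ dot w u.1 = u.2 then (1:ℝ) else 0) := ⟨_, fun _ => rfl⟩
  have hdev := deg_dev S
  simp only [← hdeg] at hdev
  -- key sum exchange
  have key : ∀ g : (F × F × F) × F → ℝ, ∑ u, m u * g u =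
      ∑ w ∈ V, ∑ v ∈ Bset G w (π w), g (v, dot w v) := by
    intro g
    simp only [hm, Finset.sum_mul]
    rw [Finset.sum_comm]
    apply Finset.sum_congr rfl; intro w _
    rw [Fintype.sum_prod_type, ← Finset.sum_filter_add_sum_filter_not Finset.univ (fun v => v ∈ Bset G w (π w))]
    have z : ∑ v ∈ Finset.univ.filter (fun v => ¬ v ∈ Bset G w (π w)), ∑ t, (if v ∈ Bset G w (π w) ∧ dot w v = t then (1:ℝ) else 0) * g (v, t) = 0 := by
      apply Finset.sum_eq_zero; intro v hv
      rw [Finset.mem_filter] at hv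
      apply Finset.sum_eq_zero; intro t _
      rw [if_neg (fun h => hv.2 h.1), zero_mul]
    simp only at z ⊢
    rw [z, add_zero, Finset.filter_mem_eq_inter, Finset.univ_inter]
    apply Finset.sum_congr rfl; intro v hv
    rw [Finset.sum_eq_single (dot w v)]
    · rw [if_pos ⟨hv, rfl⟩, one_mul]
    · intro t _ ht; rw [if_neg (fun h => ht h.2.symm), zero_mul]
    · intro h; exact absurd (Finset.mem_univ _) h
  have hm1 : ∑ u, m u ≤ V.card * ((d + 1) * Fintype.card F) := by
    have := key (fun _ => 1)
    simp only [mul_one, Finset.sum_const, nsmul_eq_mul] at this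
    rw [this]
    rw [← nsmul_eq_mul]
    apply Finset.sum_le_card_nsmul
    intro w hw
    have := card_Bset G w (π w) d (hV w hw).1 (hV w hw).2
    exact_mod_cast this
  have hm2 : ∑ u, m u ^ 2 ≤ V.card * (V.card * Fintype.card F + Fintype.card F * ((d + 1) * Fintype.card F)) := by
    have := key m
    simp only [sq]
    rw [this, ← nsmul_eq_mul]
    apply Finset.sum_le_card_nsmul
    intro w hw
    have h := sum_inter G V π d w (hV w hw).1 (hV w hw).2
    have h' : ∑ w' ∈ V, (((Bset G w (π w)).filter (fun v => dot w' v = dot w v)).card : ℝ) ≤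
      V.card * Fintype.card F + Fintype.card F * ((d + 1) * Fintype.card F) := by exact_mod_cast h
    refine le_trans ?_ h'
    simp only [hm]
    rw [Finset.sum_comm]
    apply Finset.sum_le_sum
    intro w' _
    rw [Finset.card_filter]
    push_cast
    apply Finset.sum_le_sum
    intro v _
    split_ifs with h1 h2 h2
    · exact le_rfl
    · exact absurd h1.2 h2
    · exact zero_le_one
    · exact le_rfl
  have hlow : (Fintype.card F - 1 : ℝ) * (0.9 * S.card) * V.card ≤ ∑ u, m u * deg u := by
    rw [key, mul_comm, ← nsmul_eq_mul]
    apply Finset.card_nsmul_le_sum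
    intro w hw
    have h := common_nbr_sum G S w (π w)
    have h' : ((Fintype.card F - 1 : ℕ) : ℝ) *
          ((S.filter (fun w' => Cons G w w' ∧ Cons G (π w) w')).card : ℝ) ≤
          ∑ v ∈ Bset G w (π w), deg (v, dot w v) := by
      simp only [hdeg]; exact_mod_cast h
    refine le_trans ?_ h'
    rw [hq1]
    apply mul_le_mul_of_nonneg_left (hc w hw)
    rw [← hq1]; exact Nat.cast_nonneg _
  have hCS := Finset.sum_mul_sq_le_sq_mul_sq Finset.univ m (fun u => deg u - (S.card : ℝ) / Fintype.card F)
  have hsplit : ∑ u, m u * (deg u - (S.card : ℝ) / Fintype.card F) = ∑ u, m u * deg u - (∑ u, m u) * ((S.card : ℝ) / Fintype.card F) := by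
    rw [Finset.sum_mul, ← Finset.sum_sub_distrib]
    apply Finset.sum_congr rfl; intro u _; ring
  generalize hX : ∑ u, m u * (deg u - (S.card : ℝ) / Fintype.card F) = X at *
  generalize ∑ u, m u * deg u = Y at *
  have hm2' := hCS.trans (mul_le_mul hm2 hdev (Finset.sum_nonneg fun _ _ => sq_nonneg _) (by positivity))
  have hm1' : (∑ u, m u) * ((S.card : ℝ) / Fintype.card F) ≤ V.card * (d + 1) * S.card := by
    refine le_trans (mul_le_mul_of_nonneg_right hm1 (by positivity)) (le_of_eq ?_)
    field_simp
  generalize (∑ u, m u) * ((S.card : ℝ) / Fintype.card F) = Z at *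
  clear hCS hm2 hm1 hdev key hm hdeg
  rcases Nat.eq_zero_or_pos V.card with h0 | h0
  · rw [h0]; simp; positivity
  have ha : (0:ℝ) < V.card := by exact_mod_cast h0
  generalize (V.card : ℝ) = a at *
  generalize (S.card : ℝ) = n at *
  generalize (Fintype.card F : ℝ) = q at *
  have hd0 : (0:ℝ) ≤ d := Nat.cast_nonneg d
  generalize (d : ℝ) = δ at *
  have hn : 0 < n := by nlinarith
  have hna : 0 < n * a := by positivity
  have hX1 : 0.8 * q * (n * a) ≤ X := by
    rw [hsplit]
    have : 0.8 * q * (n * a) ≤ (0.9 * (q - 1) - (δ + 1)) * (n * a) := by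
      apply mul_le_mul_of_nonneg_right _ hna.le
      linarith
    nlinarith
  have hX2 : (0.8 * q * (n * a)) ^ 2 ≤ a * (a * q + q * ((δ + 1) * q)) * (q ^ 3 * n) :=
    le_trans (pow_le_pow_left₀ (by positivity) hX1 2) hm2'
  have h9 : 0.64 * (n * a) ≤ a * q ^ 2 + q ^ 3 * (δ + 1) := by
    have hp : 0 < q ^ 2 * (n * a) := by positivity
    refine le_of_mul_le_mul_left ?_ hp
    refine le_trans (le_of_eq ?_) (le_trans hX2 (le_of_eq ?_)) <;> ring
  have h10 : 118 * q ^ 2 * a ≤ n * a := mul_le_mul_of_nonneg_right hS ha.le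
  have h11 : q ^ 2 * (74 * a) ≤ q ^ 2 * (q * (δ + 1)) := by nlinarith [mul_pos (pow_pos hq 2) ha]
  exact le_of_mul_le_mul_left h11 (by positivity)

end Helpers
end Paper

namespace Paper
set_option linter.unusedSectionVars false
section Helpers
open Classical

variable {F K : Type*} [Field F] [Fintype F]

lemma clique_step (G : F × F × F → F → F → K) (S : Finset (F × F × F)) (d : ℕ)
    (hLL : ∀ w ∈ S, ∀ w' ∈ S, ¬ Cons G w w' → (Agset G w w').card ≤ d)
    (hd : 100 * ((d:ℝ) + 1) ≤ Fintype.card F)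
    (hS : 118 * (Fintype.card F : ℝ) ^ 2 ≤ S.card)
    (hbad : 1000 * ∑ w₁ ∈ S, ∑ w₂ ∈ S, (if Cons G w₁ w₂ then (0:ℝ) else 1) ≤ (S.card : ℝ) ^ 2) :
    ∃ T ⊆ S, (∀ w ∈ T, ∀ w' ∈ T, Cons G w w') ∧ 100 * (Fintype.card F : ℝ) ^ 2 ≤ T.card := by
  have hq : (0:ℝ) < Fintype.card F := by exact_mod_cast card_pos_F
  have hn : (0:ℝ) < S.card := lt_of_lt_of_le (by positivity) hS
  obtain ⟨nd, hnd⟩ : ∃ nd : F × F × F → ℝ, ∀ w, nd w = ((S.filter (fun w' => ¬ Cons G w w')).card : ℝ) :=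
    ⟨_, fun _ => rfl⟩
  have hnd' : ∀ w, ∑ w₂ ∈ S, (if Cons G w w₂ then (0:ℝ) else 1) = nd w := by
    intro w
    rw [hnd, Finset.card_filter]; push_cast
    apply Finset.sum_congr rfl; intro v _
    by_cases h : Cons G w v <;> simp [h]
  simp only [hnd'] at hbad
  have hnd0 : ∀ w, 0 ≤ nd w := fun w => by rw [hnd]; exact Nat.cast_nonneg _
  set T0 := S.filter (fun w => nd w ≤ S.card / 20) with hT0
  set T1 := S.filter (fun w => ¬ nd w ≤ S.card / 20) with hT1
  have hc1 : T0.card + T1.card = S.card := Finset.card_filter_add_card_filter_not _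
  have hT1c : (T1.card : ℝ) * (S.card / 20) ≤ ∑ w ∈ S, nd w := by
    calc (T1.card : ℝ) * (S.card / 20) ≤ ∑ w ∈ T1, nd w := by
          rw [← nsmul_eq_mul]
          apply Finset.card_nsmul_le_sum
          intro w hw
          rw [hT1, Finset.mem_filter] at hw
          exact (not_le.mp hw.2).le
      _ ≤ _ := Finset.sum_le_sum_of_subset_of_nonneg (Finset.filter_subset _ _) (fun _ _ _ => hnd0 _)
  have hT1c' : (T1.card : ℝ) ≤ S.card / 50 := by
    have : (S.card : ℝ) * T1.card ≤ S.card * (S.card / 50) := by nlinarith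
    exact le_of_mul_le_mul_left this hn
  have hex : ∀ w, ∃ w', (w ∈ T0 ∧ ∃ w' ∈ T0, ¬ Cons G w w') → (w' ∈ T0 ∧ ¬ Cons G w w') := by
    intro w
    by_cases h : w ∈ T0 ∧ ∃ w' ∈ T0, ¬ Cons G w w'
    · obtain ⟨_, w', h1, h2⟩ := h
      exact ⟨w', fun _ => ⟨h1, h2⟩⟩
    · exact ⟨w, fun h' => absurd h' h⟩
  choose π hπ using hex
  set V := T0.filter (fun w => ∃ w' ∈ T0, ¬ Cons G w w') with hV
  have hmV : ∀ w ∈ V, w ∈ T0 ∧ π w ∈ T0 ∧ ¬ Cons G w (π w) := by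
    intro w hw
    rw [hV, Finset.mem_filter] at hw
    exact ⟨hw.1, hπ w hw⟩
  have hT0S : T0 ⊆ S := Finset.filter_subset _ _
  have hnT0 : ∀ w ∈ T0, nd w ≤ S.card / 20 := fun w hw => by
    rw [hT0, Finset.mem_filter] at hw; exact hw.2
  have hVb := V_bound G S V d π (fun w hw => by
      obtain ⟨a, b, c⟩ := hmV w hw
      exact ⟨c, hLL _ (hT0S a) _ (hT0S b) c⟩) (fun w hw => by
      obtain ⟨a, b, c⟩ := hmV w hw
      have h1 := hnT0 _ a
      have h2 := hnT0 _ b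
      rw [hnd] at h1 h2
      have : S.card ≤ (S.filter (fun w' => Cons G w w' ∧ Cons G (π w) w')).card +
        ((S.filter (fun w' => ¬ Cons G w w')).card + (S.filter (fun w' => ¬ Cons G (π w) w')).card) := by
        refine le_trans ?_ (Nat.add_le_add_left (Finset.card_union_le _ _) _)
        refine le_trans ?_ (Finset.card_union_le _ _)
        apply Finset.card_le_card
        intro x hx
        simp only [Finset.mem_union, Finset.mem_filter]
        tauto
      have h3 : (S.card : ℝ) ≤ (S.filter (fun w' => Cons G w w' ∧ Cons G (π w) w')).card +
        ((S.filter (fun w' => ¬ Cons G w w')).card + (S.filter (fun w' => ¬ Cons G (π w) w')).card) := by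
        exact_mod_cast this
      linarith) hd hS
  refine ⟨T0.filter (fun w => ¬ ∃ w' ∈ T0, ¬ Cons G w w'), (Finset.filter_subset _ _).trans hT0S, ?_, ?_⟩
  · intro w hw w' hw'
    rw [Finset.mem_filter] at hw hw'
    by_contra h
    exact hw.2 ⟨w', hw'.1, h⟩
  · have hc2 : V.card + (T0.filter (fun w => ¬ ∃ w' ∈ T0, ¬ Cons G w w')).card = T0.card :=
      Finset.card_filter_add_card_filter_not _
    have hc1' : (T0.card : ℝ) + T1.card = S.card := by exact_mod_cast hc1
    have hc2' : (V.card : ℝ) + (T0.filter (fun w => ¬ ∃ w' ∈ T0, ¬ Cons G w w')).card = T0.card := by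
      exact_mod_cast hc2
    have hqq : 100 * (Fintype.card F * ((d:ℝ) + 1)) ≤ (Fintype.card F : ℝ) ^ 2 := by nlinarith
    linarith

/-- Combination of all the combinatorial steps. -/
lemma exists_clique (G : F × F × F → F → F → K) (S : Finset (F × F × F)) (f : F → F → F → K) (d : ℕ)
    (ε : ℝ) (hε : 0 < ε) (hε1 : ε ≤ 1)
    (hS : 99 * (Fintype.card F : ℝ) ^ 2 / ε ^ 2 ≤ S.card)
    (hag : ∀ w ∈ S, 1.2 * ε * (Fintype.card F : ℝ) ^ 2 ≤
      ((Finset.univ.filter (fun p : F × F =>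
        f p.1 p.2 (dot w (p.1, p.2, 1)) = G w p.1 p.2)).card : ℝ))
    (hLL : ∀ w ∈ S, ∀ w' ∈ S, ¬ Cons G w w' → (Agset G w w').card ≤ d)
    (hd1 : 1 ≤ d)
    (hd : 1000000 * (d:ℝ) ≤ ε ^ 4 * Fintype.card F) :
    ∃ T ⊆ S, (∀ w ∈ T, ∀ w' ∈ T, Cons G w w') ∧ 100 * (Fintype.card F : ℝ) ^ 2 ≤ T.card := by
  have hq : (0:ℝ) < Fintype.card F := by exact_mod_cast card_pos_F
  have hq1 : (((Fintype.card F - 1 : ℕ)) : ℝ) = Fintype.card F - 1 := by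
    rw [Nat.cast_sub (Nat.succ_le_of_lt card_pos_F)]; simp
  have hn : (0:ℝ) < S.card := lt_of_lt_of_le (by positivity) hS
  have p1 := pairs_lower G S f (1.2 * ε * (Fintype.card F : ℝ) ^ 2) (by positivity) d hag hLL
  have p2 := bad_triples G S d hLL
  rw [hq1] at p2
  have hd1' : (1:ℝ) ≤ d := by exact_mod_cast hd1
  have hε4 : ε ^ 4 ≤ 1 := pow_le_one₀ hε.le hε1
  have hε2 : ε ^ 2 ≤ 1 := pow_le_one₀ hε.le hε1
  have hε24 : ε ^ 4 = ε ^ 2 * ε ^ 2 := by ring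
  have hqd : 1000000 * (d:ℝ) ≤ Fintype.card F := by nlinarith
  have hS' : 99 * (Fintype.card F : ℝ) ^ 2 ≤ S.card * ε ^ 2 := by
    rwa [div_le_iff₀ (by positivity)] at hS
  have key1 : 1.4 * ε ^ 2 * (S.card : ℝ) ^ 2 ≤ ∑ w ∈ S, ((S.filter (fun w' => Cons G w w')).card : ℝ) := by
    generalize ∑ w ∈ S, ((S.filter (fun w' => Cons G w w')).card : ℝ) = Sg at *
    clear p2
    generalize (S.card : ℝ) = n at *
    generalize (Fintype.card F : ℝ) = q at *
    generalize (d:ℝ) = δ at *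
    -- (1.44 ε² q⁴ n² ≤ q³ (n q² + δ n² + q Sg)
    have a1 : q ^ 3 * (1.44 * ε ^ 2 * q * n ^ 2) ≤ q ^ 3 * (n * q ^ 2 + δ * n ^ 2 + q * Sg) := by
      refine le_trans (le_of_eq ?_) p1; ring
    have a2 := le_of_mul_le_mul_left a1 (by positivity)
    have a3 : δ * n ^ 2 ≤ 0.01 * ε ^ 2 * q * n ^ 2 := by
      apply mul_le_mul_of_nonneg_right _ (by positivity)
      nlinarith [mul_nonneg (mul_nonneg (sq_nonneg ε) (sub_nonneg.mpr hε2)) hq.le]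
    have a4 : n * q ^ 2 ≤ 0.02 * ε ^ 2 * q * n ^ 2 := by
      have : q ^ 2 ≤ q * (0.02 * ε ^ 2 * n) := by
        have : 1 ≤ q := by linarith
        have h3 : 99 * q ^ 2 * 1 ≤ n * ε ^ 2 * q := mul_le_mul hS' this (by positivity) (by positivity)
        nlinarith
      nlinarith
    have a5 : q * (1.4 * ε ^ 2 * n ^ 2) ≤ q * Sg := by nlinarith [mul_pos (mul_pos (pow_pos hε 2) hq) (pow_pos hn 2)]
    exact le_of_mul_le_mul_left a5 hq
  have key2 : ∑ w₁ ∈ S, ∑ w₂ ∈ S, (if Cons G w₁ w₂ then (0:ℝ) else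
        ((S.filter (fun w => Cons G w₁ w ∧ Cons G w₂ w)).card : ℝ)) ≤ ε ^ 4 / 2000 * (S.card : ℝ) ^ 3 := by
    generalize ∑ w₁ ∈ S, ∑ w₂ ∈ S, (if Cons G w₁ w₂ then (0:ℝ) else
        ((S.filter (fun w => Cons G w₁ w ∧ Cons G w₂ w)).card : ℝ)) = Sg at *
    clear p1 key1
    generalize (S.card : ℝ) = n at *
    generalize (Fintype.card F : ℝ) = q at *
    generalize (d:ℝ) = δ at *
    have b1 : 9801 * q ^ 4 ≤ ε ^ 4 * n ^ 2 := by
      have := pow_le_pow_left₀ (by positivity) hS' 2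
      nlinarith
    have b2 : 4 * q ^ 5 * n ≤ ε ^ 4 / 2450 * (q * n ^ 3) := by
      have := mul_le_mul_of_nonneg_right b1 (show 0 ≤ q * n by positivity)
      have h0 : 0 ≤ ε ^ 4 * (q * n ^ 3) := by positivity
      linarith
    have b3 : 2 * (δ + 1) * n ^ 3 ≤ ε ^ 4 / 250000 * (q * n ^ 3) := by
      have : 2 * (δ + 1) ≤ ε ^ 4 / 250000 * q := by linarith
      have := mul_le_mul_of_nonneg_right this (show 0 ≤ n ^ 3 by positivity)
      linarith
    have b4 : 0 ≤ ε ^ 4 * (q * n ^ 3) := by positivity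
    have b5 : (q - 1) * Sg ≤ (q - 1) * (ε ^ 4 / 2000 * n ^ 3) := by
      have : ε ^ 4 / 2000 * (0.99 * q) * n ^ 3 ≤ (ε ^ 4 / 2000) * (q - 1) * n ^ 3 := by
        apply mul_le_mul_of_nonneg_right _ (by positivity)
        apply mul_le_mul_of_nonneg_left _ (by positivity)
        linarith
      linarith
    exact le_of_mul_le_mul_left b5 (by linarith)
  obtain ⟨v, hv, hv2⟩ := graph_step S (Cons G) (fun a b h => h.symm) (1.4 * ε ^ 2) (ε ^ 4 / 2000)
    (by positivity) (by exact_mod_cast hn) key1 key2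
  set N := S.filter (fun w' => Cons G v w') with hN
  have hnb : 0 ≤ ∑ w₁ ∈ N, ∑ w₂ ∈ N, (if Cons G w₁ w₂ then (0:ℝ) else 1) := by
    apply Finset.sum_nonneg; intro _ _; apply Finset.sum_nonneg; intro _ _
    split_ifs
    · exact le_rfl
    · exact zero_le_one
  have hNS : N ⊆ S := Finset.filter_subset _ _
  have hv3 : (1.2 * ε ^ 2 * S.card) ^ 2 ≤ (N.card : ℝ) ^ 2 -
      1000 * ∑ w₁ ∈ N, ∑ w₂ ∈ N, (if Cons G w₁ w₂ then (0:ℝ) else 1) := by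
    refine le_trans ?_ hv2
    have : 0 ≤ ε ^ 4 * (S.card : ℝ) ^ 2 := by positivity
    nlinarith
  have hNc : 1.2 * ε ^ 2 * S.card ≤ N.card := by
    apply le_of_sq_le_sq _ (Nat.cast_nonneg _)
    linarith
  obtain ⟨T, hT, hT2, hT3⟩ := clique_step G N d (fun w hw w' hw' => hLL w (hNS hw) w' (hNS hw'))
    (by linarith) (by nlinarith) (by nlinarith [sq_nonneg (1.2 * ε ^ 2 * (S.card:ℝ))])
  exact ⟨T, hT.trans hNS, hT2, hT3⟩

end Helpers
end Paper

namespace Paper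
set_option linter.unusedSectionVars false
section Helpers
open Classical

open MvPolynomial in
/-- Substituting polynomials of degree at most one does not increase the degree. -/
lemma totalDegree_aeval_le {σ τ K : Type*} [Field K] (g : σ → MvPolynomial τ K)
    (hg : ∀ i, (g i).totalDegree ≤ 1) (p : MvPolynomial σ K) :
    (aeval g p).totalDegree ≤ p.totalDegree := by
  rw [aeval_def, eval₂_eq]
  apply totalDegree_finsetSum_le
  intro s hs
  refine le_trans (totalDegree_mul _ _) ?_
  rw [algebraMap_eq, totalDegree_C, zero_add]
  refine le_trans (totalDegree_finsetProd _ _) ?_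
  refine le_trans ?_ (le_totalDegree hs)
  rw [Finsupp.sum]
  apply Finset.sum_le_sum
  intro i _
  refine le_trans (totalDegree_pow _ _) ?_
  calc _ ≤ s i * 1 := Nat.mul_le_mul_left _ (hg i)
    _ = _ := mul_one _

open MvPolynomial in
lemma natDegree_aeval_le {σ K : Type*} [Field K] (g : σ → Polynomial K)
    (hg : ∀ i, (g i).natDegree ≤ 1) (p : MvPolynomial σ K) :
    (aeval g p).natDegree ≤ p.totalDegree := by
  rw [aeval_def, eval₂_eq]
  apply Polynomial.natDegree_sum_le_of_forall_le
  intro s hs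
  refine le_trans Polynomial.natDegree_mul_le ?_
  rw [Polynomial.algebraMap_eq, Polynomial.natDegree_C, zero_add]
  refine le_trans (Polynomial.natDegree_prod_le _ _) ?_
  refine le_trans ?_ (le_totalDegree hs)
  rw [Finsupp.sum]
  apply Finset.sum_le_sum
  intro i _
  refine le_trans Polynomial.natDegree_pow_le ?_
  calc _ ≤ s i * 1 := Nat.mul_le_mul_left _ (hg i)
    _ = _ := mul_one _

variable {F K : Type*} [Field F] [Fintype F] [Field K]

open MvPolynomial in
/-- A polynomial of degree `≤ d < q` vanishing at all `F`-points is zero. -/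
lemma eq_zero_of_points {σ : Type*} [Finite σ] (ι : F →+* K) (p : MvPolynomial σ K)
    (hd : p.totalDegree < Fintype.card F) (h : ∀ v : σ → F, eval (fun i => ι (v i)) p = 0) : p = 0 := by
  apply eq_zero_of_eval_zero_at_prod_finset p (fun _ => Finset.univ.image ι)
  · intro i
    rw [Finset.card_image_of_injective _ ι.injective, Finset.card_univ]
    exact lt_of_le_of_lt (degreeOf_le_totalDegree _ _) hd
  · intro x hx
    have : ∀ i, ∃ y, ι y = x i := fun i => by
      have := hx i
      simpa using this
    choose v hv using this
    have := h v
    simp only [hv] at this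
    exact this

open MvPolynomial in
/-- The line lemma. -/
lemma line_lemma {σ : Type*} (ι : F →+* K) (p : MvPolynomial σ K) (d : ℕ) (hp : p.totalDegree ≤ d)
    (u v : σ → F) (B : Finset F) (hB : d < B.card)
    (h : ∀ t ∈ B, eval (fun i => ι (u i + t * v i)) p = 0) (t : F) :
    eval (fun i => ι (u i + t * v i)) p = 0 := by
  set P : Polynomial K := aeval (fun i => Polynomial.C (ι (u i)) + Polynomial.X * Polynomial.C (ι (v i))) p with hP
  have hdeg : P.natDegree ≤ d := by
    refine le_trans (natDegree_aeval_le _ ?_ p) hp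
    intro i
    refine le_trans (Polynomial.natDegree_add_le _ _) ?_
    refine max_le ?_ ?_
    · simp
    · refine le_trans Polynomial.natDegree_mul_le ?_
      simp
  have hev : ∀ t : F, P.eval (ι t) = eval (fun i => ι (u i + t * v i)) p := by
    intro t
    rw [hP]
    clear hP hdeg P h hp
    induction p using MvPolynomial.induction_on with
    | C a => simp
    | add p q hp hq => simp only [map_add, hp, hq, Polynomial.eval_add]
    | mul_X p s hp =>
      simp only [map_mul, hp, aeval_X, eval_X, Polynomial.eval_mul, Polynomial.eval_add,
        Polynomial.eval_C, Polynomial.eval_X, map_add]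
  have hz : P = 0 := by
    apply Polynomial.eq_zero_of_natDegree_lt_card_of_eval_eq_zero' P (B.image ι)
    · intro x hx
      obtain ⟨t, ht, rfl⟩ := Finset.mem_image.mp hx
      rw [hev]; exact h t ht
    · rw [Finset.card_image_of_injective _ ι.injective]; omega
  rw [← hev, hz, Polynomial.eval_zero]

open MvPolynomial in
lemma sub_subst_dvd {σ : Type*} (i : σ) (b : K) (p : MvPolynomial σ K) :
    (X i - C b) ∣ p - aeval (fun t => if t = i then C b else X t) p := by
  induction p using MvPolynomial.induction_on with
  | C a => simp
  | add p q hp hq =>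
    rw [map_add]
    have := dvd_add hp hq
    convert this using 1; ring
  | mul_X p t hp =>
    rw [map_mul, aeval_X]
    set ψ : MvPolynomial σ K := aeval (fun t => if t = i then C b else X t) p
    have e : p * X t - ψ * (if t = i then C b else X t) = (p - ψ) * X t + ψ * (X t - (if t = i then C b else X t)) := by ring
    rw [e]
    apply dvd_add (Dvd.dvd.mul_right hp _)
    apply Dvd.dvd.mul_left
    by_cases h : t = i
    · rw [if_pos h, h]
    · rw [if_neg h, sub_self]; exact dvd_zero _

open MvPolynomial in
lemma eval_aeval' {σ τ : Type*} (x : τ → K) (g : σ → MvPolynomial τ K) (p : MvPolynomial σ K) :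
    eval x (aeval g p) = eval (fun i => eval x (g i)) p := by
  induction p using MvPolynomial.induction_on with
  | C a => simp
  | add p q hp hq => simp only [map_add, hp, hq]
  | mul_X p t hp => simp only [map_mul, hp, aeval_X, eval_X]

open MvPolynomial in
lemma dvd_of_points {σ : Type*} [Finite σ] (ι : F →+* K) (p : MvPolynomial σ K)
    (hd : p.totalDegree < Fintype.card F) (i : σ) (b : F)
    (h : ∀ v : σ → F, v i = b → eval (fun i => ι (v i)) p = 0) : (X i - C (ι b)) ∣ p := by
  have h1 := sub_subst_dvd i (ι b) p
  have h2 : aeval (fun t => if t = i then C (ι b) else X t) p = (0 : MvPolynomial σ K) := by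
    apply eq_zero_of_points ι
    · refine lt_of_le_of_lt (totalDegree_aeval_le _ ?_ p) hd
      intro t
      by_cases ht : t = i
      · simp [ht]
      · rw [if_neg ht, totalDegree_X]
    · intro v
      rw [eval_aeval']
      have := h (fun t => if t = i then b else v t) (if_pos rfl)
      rw [← this]
      congr 1
      apply congrArg
      funext t
      by_cases ht : t = i <;> simp [ht]
  rwa [h2, sub_zero] at h1

open MvPolynomial in
/-- Newton interpolation along a family of hyperplanes tangent to a parabola. -/
lemma newton {σ : Type*} [Finite σ] (ι : F →+* K) (d : ℕ) (hd : d < Fintype.card F) (i j : σ)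
    (hij : i ≠ j) (c : F) (g : F → MvPolynomial σ K) (A : Finset F)
    (hg : ∀ a ∈ A, (g a).totalDegree ≤ d)
    (hc : ∀ a ∈ A, ∀ a' ∈ A, a ≠ a' → ∀ v : σ → F, v i = a + a' → v j = a * a' + c →
      eval (fun t => ι (v t)) (g a) = eval (fun t => ι (v t)) (g a')) :
    ∃ P : MvPolynomial σ K, P.totalDegree ≤ d ∧ ∀ a ∈ A, ∀ v : σ → F,
      v j = a * v i - a ^ 2 + c → eval (fun t => ι (v t)) P = eval (fun t => ι (v t)) (g a) := by
  induction A using Finset.induction_on with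
  | empty => exact ⟨0, by simp, by simp⟩
  | insert k A hk ih =>
    obtain ⟨P, hP1, hP2⟩ := ih (fun a ha => hg a (Finset.mem_insert_of_mem ha))
      (fun a ha a' ha' => hc a (Finset.mem_insert_of_mem ha) a' (Finset.mem_insert_of_mem ha'))
    set h : F → MvPolynomial σ K := fun a => C (ι a) * X i - C (ι (a ^ 2)) + C (ι c) with hh
    have hhdeg : ∀ a, (h a).totalDegree ≤ 1 := by
      intro a
      refine le_trans (totalDegree_add _ _) (max_le (le_trans (totalDegree_sub _ _) (max_le ?_ ?_)) ?_)
      · refine le_trans (totalDegree_mul _ _) ?_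
        rw [totalDegree_C, totalDegree_X]
      · rw [totalDegree_C]; exact zero_le_one
      · rw [totalDegree_C]; exact zero_le_one
    have hhev : ∀ a (v : σ → F), eval (fun t => ι (v t)) (h a) = ι (a * v i - a ^ 2 + c) := by
      intro a v; simp [hh]
    set D : MvPolynomial σ K := aeval (fun t => if t = j then h k else X t) (g k - P) with hD
    have hDdeg : D.totalDegree ≤ d := by
      refine le_trans (totalDegree_aeval_le _ ?_ _) (le_trans (totalDegree_sub _ _)
        (max_le (hg k (Finset.mem_insert_self _ _)) hP1))
      intro t
      by_cases ht : t = j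
      · rw [if_pos ht]; exact hhdeg k
      · rw [if_neg ht, totalDegree_X]
    have hDev : ∀ v : σ → F, eval (fun t => ι (v t)) D =
        eval (fun t => ι (if t = j then k * v i - k ^ 2 + c else v t)) (g k - P) := by
      intro v
      rw [hD, eval_aeval']
      congr 1
      apply congrArg
      funext t
      by_cases ht : t = j
      · simp only [ht, if_true]; exact hhev k v
      · simp [ht]
    have hdvd : ∏ a ∈ A, (X i - C (ι (k + a))) ∣ D := by
      apply Finset.prod_dvd_of_coprime
      · intro a _ a' _ haa
        refine ⟨C ((ι a' - ι a)⁻¹), -C ((ι a' - ι a)⁻¹), ?_⟩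
        have hne : ι a' - ι a ≠ 0 := by
          rw [← map_sub]
          exact (map_ne_zero ι).mpr (sub_ne_zero.mpr (Ne.symm haa))
        have : C ((ι a' - ι a)⁻¹) * (X i - C (ι (k + a))) + -C ((ι a' - ι a)⁻¹) * (X i - C (ι (k + a')))
          = C ((ι a' - ι a)⁻¹ * (ι a' - ι a) : K) * (1 : MvPolynomial σ K) := by
          simp only [map_add, map_sub, map_mul]; ring
        rw [this, inv_mul_cancel₀ hne]; simp
      · intro a ha
        apply dvd_of_points ι D (lt_of_le_of_lt hDdeg hd)
        intro v hv
        rw [hDev, map_sub, sub_eq_zero]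
        have e1 := hc k (Finset.mem_insert_self _ _) a (Finset.mem_insert_of_mem ha)
          (by rintro rfl; exact hk ha) (fun t => if t = j then k * v i - k ^ 2 + c else v t)
          (by simp only [hij, if_false]; exact hv) (by simp only [if_true]; rw [hv]; ring)
        rw [e1]
        refine (hP2 a ha (fun t => if t = j then k * v i - k ^ 2 + c else v t) ?_).symm
        simp only [hij, if_true, if_false]; rw [hv]; ring
    obtain ⟨Q, hQ⟩ := hdvd
    by_cases hD0 : D = 0
    · refine ⟨P, hP1, ?_⟩
      intro a ha v hv
      rcases Finset.mem_insert.mp ha with rfl | ha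
      · have := hDev v
        rw [hD0, map_zero, map_sub] at this
        have e : (fun t => ι (if t = j then a * v i - a ^ 2 + c else v t)) = fun t => ι (v t) := by
          funext t
          by_cases ht : t = j
          · rw [if_pos ht, ht, hv]
          · rw [if_neg ht]
        rw [e] at this
        exact (sub_eq_zero.mp this.symm).symm
      · exact hP2 a ha v hv
    · have hne1 : ∀ b : K, (X i - C b : MvPolynomial σ K) ≠ 0 := by
        intro b hb
        have : eval (fun _ => b + 1) (X i - C b : MvPolynomial σ K) = 0 := by rw [hb, map_zero]
        simp at this
      have hdeg1 : ∀ b : K, 1 ≤ (X i - C b : MvPolynomial σ K).totalDegree := by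
        intro b
        by_contra hlt
        have h0 : (X i - C b : MvPolynomial σ K).totalDegree = 0 := by omega
        rw [totalDegree_eq_zero_iff_eq_C] at h0
        have e1 := congrArg (eval (fun _ => b + 1)) h0
        have e2 := congrArg (eval (fun _ => b)) h0
        rw [eval_C] at e1 e2
        rw [← e2] at e1
        simp at e1
      have hprodne : ∏ a ∈ A, (X i - C (ι (k + a)) : MvPolynomial σ K) ≠ 0 :=
        Finset.prod_ne_zero_iff.mpr (fun a _ => hne1 _)
      have hQne : Q ≠ 0 := by rintro rfl; rw [mul_zero] at hQ; exact hD0 hQ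
      have hdegprod : A.card ≤ (∏ a ∈ A, (X i - C (ι (k + a)) : MvPolynomial σ K)).totalDegree := by
        clear hQ hprodne hP2 hP1 hc hg hk ih
        induction A using Finset.induction_on with
        | empty => simp
        | insert a A ha ih =>
          rw [Finset.prod_insert ha, totalDegree_mul_of_isDomain (hne1 _)
            (Finset.prod_ne_zero_iff.mpr (fun a _ => hne1 _)), Finset.card_insert_of_notMem ha]
          have := hdeg1 (ι (k + a))
          omega
      have hQdeg : Q.totalDegree + A.card ≤ d := by
        rw [hQ, totalDegree_mul_of_isDomain hprodne hQne] at hDdeg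
        omega
      refine ⟨P + C (ι (∏ a ∈ A, (k - a)))⁻¹ * Q * ∏ a ∈ A, (X j - h a), ?_, ?_⟩
      · refine le_trans (totalDegree_add _ _) (max_le hP1 ?_)
        refine le_trans (totalDegree_mul _ _) ?_
        have e1 : (C (ι (∏ a ∈ A, (k - a)))⁻¹ * Q).totalDegree ≤ Q.totalDegree := by
          refine le_trans (totalDegree_mul _ _) ?_
          rw [totalDegree_C, zero_add]
        have e2 : (∏ a ∈ A, (X j - h a)).totalDegree ≤ A.card := by
          refine le_trans (totalDegree_finsetProd _ _) ?_
          rw [Finset.card_eq_sum_ones]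
          apply Finset.sum_le_sum
          intro a _
          refine le_trans (totalDegree_sub _ _) (max_le ?_ (hhdeg a))
          rw [totalDegree_X]
        omega
      · intro a ha v hv
        have hpe : eval (fun t => ι (v t)) (∏ a ∈ A, (X j - h a)) =
            ∏ b ∈ A, (ι (v j) - (ι (b * v i - b ^ 2 + c))) := by
          rw [map_prod]
          apply Finset.prod_congr rfl
          intro b _
          rw [map_sub, eval_X, hhev]
        rw [map_add, map_mul, map_mul, eval_C, hpe]
        rcases Finset.mem_insert.mp ha with rfl | ha
        · have := hDev v
          have e : (fun t => ι (if t = j then a * v i - a ^ 2 + c else v t)) = fun t => ι (v t) := by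
            funext t
            by_cases ht : t = j
            · rw [if_pos ht, ht, hv]
            · rw [if_neg ht]
          rw [e, map_sub, hQ, map_mul, map_prod] at this
          simp only [map_sub, eval_X, eval_C] at this
          have e3 : ∏ b ∈ A, (ι (v j) - (ι (b * v i - b ^ 2 + c))) =
              ι (∏ b ∈ A, (a - b)) * ∏ b ∈ A, (ι (v i) - ι (a + b)) := by
            rw [map_prod, ← Finset.prod_mul_distrib]
            apply Finset.prod_congr rfl
            intro b _
            rw [hv, ← map_sub, ← map_sub, ← map_mul]
            congr 1; ring
          rw [e3]
          have hnz : ι (∏ b ∈ A, (a - b)) ≠ 0 := by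
            rw [map_ne_zero]
            apply Finset.prod_ne_zero_iff.mpr
            intro b hb
            apply sub_ne_zero.mpr
            rintro rfl; exact hk hb
          rw [eq_sub_iff_add_eq] at this
          rw [← this]
          field_simp
          ring
        · have hz : ∏ b ∈ A, (ι (v j) - (ι (b * v i - b ^ 2 + c))) = 0 := by
            apply Finset.prod_eq_zero ha
            rw [hv, sub_self]
          rw [hz, mul_zero, add_zero]
          exact hP2 a ha v hv

end Helpers
end Paper

namespace Paper
set_option linter.unusedSectionVars false
section Helpers
open Classical

variable {F K : Type*} [Field F] [Fintype F] [Field K]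

/-- Functions `F → K` given by univariate polynomials of degree at most `d`. -/
def IsUni (ι : F →+* K) (d : ℕ) (φ : F → K) : Prop :=
  ∃ P : Polynomial K, P.natDegree ≤ d ∧ ∀ t, φ t = P.eval (ι t)

lemma IsUni.eq {ι : F →+* K} {d : ℕ} {φ ψ : F → K} (h1 : IsUni ι d φ) (h2 : IsUni ι d ψ)
    (B : Finset F) (hB : d < B.card) (h : ∀ t ∈ B, φ t = ψ t) (t : F) : φ t = ψ t := by
  obtain ⟨P, hP, hP'⟩ := h1
  obtain ⟨Q, hQ, hQ'⟩ := h2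
  have hz : P - Q = 0 := by
    apply Polynomial.eq_zero_of_natDegree_lt_card_of_eval_eq_zero' (P - Q) (B.image ι)
    · intro x hx
      obtain ⟨t, ht, rfl⟩ := Finset.mem_image.mp hx
      rw [Polynomial.eval_sub, ← hP', ← hQ', h t ht, sub_self]
    · rw [Finset.card_image_of_injective _ ι.injective]
      have := Polynomial.natDegree_sub_le P Q
      have : max P.natDegree Q.natDegree ≤ d := max_le hP hQ
      omega
  rw [hP', hQ', sub_eq_zero.mp hz]

open MvPolynomial in
lemma isUni_eval {σ : Type*} (ι : F →+* K) (p : MvPolynomial σ K) (d : ℕ) (hp : p.totalDegree ≤ d)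
    (l : σ → F → K) (hl : ∀ i, ∃ α β, ∀ t, l i t = α + ι t * β) :
    IsUni ι d (fun t => eval (fun i => l i t) p) := by
  choose u v huv using hl
  refine ⟨aeval (fun i => Polynomial.C (u i) + Polynomial.X * Polynomial.C (v i)) p, ?_, ?_⟩
  · refine le_trans (natDegree_aeval_le _ ?_ p) hp
    intro i
    refine le_trans (Polynomial.natDegree_add_le _ _) ?_
    refine max_le ?_ ?_
    · simp
    · refine le_trans Polynomial.natDegree_mul_le ?_
      simp
  · intro t
    simp only [huv]
    clear hp
    induction p using MvPolynomial.induction_on with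
    | C a => simp
    | add p q hp hq => simp only [map_add, hp, hq, Polynomial.eval_add]
    | mul_X p s hp =>
      simp only [map_mul, hp, aeval_X, eval_X, Polynomial.eval_mul, Polynomial.eval_add,
        Polynomial.eval_C, Polynomial.eval_X]

lemma isUni_eval2 (ι : F →+* K) (p : MvPolynomial (Fin 2) K) (d : ℕ) (hp : p.totalDegree ≤ d)
    (a b a' b' : F) :
    IsUni ι d (fun t => MvPolynomial.eval ![ι (a + t * b), ι (a' + t * b')] p) := by
  have := isUni_eval ι p d hp (fun i t => (![ι (a + t * b), ι (a' + t * b')] : Fin 2 → K) i) (by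
    intro i
    fin_cases i
    · exact ⟨ι a, ι b, fun t => by simp⟩
    · exact ⟨ι a', ι b', fun t => by simp⟩)
  exact this

lemma isUni_eval3 (ι : F →+* K) (p : MvPolynomial (Fin 3) K) (d : ℕ) (hp : p.totalDegree ≤ d)
    (a b a' b' a'' b'' : F) :
    IsUni ι d (fun t => MvPolynomial.eval ![ι (a + t * b), ι (a' + t * b'), ι (a'' + t * b'')] p) := by
  have := isUni_eval ι p d hp (fun i t => (![ι (a + t * b), ι (a' + t * b'), ι (a'' + t * b'')] : Fin 3 → K) i) (by
    intro i
    fin_cases i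
    · exact ⟨ι a, ι b, fun t => by simp⟩
    · exact ⟨ι a', ι b', fun t => by simp⟩
    · exact ⟨ι a'', ι b'', fun t => by simp⟩)
  exact this

/-- A quadratic has at most two roots. -/
lemma quad_fiber (B : Finset F) (x k : F) (h : ∀ s ∈ B, s * x - s ^ 2 = k) : B.card ≤ 2 := by
  rcases B.eq_empty_or_nonempty with rfl | ⟨s, hs⟩
  · simp
  · refine le_trans (Finset.card_le_card (t := {s, x - s}) ?_) Finset.card_le_two
    intro s' hs'
    have h1 := h s hs
    have h2 := h s' hs'
    have : (s' - s) * (s' - (x - s)) = 0 := by linear_combination h1 - h2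
    rw [Finset.mem_insert, Finset.mem_singleton]
    rcases mul_eq_zero.mp this with h | h
    · left; exact sub_eq_zero.mp h
    · right; exact sub_eq_zero.mp h

lemma card_image_quad (B : Finset F) (φ : F → F) (h : ∀ x : F, ∃ y k, ∀ s ∈ B, φ s = x → s * y - s ^ 2 = k) :
    B.card ≤ 2 * (B.image φ).card := by
  apply Finset.card_le_mul_card_image
  intro x _
  obtain ⟨y, k, hk⟩ := h x
  apply quad_fiber _ y k
  intro s hs
  rw [Finset.mem_filter] at hs
  exact hk s hs.1 hs.2

/-- incidence of a plane with a line of a parabola family -/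
def LInc (w : F × F × F) (u : (F × F) × (F × F)) : Prop :=
  u.2.2 = w.1 + w.2.1 * u.1.1 ∧ u.2.1 - u.2.2 ^ 2 = w.2.1 * (u.1.2 - u.1.1 ^ 2) + w.2.2

lemma unc_lines (T : Finset (F × F × F)) (hT : 100 * (Fintype.card F : ℝ) ^ 2 ≤ T.card) :
    100 * ((Finset.univ.filter (fun u : (F × F) × (F × F) => ∀ w ∈ T, ¬ LInc w u)).card : ℝ) ≤
      (Fintype.card F : ℝ) ^ 4 := by
  have hq : (0:ℝ) < Fintype.card F := by exact_mod_cast card_pos_F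
  have hβ : (Fintype.card ((F × F) × (F × F)) : ℝ) = (Fintype.card F : ℝ) ^ 4 := by
    simp only [Fintype.card_prod]; push_cast; ring
  have := uncovered (β := (F × F) × (F × F)) T LInc ((Fintype.card F : ℝ) ^ 2) 1 (by
      intro w _
      have : (Finset.univ.filter (fun u : (F × F) × (F × F) => LInc w u)).card = Fintype.card (F × F) := by
        rw [← Finset.card_univ]
        apply Finset.card_bij (fun u _ => u.1)
        · intro _ _; exact Finset.mem_univ _
        · rintro ⟨⟨a, c⟩, ⟨e, s⟩⟩ h1 ⟨⟨a', c'⟩, ⟨e', s'⟩⟩ h2 he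
          rw [Finset.mem_filter] at h1 h2
          simp only [LInc, Prod.mk.injEq] at h1 h2 he
          obtain ⟨rfl, rfl⟩ := he
          have hs : s = s' := h1.2.1.trans h2.2.1.symm
          subst hs
          have : e = e' := by linear_combination h1.2.2 - h2.2.2
          rw [this]
        · rintro ⟨a, c⟩ _
          refine ⟨((a, c), (w.2.1 * (c - a ^ 2) + w.2.2 + (w.1 + w.2.1 * a) ^ 2, w.1 + w.2.1 * a)), ?_, rfl⟩
          rw [Finset.mem_filter]
          refine ⟨Finset.mem_univ _, rfl, ?_⟩
          simp
      rw [this, Fintype.card_prod]; push_cast; ring) (by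
      rintro ⟨w0, w1, w2⟩ _ ⟨w0', w1', w2'⟩ _ hne
      have : (Finset.univ.filter (fun u : (F × F) × (F × F) => LInc (w0, w1, w2) u ∧ LInc (w0', w1', w2') u)).card ≤ 1 := by
        rw [Finset.card_le_one]
        rintro ⟨⟨a, c⟩, ⟨e, s⟩⟩ h1 ⟨⟨a', c'⟩, ⟨e', s'⟩⟩ h2
        rw [Finset.mem_filter] at h1 h2
        obtain ⟨-, ⟨g1, g2⟩, g3, g4⟩ := h2
        obtain ⟨-, ⟨h1, h2⟩, h3, h4⟩ := h1
        simp only at h1 h2 h3 h4 g1 g2 g3 g4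
        have hw1 : w1 - w1' ≠ 0 := by
          intro h0
          apply hne
          have e1 : w1 = w1' := sub_eq_zero.mp h0
          subst e1
          have e0 : w0 = w0' := by linear_combination h3 - h1
          have e2 : w2 = w2' := by linear_combination h4 - h2
          rw [e0, e2]
        have ea : a = a' := by
          apply mul_left_cancel₀ hw1
          linear_combination h3 - h1 - g3 + g1
        subst ea
        have ec : c = c' := by
          apply mul_left_cancel₀ hw1
          linear_combination h4 - h2 - g4 + g2
        subst ec
        have es : s = s' := h1.trans g1.symm
        subst es
        have ee : e = e' := by linear_combination h2 - g2
        rw [ee]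
      exact_mod_cast this) (by rw [hβ]; ring) (by exact_mod_cast Fintype.card_pos) (by positivity)
  rw [hβ] at this
  have this' : ((Finset.univ.filter (fun u : (F × F) × (F × F) => ∀ w ∈ T, ¬ LInc w u)).card : ℝ) * T.card *
      (Fintype.card F : ℝ) ^ 2 ≤ ((Fintype.card F : ℝ) ^ 4) ^ 2 := by convert this
  clear this
  generalize ((Finset.univ.filter (fun u : (F × F) × (F × F) => ∀ w ∈ T, ¬ LInc w u)).card : ℝ) = U at *
  have hU : 0 ≤ U ∨ U < 0 := le_or_gt _ _
  have h1 : (Fintype.card F : ℝ) ^ 4 * (100 * U) ≤ (Fintype.card F : ℝ) ^ 4 * (Fintype.card F : ℝ) ^ 4 := by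
    rcases hU with hU | hU
    · have := mul_le_mul_of_nonneg_left hT (mul_nonneg hU (sq_nonneg (Fintype.card F : ℝ)))
      nlinarith
    · have h3 : 0 ≤ (Fintype.card F : ℝ) ^ 4 := by positivity
      nlinarith [mul_nonneg h3 h3]
  exact le_of_mul_le_mul_left h1 (by positivity)

lemma inc_pt (w : F × F × F) :
    (Finset.univ.filter (fun p : F × F × F => dot w (p.1, p.2.1, 1) = p.2.2)).card = Fintype.card F ^ 2 := by
  have : Fintype.card F ^ 2 = (Finset.univ : Finset (F × F)).card := by
    rw [Finset.card_univ, Fintype.card_prod]; ring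
  rw [this]
  apply Finset.card_bij' (fun u _ => (u.1, u.2.1)) (fun v _ => (v.1, v.2, dot w (v.1, v.2, 1)))
  · intro u _; exact Finset.mem_univ _
  · intro u _; rw [Finset.mem_filter]; exact ⟨Finset.mem_univ _, rfl⟩
  · rintro ⟨x, y, z⟩ h; rw [Finset.mem_filter] at h; simp only at h ⊢; rw [h.2]
  · intro u _; rfl

lemma inc_pt2 (w w' : F × F × F) (h : w ≠ w') :
    (Finset.univ.filter (fun p : F × F × F => dot w (p.1, p.2.1, 1) = p.2.2 ∧
      dot w' (p.1, p.2.1, 1) = p.2.2)).card ≤ Fintype.card F := by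
  refine le_trans ?_ (card_line w w' h)
  apply Finset.card_le_card_of_injOn (fun u => (u.1, u.2.1))
  · intro u hu
    rw [Finset.mem_coe, Finset.mem_filter] at hu ⊢
    exact ⟨Finset.mem_univ _, hu.2.1.trans hu.2.2.symm⟩
  · rintro ⟨x, y, z⟩ h ⟨x', y', z'⟩ h' he
    rw [Finset.mem_coe, Finset.mem_filter] at h h'
    simp only [Prod.mk.injEq] at he h h'
    obtain ⟨rfl, rfl⟩ := he
    rw [← h.2.1, ← h'.2.1]

lemma unc_points (T : Finset (F × F × F)) (hT : 100 * (Fintype.card F : ℝ) ^ 2 ≤ T.card) :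
    100 * ((Finset.univ.filter (fun p : (F × F) × F => ∀ w ∈ T, ¬ dot w (p.1.1, p.1.2, 1) = p.2)).card : ℝ) ≤
      (Fintype.card F : ℝ) ^ 2 := by
  have hq : (0:ℝ) < Fintype.card F := by exact_mod_cast card_pos_F
  have hβ : (Fintype.card (F × F × F) : ℝ) = (Fintype.card F : ℝ) ^ 3 := by
    simp only [Fintype.card_prod]; push_cast; ring
  have := uncovered (β := F × F × F) T (fun w p => dot w (p.1, p.2.1, 1) = p.2.2)
    ((Fintype.card F : ℝ) ^ 2) (Fintype.card F : ℝ) (fun w _ => by exact_mod_cast inc_pt w)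
    (fun w _ w' _ h => by exact_mod_cast inc_pt2 w w' h) (by rw [hβ]; ring)
    (by exact_mod_cast Fintype.card_pos) (by positivity)
  rw [hβ] at this
  have he : (Finset.univ.filter (fun p : (F × F) × F => ∀ w ∈ T, ¬ dot w (p.1.1, p.1.2, 1) = p.2)).card =
      (Finset.univ.filter (fun p : F × F × F => ∀ w ∈ T, ¬ dot w (p.1, p.2.1, 1) = p.2.2)).card := by
    apply Finset.card_equiv (Equiv.prodAssoc F F F)
    intro p
    rw [Finset.mem_filter, Finset.mem_filter]
    simp
  rw [he]
  have this' : ((Finset.univ.filter (fun p : F × F × F => ∀ w ∈ T, ¬ dot w (p.1, p.2.1, 1) = p.2.2)).card : ℝ)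
      * T.card * (Fintype.card F : ℝ) ^ 2 ≤ ((Fintype.card F : ℝ) ^ 3) ^ 2 := by convert this
  clear this
  have hU : (0:ℝ) ≤ ((Finset.univ.filter (fun p : F × F × F => ∀ w ∈ T, ¬ dot w (p.1, p.2.1, 1) = p.2.2)).card : ℝ) :=
    Nat.cast_nonneg _
  generalize ((Finset.univ.filter (fun p : F × F × F => ∀ w ∈ T, ¬ dot w (p.1, p.2.1, 1) = p.2.2)).card : ℝ) = U at *
  have h1 : (Fintype.card F : ℝ) ^ 4 * (100 * U) ≤ (Fintype.card F : ℝ) ^ 4 * (Fintype.card F : ℝ) ^ 2 := by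
    have := mul_le_mul_of_nonneg_left hT (mul_nonneg hU (sq_nonneg (Fintype.card F : ℝ)))
    nlinarith
  exact le_of_mul_le_mul_left h1 (by positivity)

/-- Averaging: if few pairs are marked, then few first coordinates have many marked partners. -/
lemma bad_count {α β : Type*} [Fintype α] [Fintype β] (U : α → β → Prop) (m : ℝ) (Bd : Finset α)
    (h : ∀ a ∈ Bd, m ≤ ((Finset.univ.filter (fun b => U a b)).card : ℝ)) :
    (Bd.card : ℝ) * m ≤ ((Finset.univ.filter (fun p : α × β => U p.1 p.2)).card : ℝ) := by
  have e : ((Finset.univ.filter (fun p : α × β => U p.1 p.2)).card : ℝ) =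
      ∑ a, ((Finset.univ.filter (fun b => U a b)).card : ℝ) := by
    rw [Finset.card_filter]
    push_cast
    rw [Fintype.sum_prod_type]
    apply Finset.sum_congr rfl
    intro a _
    rw [Finset.card_filter]; push_cast; rfl
  rw [e, ← nsmul_eq_mul]
  refine le_trans (Finset.card_nsmul_le_sum _ _ _ h) ?_
  apply Finset.sum_le_sum_of_subset_of_nonneg (Finset.subset_univ _)
  intro _ _ _; exact Nat.cast_nonneg _

lemma card_filter_iff {α : Type*} [Fintype α] (p q : α → Prop) [DecidablePred p] [DecidablePred q]
    (h : ∀ x, p x ↔ q x) :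
    ((Finset.univ.filter p).card : ℝ) = ((Finset.univ.filter q).card : ℝ) := by
  congr 2
  ext x
  rw [Finset.mem_filter, Finset.mem_filter, h x]

end Helpers
end Paper

namespace Paper
set_option linter.unusedSectionVars false
section Helpers
open Classical

variable {F K : Type*} [Field F] [Fintype F] [Field K]

lemma half_compl (Q : F → Prop) (h : ¬ (Fintype.card F ≤ 2 * (Finset.univ.filter Q).card)) :
      (Fintype.card F : ℝ) / 2 ≤ ((Finset.univ.filter (fun x => ¬ Q x)).card : ℝ) := by
  have e : (Finset.univ.filter Q).card + (Finset.univ.filter (fun x => ¬ Q x)).card = Fintype.card F := by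
    rw [Finset.card_filter_add_card_filter_not, Finset.card_univ]
  have e' : Fintype.card F ≤ 2 * (Finset.univ.filter (fun x => ¬ Q x)).card := by omega
  have e'' : (Fintype.card F : ℝ) ≤ 2 * (Finset.univ.filter (fun x => ¬ Q x)).card := by exact_mod_cast e'
  linarith

lemma half_compl' (Q R : F → Prop) (hR : ∀ x, R x ↔ ¬ Q x)
    (h : ¬ (Fintype.card F ≤ 2 * (Finset.univ.filter Q).card)) :
      (Fintype.card F : ℝ) / 2 ≤ ((Finset.univ.filter R).card : ℝ) := by
  refine le_trans (half_compl Q h) (le_of_eq ?_)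
  exact card_filter_iff _ _ (fun x => (hR x).symm)

lemma choose_c_aux (CL UL : F × F → F × F → Prop) (CP UP : F × F → F → Prop)
    (hUL : ∀ u v, UL u v ↔ ¬ CL u v) (hUP : ∀ u v, UP u v ↔ ¬ CP u v)
    (k1 : 100 * ((Finset.univ.filter (fun p : (F × F) × (F × F) => UL p.1 p.2)).card : ℝ) ≤ (Fintype.card F : ℝ) ^ 4)
    (k2 : 100 * ((Finset.univ.filter (fun p : (F × F) × F => UP p.1 p.2)).card : ℝ) ≤ (Fintype.card F : ℝ) ^ 2) :
    ∃ (c : F) (A : Finset F), Fintype.card F ≤ 2 * A.card ∧ ∀ a ∈ A,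
      (∃ (e : F) (B : Finset F), Fintype.card F ≤ 2 * B.card ∧ ∀ s ∈ B, CL (a, c) (e, s)) ∧
      (∀ a', ∃ B : Finset F, Fintype.card F ≤ 2 * B.card ∧ ∀ z ∈ B, CP (a + a', a * a' + c) z) := by
  have hq : (0:ℝ) < Fintype.card F := by exact_mod_cast card_pos_F
  obtain ⟨GP, hGP⟩ : ∃ GP : F × F → Prop, ∀ u, GP u ↔ ∃ e, Fintype.card F ≤
      2 * (Finset.univ.filter (fun s => CL u (e, s))).card := ⟨_, fun _ => Iff.rfl⟩
  obtain ⟨GV, hGV⟩ : ∃ GV : F × F → Prop, ∀ u, GV u ↔ Fintype.card F ≤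
      2 * (Finset.univ.filter (fun z => CP u z)).card := ⟨_, fun _ => Iff.rfl⟩
  obtain ⟨BP, hBP⟩ : ∃ BP : Finset (F × F), ∀ u, u ∈ BP ↔ ¬ GP u :=
    ⟨Finset.univ.filter (fun u => ¬ GP u), fun u => by rw [Finset.mem_filter]; simp⟩
  obtain ⟨BL, hBL⟩ : ∃ BL : Finset (F × F), ∀ u, u ∈ BL ↔ ¬ GV u :=
    ⟨Finset.univ.filter (fun u => ¬ GV u), fun u => by rw [Finset.mem_filter]; simp⟩
  obtain ⟨BQ, hBQ⟩ : ∃ BQ : Finset (F × F), ∀ u, u ∈ BQ ↔ ∃ a', ¬ GV (u.1 + a', u.1 * a' + u.2) :=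
    ⟨Finset.univ.filter (fun u => ∃ a', ¬ GV (u.1 + a', u.1 * a' + u.2)), fun u => by rw [Finset.mem_filter]; simp⟩
  have b1 : (BP.card : ℝ) * (Fintype.card F * (Fintype.card F / 2)) ≤ (Fintype.card F : ℝ) ^ 4 / 100 := by
    have h0 : ∀ u ∈ BP, (Fintype.card F : ℝ) * (Fintype.card F / 2) ≤
        ((Finset.univ.filter (fun v => UL u v)).card : ℝ) := by
      intro u hu
      rw [hBP, hGP, not_exists] at hu
      have h3 := bad_count (fun (e : F) (s : F) => UL u (e, s)) ((Fintype.card F : ℝ) / 2)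
        (Finset.univ : Finset F) (fun e _ => half_compl' _ _ (fun x => hUL u (e, x)) (hu e))
      have h4 : ((Finset.univ : Finset F).card : ℝ) = Fintype.card F := by rw [Finset.card_univ]
      rw [h4] at h3
      exact h3
    have h1 := bad_count UL (Fintype.card F * (Fintype.card F / 2)) BP h0
    rw [le_div_iff₀ (by norm_num), mul_comm _ (100:ℝ)]
    exact le_trans (mul_le_mul_of_nonneg_left h1 (by norm_num)) k1
  have b2 : (BL.card : ℝ) * (Fintype.card F / 2) ≤ (Fintype.card F : ℝ) ^ 2 / 100 := by
    have h0 : ∀ u ∈ BL, (Fintype.card F : ℝ) / 2 ≤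
        ((Finset.univ.filter (fun v => UP u v)).card : ℝ) := by
      intro u hu
      rw [hBL, hGV] at hu
      exact half_compl' _ _ (fun x => hUP u x) hu
    have h1 := bad_count UP (Fintype.card F / 2) BL h0
    rw [le_div_iff₀ (by norm_num), mul_comm _ (100:ℝ)]
    exact le_trans (mul_le_mul_of_nonneg_left h1 (by norm_num)) k2
  have b1' : (BP.card : ℝ) ≤ (Fintype.card F : ℝ) ^ 2 / 50 := by
    have : (Fintype.card F : ℝ) ^ 2 / 2 * BP.card ≤ (Fintype.card F : ℝ) ^ 2 / 2 * ((Fintype.card F : ℝ) ^ 2 / 50) := by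
      nlinarith
    exact le_of_mul_le_mul_left this (by positivity)
  have b2' : (BL.card : ℝ) ≤ (Fintype.card F : ℝ) / 50 := by
    have : (Fintype.card F : ℝ) / 2 * BL.card ≤ (Fintype.card F : ℝ) / 2 * ((Fintype.card F : ℝ) / 50) := by
      nlinarith
    exact le_of_mul_le_mul_left this (by positivity)
  have b3 : BQ.card ≤ BL.card * Fintype.card F := by
    have : BQ ⊆ (BL ×ˢ (Finset.univ : Finset F)).image (fun p => (p.2, p.1.2 - p.2 * (p.1.1 - p.2))) := by
      rintro ⟨a, c⟩ h
      rw [hBQ] at h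
      obtain ⟨a', h⟩ := h
      rw [Finset.mem_image]
      refine ⟨((a + a', a * a' + c), a), ?_, ?_⟩
      · rw [Finset.mem_product, hBL]
        exact ⟨h, Finset.mem_univ _⟩
      · simp
    refine le_trans (Finset.card_le_card this) (le_trans Finset.card_image_le ?_)
    rw [Finset.card_product, Finset.card_univ]
  have b3' : (BQ.card : ℝ) ≤ (Fintype.card F : ℝ) ^ 2 / 50 := by
    have : (BQ.card : ℝ) ≤ BL.card * Fintype.card F := by exact_mod_cast b3
    nlinarith
  have b4 : ((BP ∪ BQ).card : ℝ) ≤ (Fintype.card F : ℝ) ^ 2 / 25 := by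
    have : ((BP ∪ BQ).card : ℝ) ≤ BP.card + BQ.card := by exact_mod_cast Finset.card_union_le _ _
    linarith
  -- choose c
  by_contra hcon
  push Not at hcon
  obtain ⟨Bd, hBd⟩ : ∃ Bd : F → F → Prop, ∀ c a, Bd c a ↔ (a, c) ∈ BP ∪ BQ := ⟨_, fun _ _ => Iff.rfl⟩
  obtain ⟨Gd, hGd⟩ : ∃ Gd : F → F → Prop, ∀ c a, Gd c a ↔ ¬ Bd c a := ⟨_, fun _ _ => Iff.rfl⟩
  have hall : ∀ c : F, (Fintype.card F : ℝ) / 2 ≤ ((Finset.univ.filter (fun a => Bd c a)).card : ℝ) := by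
    intro c
    refine half_compl' (fun a => Gd c a) (fun a => Bd c a) (fun x => by rw [hGd, not_not]) ?_
    · 
      intro h
      obtain ⟨a, ha, ha2⟩ := hcon c _ h
      rw [Finset.mem_filter, hGd, hBd, Finset.mem_union, not_or, hBP, hBQ] at ha
      obtain ⟨-, h1, h2⟩ := ha
      simp only [not_not, not_exists] at h1 h2
      obtain ⟨e, he⟩ := (hGP _).mp h1
      obtain ⟨a', ha'⟩ := ha2 ⟨e, _, he, fun s hs => by
        rw [Finset.mem_filter] at hs; exact hs.2⟩
      obtain ⟨z, hz, hz2⟩ := ha' _ ((hGV _).mp (h2 a'))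
      rw [Finset.mem_filter] at hz
      exact hz2 hz.2
  have := bad_count Bd ((Fintype.card F : ℝ) / 2) Finset.univ (fun c _ => hall c)
  have he : (Finset.univ.filter (fun p : F × F => Bd p.1 p.2)).card = (BP ∪ BQ).card := by
    apply Finset.card_equiv (Equiv.prodComm F F)
    intro p
    rw [Finset.mem_filter, hBd]
    simp only [Finset.mem_univ, true_and]
    exact Iff.rfl
  rw [he, Finset.card_univ] at this
  nlinarith [pow_pos hq 2]

lemma choose_c (T : Finset (F × F × F)) (hT : 100 * (Fintype.card F : ℝ) ^ 2 ≤ T.card) :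
    ∃ (c : F) (A : Finset F), Fintype.card F ≤ 2 * A.card ∧ ∀ a ∈ A,
      (∃ (e : F) (B : Finset F), Fintype.card F ≤ 2 * B.card ∧ ∀ s ∈ B, ∃ w ∈ T, LInc w ((a, c), (e, s))) ∧
      (∀ a', ∃ B : Finset F, Fintype.card F ≤ 2 * B.card ∧ ∀ z ∈ B, ∃ w ∈ T,
        dot w (a + a', a * a' + c, 1) = z) := by
  have := choose_c_aux (fun u v => ∃ w ∈ T, LInc w (u, v)) (fun u v => ∀ w ∈ T, ¬ LInc w (u, v))
    (fun u z => ∃ w ∈ T, dot w (u.1, u.2, 1) = z) (fun u z => ∀ w ∈ T, ¬ dot w (u.1, u.2, 1) = z)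
    (fun u v => by push Not; exact Iff.rfl) (fun u v => by push Not; exact Iff.rfl)
    (by
      refine le_trans (le_of_eq ?_) (unc_lines T hT)
      congr!)
    (by
      refine le_trans (le_of_eq ?_) (unc_points T hT)
      congr!)
  exact this

end Helpers
end Paper

namespace Paper
set_option linter.unusedSectionVars false
section Helpers
open Classical
open MvPolynomial

variable {F K : Type*} [Field F] [Fintype F] [Field K]

lemma ev2 (ι : F →+* K) (v : Fin 2 → F) : (fun t => ι (v t)) = ![ι (v 0), ι (v 1)] := by
  ext t; fin_cases t <;> rfl

lemma ev3 (ι : F →+* K) (v : Fin 3 → F) : (fun t => ι (v t)) = ![ι (v 0), ι (v 1), ι (v 2)] := by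
  ext t; fin_cases t <;> rfl

lemma plane_interp (ι : F →+* K) (d : ℕ) (T : Finset (F × F × F))
    (g : F × F × F → MvPolynomial (Fin 2) K) (hg : ∀ w ∈ T, (g w).totalDegree ≤ d)
    (hT : ∀ w ∈ T, ∀ w' ∈ T, ∀ x y : F, dot w (x, y, 1) = dot w' (x, y, 1) →
      eval ![ι x, ι y] (g w) = eval ![ι x, ι y] (g w'))
    (hdq : 10 * (d + 1) ≤ Fintype.card F) (a c e : F) (B : Finset F)
    (hB : Fintype.card F ≤ 2 * B.card) (hcov : ∀ s ∈ B, ∃ w ∈ T, LInc w ((a, c), (e, s))) :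
    ∃ G : MvPolynomial (Fin 2) K, G.totalDegree ≤ d ∧ ∀ w ∈ T, ∀ x : F,
      eval ![ι x, ι (dot w (x, a * x - a ^ 2 + c, 1))] G = eval ![ι x, ι (a * x - a ^ 2 + c)] (g w) := by
  choose! ws hws hinc using hcov
  have hdot : ∀ s ∈ B, ∀ x, dot (ws s) (x, a * x - a ^ 2 + c, 1) = s * x - s ^ 2 + e := by
    intro s hs x
    have := hinc s hs
    obtain ⟨h1, h2⟩ := this
    simp only at h1 h2
    simp only [dot]
    linear_combination (-x) * h1 - h2
  have hev : ∀ s (v : Fin 2 → F), eval (fun t => ι (v t))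
      (aeval (![X 0, C (ι a) * X 0 + C (ι (c - a ^ 2))] : Fin 2 → MvPolynomial (Fin 2) K) (g (ws s))) =
      eval ![ι (v 0), ι (a * v 0 - a ^ 2 + c)] (g (ws s)) := by
    intro s v
    rw [eval_aeval']
    congr 1
    congr 1
    ext i
    fin_cases i
    · simp
    · simp
      ring
  obtain ⟨G, hGd, hG⟩ := newton (σ := Fin 2) ι d (by omega) 0 1 (by decide) e
    (fun s => aeval (![X 0, C (ι a) * X 0 + C (ι (c - a ^ 2))] : Fin 2 → MvPolynomial (Fin 2) K) (g (ws s))) B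
    (by
      intro s hs
      refine le_trans (totalDegree_aeval_le _ ?_ _) (hg _ (hws s hs))
      intro i
      fin_cases i
      · simp
      · simp only [Fin.mk_one, Matrix.cons_val_one, Matrix.cons_val_fin_one]
        refine le_trans (totalDegree_add _ _) (max_le ?_ ?_)
        · refine le_trans (totalDegree_mul _ _) ?_
          simp
        · rw [totalDegree_C]; exact Nat.zero_le _)
    (by
      intro s hs s' hs' _ v h0 h1
      simp only [hev]
      apply hT _ (hws s hs) _ (hws s' hs')
      rw [hdot s hs, hdot s' hs', h0]
      ring)
  refine ⟨G, hGd, ?_⟩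
  intro w hw x
  obtain ⟨s0, hs0⟩ : ∃ s0, s0 = w.1 + w.2.1 * a := ⟨_, rfl⟩
  obtain ⟨t0, ht0⟩ : ∃ t0, t0 = w.2.1 * (c - a ^ 2) + w.2.2 := ⟨_, rfl⟩
  have hd0 : ∀ x, dot w (x, a * x - a ^ 2 + c, 1) = t0 + x * s0 := by
    intro x; rw [hs0, ht0]; simp only [dot]; ring
  have u1 : IsUni ι d (fun x => eval ![ι x, ι (dot w (x, a * x - a ^ 2 + c, 1))] G) := by
    have := isUni_eval2 ι G d hGd 0 1 t0 s0
    simpa only [hd0, zero_add, mul_one] using this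
  have u2 : IsUni ι d (fun x => eval ![ι x, ι (a * x - a ^ 2 + c)] (g w)) := by
    have := isUni_eval2 ι (g w) d (hg w hw) 0 1 (c - a ^ 2) a
    have e : ∀ x : F, a * x - a ^ 2 + c = c - a ^ 2 + x * a := fun x => by ring
    simpa only [e, zero_add, mul_one] using this
  have hφ : ∀ s, s ≠ s0 → s * ((t0 + s ^ 2 - e) / (s - s0)) - s ^ 2 + e = t0 + ((t0 + s ^ 2 - e) / (s - s0)) * s0 := by
    intro s hs
    have : s - s0 ≠ 0 := sub_ne_zero.mpr hs
    field_simp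
    ring
  have hcard := card_image_quad (B.erase s0) (fun s => (t0 + s ^ 2 - e) / (s - s0)) (by
    intro x
    refine ⟨x, t0 + x * s0 - e, ?_⟩
    intro s hs hx
    have h1 := hφ s (Finset.ne_of_mem_erase hs)
    rw [hx] at h1
    linear_combination h1)
  have hc2 : B.card - 1 ≤ (B.erase s0).card := Finset.pred_card_le_card_erase
  refine u1.eq u2 ((B.erase s0).image (fun s => (t0 + s ^ 2 - e) / (s - s0))) (by omega) ?_ x
  intro x hx
  obtain ⟨s, hs, hsx⟩ := Finset.mem_image.mp hx
  have hsB := Finset.mem_of_mem_erase hs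
  have h1 := hφ s (Finset.ne_of_mem_erase hs)
  rw [hsx] at h1
  have h2 := hG s hsB ![x, t0 + x * s0] (by
    simp only [Matrix.cons_val_one, Matrix.cons_val_zero, Matrix.cons_val_fin_one]
    exact h1.symm)
  rw [hev, ev2] at h2
  simp only [Matrix.cons_val_one, Matrix.cons_val_zero, Matrix.cons_val_fin_one] at h2
  simp only [hd0]
  rw [h2]
  apply hT _ (hws s hsB) _ hw
  rw [hdot s hsB, hd0, h1]

theorem clique_poly (ι : F →+* K) (d : ℕ) (T : Finset (F × F × F))
    (g : F × F × F → MvPolynomial (Fin 2) K) (hg : ∀ w ∈ T, (g w).totalDegree ≤ d)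
    (hT : ∀ w ∈ T, ∀ w' ∈ T, ∀ x y : F, dot w (x, y, 1) = dot w' (x, y, 1) →
      eval ![ι x, ι y] (g w) = eval ![ι x, ι y] (g w'))
    (hdq : 10 * (d + 1) ≤ Fintype.card F) (hTc : 100 * (Fintype.card F : ℝ) ^ 2 ≤ T.card) :
    ∃ P : MvPolynomial (Fin 3) K, P.totalDegree ≤ d ∧ ∀ w ∈ T, ∀ x y : F,
      eval ![ι x, ι y, ι (dot w (x, y, 1))] P = eval ![ι x, ι y] (g w) := by
  obtain ⟨c, A, hA, hA2⟩ := choose_c T hTc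
  have h2d : ∀ a ∈ A, ∃ G : MvPolynomial (Fin 2) K, G.totalDegree ≤ d ∧ ∀ w ∈ T, ∀ x : F,
      eval ![ι x, ι (dot w (x, a * x - a ^ 2 + c, 1))] G = eval ![ι x, ι (a * x - a ^ 2 + c)] (g w) := by
    intro a ha
    obtain ⟨⟨e, B, hB, hcov⟩, -⟩ := hA2 a ha
    exact plane_interp ι d T g hg hT hdq a c e B hB hcov
  choose! G hGd hG using h2d
  have hev : ∀ a (v : Fin 3 → F), eval (fun t => ι (v t))
      (aeval (![X 0, X 2] : Fin 2 → MvPolynomial (Fin 3) K) (G a)) =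
      eval ![ι (v 0), ι (v 2)] (G a) := by
    intro s v
    rw [eval_aeval']
    congr 1
    congr 1
    ext i
    fin_cases i <;> simp
  obtain ⟨P, hPd, hP⟩ := newton (σ := Fin 3) ι d (by omega) 0 1 (by decide) c
    (fun a => aeval (![X 0, X 2] : Fin 2 → MvPolynomial (Fin 3) K) (G a)) A
    (by
      intro a ha
      refine le_trans (totalDegree_aeval_le _ ?_ _) (hGd _ ha)
      intro i
      fin_cases i <;> simp)
    (by
      intro a ha a' ha' _ v h0 h1
      simp only [hev]
      obtain ⟨-, hv⟩ := hA2 a ha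
      obtain ⟨B, hB, hB2⟩ := hv a'
      have u1 := isUni_eval2 ι (G a) d (hGd a ha) (v 0) 0 0 1
      have u2 := isUni_eval2 ι (G a') d (hGd a' ha') (v 0) 0 0 1
      simp only [mul_zero, add_zero, zero_add, mul_one] at u1 u2
      refine u1.eq u2 B (by omega) ?_ (v 2)
      intro z hz
      obtain ⟨w, hw, hwz⟩ := hB2 z hz
      have k1 := hG a ha w hw (v 0)
      have k2 := hG a' ha' w hw (v 0)
      have e1 : a * v 0 - a ^ 2 + c = a * a' + c := by rw [h0]; ring
      have e2 : a' * v 0 - a' ^ 2 + c = a * a' + c := by rw [h0]; ring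
      have e3 : dot w (v 0, a * a' + c, 1) = z := by rw [h0, hwz]
      rw [e1, e3] at k1
      rw [e2, e3] at k2
      rw [k1, k2])
  refine ⟨P, hPd, ?_⟩
  intro w hw x y
  have hd0 : ∀ y, dot w (x, y, 1) = (w.1 * x + w.2.2) + y * w.2.1 := by
    intro y; simp only [dot]; ring
  have u1 := isUni_eval3 ι P d hPd x 0 0 1 (w.1 * x + w.2.2) w.2.1
  have u2 := isUni_eval2 ι (g w) d (hg w hw) x 0 0 1
  simp only [mul_zero, add_zero, zero_add, mul_one, ← hd0] at u1 u2
  have hcard := card_image_quad A (fun a => a * x - a ^ 2 + c) (by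
    intro y
    refine ⟨x, y - c, ?_⟩
    intro s hs hx
    linear_combination hx)
  refine u1.eq u2 (A.image (fun a => a * x - a ^ 2 + c)) (by omega) ?_ y
  intro y hy
  obtain ⟨a, ha, hay⟩ := Finset.mem_image.mp hy
  have h2 := hP a ha ![x, y, dot w (x, y, 1)] (by
    simp [← hay])
  rw [hev, ev3] at h2
  simp at h2
  rw [h2, ← hay]
  exact hG a ha w hw x

end Helpers
end Paper

namespace Paper
set_option linter.unusedSectionVars false
section Helpers
open Classical

variable {F K : Type*} [Field F] [Fintype F] [Field K]

lemma agset_le (ι : F →+* K) (d : ℕ) (g : F × F × F → MvPolynomial (Fin 2) K) (w w' : F × F × F)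
    (hw : (g w).totalDegree ≤ d) (hw' : (g w').totalDegree ≤ d)
    (G : F × F × F → F → F → K) (hG : ∀ w x y, G w x y = MvPolynomial.eval ![ι x, ι y] (g w))
    (h : ¬ Cons G w w') : (Agset G w w').card ≤ d := by
  by_contra hlt
  push Not at hlt
  apply h
  by_cases hww : w = w'
  · subst hww; intro x y _; rfl
  by_cases hb : w.2.1 = w'.2.1
  · by_cases ha : w.1 = w'.1
    · exfalso
      have hc : w.2.2 ≠ w'.2.2 := fun hc => hww (Prod.ext ha (Prod.ext hb hc))
      have : Agset G w w' = ∅ := by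
        apply Finset.eq_empty_of_forall_notMem
        intro p hp
        rw [Agset, Finset.mem_filter] at hp
        have h1 := hp.2.1
        simp only [dot, ha, hb, mul_one] at h1
        exact hc (add_left_cancel h1)
      rw [this] at hlt
      simp at hlt
    · have hne : w.1 - w'.1 ≠ 0 := sub_ne_zero.mpr ha
      have hx : ∀ x y, dot w (x, y, 1) = dot w' (x, y, 1) → x = (w'.2.2 - w.2.2) / (w.1 - w'.1) := by
        intro x y h
        simp only [dot] at h
        rw [eq_div_iff hne]
        rw [hb] at h
        linear_combination h
      generalize (w'.2.2 - w.2.2) / (w.1 - w'.1) = x0 at hx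
      have u1 := isUni_eval2 ι (g w) d hw x0 0 0 1
      have u2 := isUni_eval2 ι (g w') d hw' x0 0 0 1
      simp only [mul_zero, add_zero, zero_add, mul_one] at u1 u2
      intro x y hxy
      rw [hG, hG, hx x y hxy]
      refine u1.eq u2 ((Agset G w w').image Prod.snd) ?_ ?_ y
      · rw [Finset.card_image_of_injOn]
        · exact hlt
        · rintro ⟨x, y⟩ h ⟨x', y'⟩ h' he
          rw [Finset.mem_coe, Agset, Finset.mem_filter] at h h'
          simp only at he
          rw [hx x y h.2.1, hx x' y' h'.2.1, he]
      · intro y hy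
        obtain ⟨⟨x', y'⟩, hp, hpy⟩ := Finset.mem_image.mp hy
        rw [Agset, Finset.mem_filter] at hp
        obtain ⟨-, h1, h2⟩ := hp
        simp only at hpy h1 h2
        rw [hG, hG, hx x' y' h1, hpy] at h2
        exact h2
  · have hne : w.2.1 - w'.2.1 ≠ 0 := sub_ne_zero.mpr hb
    obtain ⟨α, β, hy⟩ : ∃ α β, ∀ x y, dot w (x, y, 1) = dot w' (x, y, 1) → y = α + x * β := by
      refine ⟨(w'.2.2 - w.2.2) / (w.2.1 - w'.2.1), (w'.1 - w.1) / (w.2.1 - w'.2.1), ?_⟩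
      intro x y h
      simp only [dot] at h
      field_simp
      linear_combination h
    have u1 := isUni_eval2 ι (g w) d hw 0 1 α β
    have u2 := isUni_eval2 ι (g w') d hw' 0 1 α β
    simp only [zero_add, mul_one] at u1 u2
    intro x y hxy
    rw [hG, hG, hy x y hxy]
    refine u1.eq u2 ((Agset G w w').image Prod.fst) ?_ ?_ x
    · rw [Finset.card_image_of_injOn]
      · exact hlt
      · rintro ⟨x, y⟩ h ⟨x', y'⟩ h' he
        rw [Finset.mem_coe, Agset, Finset.mem_filter] at h h'
        simp only at he
        rw [hy x y h.2.1, hy x' y' h'.2.1, he]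
    · intro x hx
      obtain ⟨⟨x', y'⟩, hp, hpx⟩ := Finset.mem_image.mp hx
      rw [Agset, Finset.mem_filter] at hp
      obtain ⟨-, h1, h2⟩ := hp
      simp only at hpx h1 h2
      rw [hG, hG, hy x' y' h1, hpx] at h2
      exact h2

/-- Incidence of a point with a plane. -/
def PInc (p w : F × F × F) : Prop := dot w (p.1, p.2.1, 1) = p.2.2

lemma pinc_card (p : F × F × F) :
    (Finset.univ.filter (fun w => PInc p w)).card = Fintype.card F ^ 2 :=
  card_dot' (p.1, p.2.1, 1) (by
    intro h
    have := congrArg (fun v => v.2.2) h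
    simp at this) p.2.2

lemma pinc_card2 (p p' : F × F × F) (h : p ≠ p') :
    (Finset.univ.filter (fun w => PInc p w ∧ PInc p' w)).card ≤ Fintype.card F := by
  obtain ⟨x, y, z⟩ := p
  obtain ⟨x', y', z'⟩ := p'
  rw [← Finset.card_univ]
  by_cases hx : x = x'
  · by_cases hy : y = y'
    · subst hx; subst hy
      have : (Finset.univ.filter (fun w => PInc (x, y, z) w ∧ PInc (x, y, z') w)) = ∅ := by
        apply Finset.filter_false_of_mem
        rintro w _ ⟨h1, h2⟩
        simp only [PInc] at h1 h2
        apply h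
        rw [← h1, ← h2]
      rw [this]; simp
    · apply Finset.card_le_card_of_injOn (fun w => w.1) (fun _ _ => Finset.mem_univ _)
      rintro ⟨a, b, c⟩ h1 ⟨a', b', c'⟩ h2 he
      rw [Finset.mem_coe, Finset.mem_filter] at h1 h2
      obtain ⟨-, h1, h3⟩ := h1
      obtain ⟨-, h2, h4⟩ := h2
      simp only [PInc, dot] at h1 h2 h3 h4 he
      subst he
      have hb : b = b' := by
        apply mul_right_cancel₀ (sub_ne_zero.mpr hy)
        subst hx
        linear_combination h1 - h3 - h2 + h4
      subst hb
      have hc : c = c' := by linear_combination h1 - h2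
      rw [hc]
  · apply Finset.card_le_card_of_injOn (fun w => w.2.1) (fun _ _ => Finset.mem_univ _)
    rintro ⟨a, b, c⟩ h1 ⟨a', b', c'⟩ h2 he
    rw [Finset.mem_coe, Finset.mem_filter] at h1 h2
    obtain ⟨-, h1, h3⟩ := h1
    obtain ⟨-, h2, h4⟩ := h2
    simp only [PInc, dot] at h1 h2 h3 h4 he
    subst he
    have ha : a = a' := by
      apply mul_right_cancel₀ (sub_ne_zero.mpr hx)
      linear_combination h1 - h3 - h2 + h4
    subst ha
    have hc : c = c' := by linear_combination h1 - h2
    rw [hc]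

lemma sampling (A : Finset (F × F × F)) :
    ∑ w, (((A.filter (fun p => PInc p w)).card : ℝ) - A.card / Fintype.card F) ^ 2 ≤
      (Fintype.card F : ℝ) ^ 2 * A.card := by
  have hq : (0:ℝ) < Fintype.card F := by exact_mod_cast card_pos_F
  have hβ : (Fintype.card (F × F × F) : ℝ) = (Fintype.card F : ℝ) ^ 3 := by
    simp only [Fintype.card_prod]; push_cast; ring
  have := second_moment A (PInc (F := F)) ((Fintype.card F : ℝ) ^ 2) (Fintype.card F : ℝ)
    (fun p _ => by exact_mod_cast pinc_card p)
    (fun p _ p' _ h => by exact_mod_cast pinc_card2 p p' h) (by rw [hβ]; ring) Fintype.card_pos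
  have e : (A.card : ℝ) * (Fintype.card F : ℝ) ^ 2 / (Fintype.card (F × F × F) : ℝ) = A.card / Fintype.card F := by
    rw [hβ]; field_simp
  rw [e] at this
  exact this

lemma sampling_bound (A T : Finset (F × F × F)) (δ : ℝ) (hδ : 0 ≤ δ)
    (h : ∀ w ∈ T, (A.card : ℝ) / Fintype.card F + δ ≤ ((A.filter (fun p => PInc p w)).card : ℝ)) :
    (T.card : ℝ) * δ ^ 2 ≤ (Fintype.card F : ℝ) ^ 2 * A.card := by
  refine le_trans ?_ (sampling A)
  rw [← nsmul_eq_mul]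
  refine le_trans (Finset.card_nsmul_le_sum T
    (fun w => (((A.filter (fun p => PInc p w)).card : ℝ) - A.card / Fintype.card F) ^ 2) _ ?_) ?_
  · intro w hw
    have := h w hw
    apply pow_le_pow_left₀ hδ
    linarith
  · apply Finset.sum_le_sum_of_subset_of_nonneg (Finset.subset_univ _)
    intro _ _ _; exact sq_nonneg _

/-- Agreement on a plane, as a count of points of the plane. -/
lemma plane_count (φ : F → F → F → K) (γ : F → F → F → K) (w : F × F × F) :
    ((Finset.univ.filter (fun p : F × F × F => φ p.1 p.2.1 p.2.2 = γ p.1 p.2.1 p.2.2)).filter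
      (fun p => PInc p w)).card =
    (Finset.univ.filter (fun p : F × F => φ p.1 p.2 (dot w (p.1, p.2, 1)) =
      γ p.1 p.2 (dot w (p.1, p.2, 1)))).card := by
  apply Finset.card_bij' (fun p _ => (p.1, p.2.1)) (fun p _ => (p.1, p.2, dot w (p.1, p.2, 1)))
  · rintro ⟨x, y, z⟩ h
    rw [Finset.mem_filter, Finset.mem_filter] at h
    rw [Finset.mem_filter]
    obtain ⟨⟨-, h1⟩, h2⟩ := h
    simp only [PInc] at h1 h2 ⊢
    rw [h2]; exact ⟨Finset.mem_univ _, h1⟩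
  · rintro ⟨x, y⟩ h
    rw [Finset.mem_filter] at h
    rw [Finset.mem_filter, Finset.mem_filter]
    exact ⟨⟨Finset.mem_univ _, h.2⟩, rfl⟩
  · rintro ⟨x, y, z⟩ h
    rw [Finset.mem_filter] at h
    have h2 := h.2
    simp only [PInc] at h2 ⊢
    rw [h2]
  · intro p _; rfl

/-- The main bound, `d ≥ 1`. -/
lemma S_bound_pos (ι : F →+* K) (d : ℕ) (f : F → F → F → K) (ε : ℝ) (hε : 0 < ε) (hε1 : ε ≤ 1)
    (hd1 : 1 ≤ d) (hd : 1000000 * (d:ℝ) ≤ ε ^ 4 * Fintype.card F)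
    (hf : ∀ P : MvPolynomial (Fin 3) K, P.totalDegree ≤ d →
      ((Finset.univ.filter (fun p : F × F × F => f p.1 p.2.1 p.2.2 =
        MvPolynomial.eval ![ι p.1, ι p.2.1, ι p.2.2] P)).card : ℝ) ≤ ε * (Fintype.card F : ℝ) ^ 3)
    (S : Finset (F × F × F)) (g : F × F × F → MvPolynomial (Fin 2) K)
    (hg : ∀ w ∈ S, (g w).totalDegree ≤ d)
    (hS : ∀ w ∈ S, 1.2 * ε * (Fintype.card F : ℝ) ^ 2 ≤
      ((Finset.univ.filter (fun p : F × F =>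
        f p.1 p.2 (dot w (p.1, p.2, 1)) = MvPolynomial.eval ![ι p.1, ι p.2] (g w))).card : ℝ)) :
    (S.card : ℝ) ≤ 99 * (Fintype.card F : ℝ) ^ 2 / ε ^ 2 := by
  by_contra hlt
  push Not at hlt
  have hq : (0:ℝ) < Fintype.card F := by exact_mod_cast card_pos_F
  have hd1' : (1:ℝ) ≤ d := by exact_mod_cast hd1
  have hε4 : ε ^ 4 ≤ ε := by
    calc ε ^ 4 ≤ ε ^ 1 := pow_le_pow_of_le_one hε.le hε1 (by norm_num)
      _ = ε := pow_one _
  have hεq : 1000000 * (d:ℝ) ≤ ε * Fintype.card F :=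
    le_trans hd (mul_le_mul_of_nonneg_right hε4 hq.le)
  have hεq2 : ε * Fintype.card F ≤ Fintype.card F := by nlinarith
  obtain ⟨T, hTS, hTc, hT⟩ := exists_clique (fun w x y => MvPolynomial.eval ![ι x, ι y] (g w)) S f d ε hε hε1
    hlt.le hS (fun w hw w' hw' h => agset_le ι d g w w' (hg w hw) (hg w' hw') _ (fun _ _ _ => rfl) h) hd1 hd
  obtain ⟨P, hPd, hP⟩ := clique_poly ι d T g (fun w hw => hg w (hTS hw)) hTc (by
    have : (10:ℝ) * (d + 1) ≤ Fintype.card F := by linarith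
    exact_mod_cast this) hT
  have hfP := hf P hPd
  obtain ⟨A, hA⟩ : ∃ A, A = (Finset.univ.filter (fun p : F × F × F => f p.1 p.2.1 p.2.2 =
        MvPolynomial.eval ![ι p.1, ι p.2.1, ι p.2.2] P)) := ⟨_, rfl⟩
  rw [← hA] at hfP
  have key := sampling_bound A T (0.2 * ε * (Fintype.card F : ℝ) ^ 2) (by positivity) (by
    intro w hw
    have h1 := hS w (hTS hw)
    have h2 := plane_count f (fun x y z => MvPolynomial.eval ![ι x, ι y, ι z] P) w
    simp only [hP w hw] at h2
    rw [← hA] at h2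
    rw [h2]
    refine le_trans ?_ h1
    have : (A.card : ℝ) / Fintype.card F ≤ ε * (Fintype.card F : ℝ) ^ 2 := by
      rw [div_le_iff₀ hq]; linarith
    linarith)
  generalize (A.card : ℝ) = α at *
  generalize (T.card : ℝ) = t at *
  generalize (Fintype.card F : ℝ) = q at *
  have h1 : 100 * q ^ 2 * (0.2 * ε * q ^ 2) ^ 2 ≤ q ^ 2 * (ε * q ^ 3) :=
    le_trans (mul_le_mul_of_nonneg_right hT (sq_nonneg _)) (le_trans key (mul_le_mul_of_nonneg_left hfP (sq_nonneg _)))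
  have h2 : (q ^ 5 * ε) * (4 * (ε * q)) ≤ (q ^ 5 * ε) * 1 := by nlinarith
  have h3 := le_of_mul_le_mul_left h2 (by positivity)
  linarith

/-- The main bound, `d = 0`. -/
lemma S_bound_zero [Fintype K] (f : F → F → F → K) (ε : ℝ) (hε : 0 < ε) 
    (hf : ∀ k : K, ((Finset.univ.filter (fun p : F × F × F => f p.1 p.2.1 p.2.2 = k)).card : ℝ) ≤
      ε * (Fintype.card F : ℝ) ^ 3)
    (S : Finset (F × F × F)) (g : F × F × F → K)
    (hS : ∀ w ∈ S, 1.2 * ε * (Fintype.card F : ℝ) ^ 2 ≤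
      ((Finset.univ.filter (fun p : F × F => f p.1 p.2 (dot w (p.1, p.2, 1)) = g w)).card : ℝ)) :
    (S.card : ℝ) ≤ 99 * (Fintype.card F : ℝ) ^ 2 / ε ^ 2 := by
  have hq : (1:ℝ) ≤ Fintype.card F := by exact_mod_cast Nat.succ_le_of_lt card_pos_F
  obtain ⟨A, hA⟩ : ∃ A : K → Finset (F × F × F), ∀ k, A k =
    (Finset.univ.filter (fun p : F × F × F => f p.1 p.2.1 p.2.2 = k)) := ⟨_, fun _ => rfl⟩
  have hf' : ∀ k, ((A k).card : ℝ) ≤ ε * (Fintype.card F : ℝ) ^ 3 := fun k => by rw [hA]; exact hf k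
  have key : ∀ k : K, ((S.filter (fun w => g w = k)).card : ℝ) * (0.2 * ε * (Fintype.card F : ℝ) ^ 2) ^ 2 ≤
      (Fintype.card F : ℝ) ^ 2 * (A k).card := by
    intro k
    apply sampling_bound (A k) _ _ (by positivity)
    intro w hw
    rw [Finset.mem_filter] at hw
    have h1 := hS w hw.1
    have h2 := plane_count f (fun x y z => k) w
    rw [← hA] at h2
    rw [h2]
    rw [hw.2] at h1
    refine le_trans ?_ h1
    have : ((A k).card : ℝ) / Fintype.card F ≤ ε * (Fintype.card F : ℝ) ^ 2 := by
      rw [div_le_iff₀ (by linarith)]; linarith [hf' k]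
    linarith
  have e1 : (S.card : ℝ) = ∑ k : K, ((S.filter (fun w => g w = k)).card : ℝ) := by
    exact_mod_cast Finset.card_eq_sum_card_fiberwise (fun _ _ => Finset.mem_coe.mpr (Finset.mem_univ _))
  have e2 : (Fintype.card F : ℝ) ^ 3 = ∑ k : K, ((A k).card : ℝ) := by
    have : (Finset.univ : Finset (F × F × F)).card = ∑ k : K, (A k).card := by
      simp only [hA]
      exact Finset.card_eq_sum_card_fiberwise (fun _ _ => Finset.mem_coe.mpr (Finset.mem_univ _))
    rw [Finset.card_univ, Fintype.card_prod, Fintype.card_prod] at this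
    have h2 : ((Fintype.card F * (Fintype.card F * Fintype.card F) : ℕ) : ℝ) = ∑ k : K, ((A k).card : ℝ) := by
      exact_mod_cast this
    rw [← h2]; push_cast; ring
  have key2 : (S.card : ℝ) * (0.2 * ε * (Fintype.card F : ℝ) ^ 2) ^ 2 ≤ (Fintype.card F : ℝ) ^ 2 * (Fintype.card F : ℝ) ^ 3 := by
    rw [e1, e2, Finset.sum_mul, Finset.mul_sum]
    exact Finset.sum_le_sum (fun k _ => key k)
  rw [le_div_iff₀ (by positivity)]
  generalize (S.card : ℝ) = s at *
  generalize (Fintype.card F : ℝ) = q at *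
  have h0 : 0 < q := by linarith
  have h3 : q ^ 4 * (s * ε ^ 2) ≤ q ^ 4 * (99 * q ^ 2) := by
    have : q ^ 5 ≤ q ^ 6 := pow_le_pow_right₀ hq (by norm_num)
    have h6 : 0 ≤ q ^ 6 := by positivity
    nlinarith
  exact le_of_mul_le_mul_left h3 (by positivity)

end Helpers
end Paper

namespace Paper
set_option linter.unusedSectionVars false
section Helpers
open Classical

variable {F K : Type*} [Field F] [Fintype F] [Field K]

lemma card_m2 : ((Finset.univ.filter (fun s : Fin 2 → Fin 2 → F =>
      s 0 0 * s 1 1 - s 0 1 * s 1 0 ≠ 0)).card : ℝ) =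
    ((Fintype.card F : ℝ) ^ 2 - 1) * ((Fintype.card F : ℝ) ^ 2 - Fintype.card F) := by
  have h := card_linearIndependent (K := F) (V := Fin 2 → F) (k := 2) (by simp)
  have hq : 1 ≤ Fintype.card F := Nat.succ_le_of_lt card_pos_F
  rw [Nat.card_eq_fintype_card, Fintype.card_subtype] at h
  have e : (Finset.univ.filter (fun s : Fin 2 → Fin 2 → F => s 0 0 * s 1 1 - s 0 1 * s 1 0 ≠ 0)) =
      Finset.univ.filter (fun s : Fin 2 → Fin 2 → F => LinearIndependent F s) := by
    ext s
    rw [Finset.mem_filter, Finset.mem_filter]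
    have := Matrix.linearIndependent_rows_iff_isUnit (A := Matrix.of s)
    rw [Matrix.isUnit_iff_isUnit_det, isUnit_iff_ne_zero, Matrix.det_fin_two] at this
    have h2 : (Matrix.of s).row = s := rfl
    rw [h2] at this
    rw [this]; rfl
  rw [e, h]
  simp only [Fin.prod_univ_two, Module.finrank_fin_fun]
  rw [Nat.cast_mul, Nat.cast_sub, Nat.cast_sub]
  · push_cast; simp
  · exact Nat.pow_le_pow_right hq (by simp)
  · exact Nat.pow_le_pow_right hq (by simp)

lemma card_li3 : ((Finset.univ.filter (fun p : (Fin 3 → F) × (Fin 3 → F) × (Fin 3 → F) =>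
      LinearIndependent F ![p.2.1, p.2.2])).card : ℝ) =
    (Fintype.card F : ℝ) ^ 3 * (((Fintype.card F : ℝ) ^ 3 - 1) * ((Fintype.card F : ℝ) ^ 3 - Fintype.card F)) := by
  have h := card_linearIndependent (K := F) (V := Fin 3 → F) (k := 2) (by simp)
  have hq : 1 ≤ Fintype.card F := Nat.succ_le_of_lt card_pos_F
  rw [Nat.card_eq_fintype_card, Fintype.card_subtype] at h
  have e : (Finset.univ.filter (fun p : (Fin 3 → F) × (Fin 3 → F) × (Fin 3 → F) =>
      LinearIndependent F ![p.2.1, p.2.2])).card =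
      ((Finset.univ : Finset (Fin 3 → F)) ×ˢ
        Finset.univ.filter (fun s : Fin 2 → Fin 3 → F => LinearIndependent F s)).card := by
    apply Finset.card_bij' (fun p _ => (p.1, ![p.2.1, p.2.2])) (fun u _ => (u.1, u.2 0, u.2 1))
    case hi =>
      intro p hp
      rw [Finset.mem_filter] at hp
      rw [Finset.mem_product, Finset.mem_filter]
      exact ⟨Finset.mem_univ _, Finset.mem_univ _, hp.2⟩
    case hj =>
      rintro ⟨a, s⟩ hu
      rw [Finset.mem_product, Finset.mem_filter] at hu
      rw [Finset.mem_filter]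
      refine ⟨Finset.mem_univ _, ?_⟩
      have : ![s 0, s 1] = s := by ext i; fin_cases i <;> rfl
      simp only [this]
      exact hu.2.2
    case left_inv => intro p _; rfl
    case right_inv =>
      rintro ⟨a, s⟩ _
      have : ![s 0, s 1] = s := by ext i; fin_cases i <;> rfl
      simp only [this]
  rw [e, Finset.card_product, h, Finset.card_univ, Fintype.card_fun]
  simp only [Fin.prod_univ_two, Module.finrank_fin_fun]
  rw [Nat.cast_mul, Nat.cast_mul, Nat.cast_sub, Nat.cast_sub]
  · push_cast; simp
  · exact Nat.pow_le_pow_right hq (by simp)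
  · exact Nat.pow_le_pow_right hq (by simp)

/-- The minor that decides verticality. -/
def Mnr (p : (Fin 3 → F) × (Fin 3 → F) × (Fin 3 → F)) : F :=
  p.2.1 0 * p.2.2 1 - p.2.1 1 * p.2.2 0

lemma li_of_mnr (p : (Fin 3 → F) × (Fin 3 → F) × (Fin 3 → F)) (h : Mnr p ≠ 0) :
    LinearIndependent F ![p.2.1, p.2.2] := by
  rw [LinearIndependent.pair_iff]
  intro s t hst
  have h0 := congrFun hst 0
  have h1 := congrFun hst 1
  simp only [Pi.add_apply, Pi.smul_apply, smul_eq_mul, Pi.zero_apply] at h0 h1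
  constructor
  · apply (mul_eq_zero.mp (?_ : s * Mnr p = 0)).resolve_right h
    simp only [Mnr]
    linear_combination p.2.2 1 * h0 - p.2.2 0 * h1
  · apply (mul_eq_zero.mp (?_ : t * Mnr p = 0)).resolve_right h
    simp only [Mnr]
    linear_combination p.2.1 0 * h1 - p.2.1 1 * h0

lemma card_nv : (Fintype.card F : ℝ) ^ 5 *
      (((Fintype.card F : ℝ) ^ 2 - 1) * ((Fintype.card F : ℝ) ^ 2 - Fintype.card F)) ≤
    ((Finset.univ.filter (fun p : (Fin 3 → F) × (Fin 3 → F) × (Fin 3 → F) => Mnr p ≠ 0)).card : ℝ) := by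
  rw [← card_m2]
  have : (((Finset.univ : Finset ((Fin 3 → F) × F × F)) ×ˢ Finset.univ.filter (fun s : Fin 2 → Fin 2 → F =>
      s 0 0 * s 1 1 - s 0 1 * s 1 0 ≠ 0)).card) ≤
      (Finset.univ.filter (fun p : (Fin 3 → F) × (Fin 3 → F) × (Fin 3 → F) => Mnr p ≠ 0)).card := by
    apply Finset.card_le_card_of_injOn
      (fun u => (u.1.1, ![u.2 0 0, u.2 0 1, u.1.2.1], ![u.2 1 0, u.2 1 1, u.1.2.2]))
    · rintro ⟨⟨a, z, z'⟩, s⟩ h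
      rw [Finset.mem_coe, Finset.mem_product, Finset.mem_filter] at h
      rw [Finset.mem_coe, Finset.mem_filter]
      refine ⟨Finset.mem_univ _, ?_⟩
      simp only [Mnr]
      exact h.2.2
    · rintro ⟨⟨a, z, z'⟩, s⟩ _ ⟨⟨a', w, w'⟩, s'⟩ _ he
      simp only [Prod.mk.injEq] at he
      obtain ⟨rfl, h1, h2⟩ := he
      have a0 := congrFun h1 0
      have a1 := congrFun h1 1
      have a2 := congrFun h1 2
      have b0 := congrFun h2 0
      have b1 := congrFun h2 1
      have b2 := congrFun h2 2
      simp only [Matrix.cons_val] at a0 a1 a2 b0 b1 b2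
      have hs : s = s' := by
        ext i j
        fin_cases i <;> fin_cases j
        · exact a0
        · exact a1
        · exact b0
        · exact b1
      rw [hs, a2, b2]
  rw [Finset.card_product, Finset.card_univ, Fintype.card_prod, Fintype.card_prod, Fintype.card_fun] at this
  have h2 : (((Fintype.card F ^ Fintype.card (Fin 3) * (Fintype.card F * Fintype.card F)) *
    (Finset.univ.filter (fun s : Fin 2 → Fin 2 → F =>
      s 0 0 * s 1 1 - s 0 1 * s 1 0 ≠ 0)).card : ℕ) : ℝ) ≤ ((Finset.univ.filter (fun p : (Fin 3 → F) × (Fin 3 → F) × (Fin 3 → F) => Mnr p ≠ 0)).card : ℝ) := by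
    exact_mod_cast this
  refine le_trans (le_of_eq ?_) h2
  rw [Nat.cast_mul]
  congr 1
  simp
  ring

/-- The parametrized plane `p` lies on the plane `w`. -/
def OnPl (w : F × F × F) (p : (Fin 3 → F) × (Fin 3 → F) × (Fin 3 → F)) : Prop :=
  dot w (p.1 0, p.1 1, 1) = p.1 2 ∧ dot w (p.2.1 0, p.2.1 1, 0) = p.2.1 2 ∧
    dot w (p.2.2 0, p.2.2 1, 0) = p.2.2 2

lemma exists_onPl (p : (Fin 3 → F) × (Fin 3 → F) × (Fin 3 → F)) (h : Mnr p ≠ 0) : ∃ w, OnPl w p := by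
  obtain ⟨α, hα⟩ : ∃ α, α = (p.2.1 2 * p.2.2 1 - p.2.2 2 * p.2.1 1) / Mnr p := ⟨_, rfl⟩
  obtain ⟨β, hβ⟩ : ∃ β, β = (p.2.1 0 * p.2.2 2 - p.2.2 0 * p.2.1 2) / Mnr p := ⟨_, rfl⟩
  rw [eq_div_iff h] at hα hβ
  refine ⟨(α, β, p.1 2 - α * p.1 0 - β * p.1 1), ?_, ?_, ?_⟩
  · simp only [dot]; ring
  · apply mul_right_cancel₀ h
    simp only [dot]
    have : p.2.1 2 * Mnr p = p.2.1 2 * (p.2.1 0 * p.2.2 1 - p.2.1 1 * p.2.2 0) := rfl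
    linear_combination p.2.1 0 * hα + p.2.1 1 * hβ - this
  · apply mul_right_cancel₀ h
    simp only [dot]
    have : p.2.2 2 * Mnr p = p.2.2 2 * (p.2.1 0 * p.2.2 1 - p.2.1 1 * p.2.2 0) := rfl
    linear_combination p.2.2 0 * hα + p.2.2 1 * hβ - this

lemma card_fiber (w : F × F × F) :
    ((Finset.univ.filter (fun p : (Fin 3 → F) × (Fin 3 → F) × (Fin 3 → F) => Mnr p ≠ 0 ∧ OnPl w p)).card : ℝ) ≤
    (Fintype.card F : ℝ) ^ 2 *
      (((Fintype.card F : ℝ) ^ 2 - 1) * ((Fintype.card F : ℝ) ^ 2 - Fintype.card F)) := by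
  rw [← card_m2]
  have : (Finset.univ.filter (fun p : (Fin 3 → F) × (Fin 3 → F) × (Fin 3 → F) => Mnr p ≠ 0 ∧ OnPl w p)).card ≤
     (((Finset.univ : Finset (F × F)) ×ˢ Finset.univ.filter (fun s : Fin 2 → Fin 2 → F =>
      s 0 0 * s 1 1 - s 0 1 * s 1 0 ≠ 0)).card) := by
    apply Finset.card_le_card_of_injOn
      (fun p => ((p.1 0, p.1 1), ![![p.2.1 0, p.2.1 1], ![p.2.2 0, p.2.2 1]]))
    · intro p h
      rw [Finset.mem_coe, Finset.mem_filter] at h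
      rw [Finset.mem_coe, Finset.mem_product, Finset.mem_filter]
      refine ⟨Finset.mem_univ _, Finset.mem_univ _, ?_⟩
      exact h.2.1
    · rintro ⟨a, b, c⟩ h ⟨a', b', c'⟩ h' he
      rw [Finset.mem_coe, Finset.mem_filter] at h h'
      obtain ⟨-, -, h1, h2, h3⟩ := h
      obtain ⟨-, -, k1, k2, k3⟩ := h'
      simp only [Prod.mk.injEq] at he h1 h2 h3 k1 k2 k3
      obtain ⟨⟨a0, a1⟩, hm⟩ := he
      have b0 := congrFun (congrFun hm 0) 0
      have b1 := congrFun (congrFun hm 0) 1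
      have c0 := congrFun (congrFun hm 1) 0
      have c1 := congrFun (congrFun hm 1) 1
      simp only [Matrix.cons_val] at b0 b1 c0 c1
      rw [a0, a1, k1] at h1
      rw [b0, b1, k2] at h2
      rw [c0, c1, k3] at h3
      have ea : a = a' := by
        ext i; fin_cases i
        · exact a0
        · exact a1
        · exact h1.symm
      have eb : b = b' := by
        ext i; fin_cases i
        · exact b0
        · exact b1
        · exact h2.symm
      have ec : c = c' := by
        ext i; fin_cases i
        · exact c0
        · exact c1
        · exact h3.symm
      rw [ea, eb, ec]
  rw [Finset.card_product, Finset.card_univ, Fintype.card_prod] at this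
  have h2 : ((Finset.univ.filter (fun p : (Fin 3 → F) × (Fin 3 → F) × (Fin 3 → F) => Mnr p ≠ 0 ∧ OnPl w p)).card : ℝ) ≤ (((Fintype.card F * Fintype.card F) *
    (Finset.univ.filter (fun s : Fin 2 → Fin 2 → F =>
      s 0 0 * s 1 1 - s 0 1 * s 1 0 ≠ 0)).card : ℕ) : ℝ) := by
    exact_mod_cast this
  refine le_trans h2 (le_of_eq ?_)
  rw [Nat.cast_mul]
  congr 1
  push_cast
  ring

open MvPolynomial in
/-- Transfer of agreement from a parametrized plane to the graph form. -/
lemma transfer (ι : F →+* K) (d : ℕ) (f : (Fin 3 → F) → K) (p : (Fin 3 → F) × (Fin 3 → F) × (Fin 3 → F))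
    (h : Mnr p ≠ 0) (w : F × F × F) (hw : OnPl w p) (Q : MvPolynomial (Fin 2) K) (hQ : Q.totalDegree ≤ d) :
    ∃ g : MvPolynomial (Fin 2) K, g.totalDegree ≤ d ∧
      (Finset.univ.filter (fun u : F × F => f (p.1 + u.1 • p.2.1 + u.2 • p.2.2) =
        eval ![ι u.1, ι u.2] Q)).card ≤
      (Finset.univ.filter (fun u : F × F => f ![u.1, u.2, dot w (u.1, u.2, 1)] =
        eval ![ι u.1, ι u.2] g)).card := by
  obtain ⟨a, b, c⟩ := p
  obtain ⟨h1, h2, h3⟩ := hw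
  obtain ⟨D, hD⟩ : ∃ D, D = Mnr (a, b, c) := ⟨_, rfl⟩
  rw [← hD] at h
  simp only [Mnr] at hD
  simp only [dot] at h1 h2 h3
  obtain ⟨l, hl⟩ : ∃ l : Fin 2 → MvPolynomial (Fin 2) K, l =
     ![C (ι (c 1 / D)) * X 0 + C (ι (- c 0 / D)) * X 1 + C (ι ((- a 0 * c 1 + a 1 * c 0) / D)),
      C (ι (- b 1 / D)) * X 0 + C (ι (b 0 / D)) * X 1 + C (ι ((- b 0 * a 1 + b 1 * a 0) / D))] := ⟨_, rfl⟩
  have hlin : ∀ α β γ : K, (C α * X 0 + C β * X 1 + C γ : MvPolynomial (Fin 2) K).totalDegree ≤ 1 := by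
    intro α β γ
    refine le_trans (totalDegree_add _ _) (max_le (le_trans (totalDegree_add _ _) (max_le ?_ ?_)) ?_)
    · refine le_trans (totalDegree_mul _ _) ?_; simp
    · refine le_trans (totalDegree_mul _ _) ?_; simp
    · rw [totalDegree_C]; exact Nat.zero_le _
  have evl : ∀ α β γ u v : K, eval ![u, v] (C α * X 0 + C β * X 1 + C γ : MvPolynomial (Fin 2) K) =
      α * u + β * v + γ := by
    intro α β γ u v
    simp
  have hev : ∀ s t : F, eval ![ι (a 0 + s * b 0 + t * c 0), ι (a 1 + s * b 1 + t * c 1)] (aeval l Q) =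
      eval ![ι s, ι t] Q := by
    intro s t
    rw [eval_aeval']
    congr 2
    ext i
    fin_cases i
    · rw [hl]
      refine (evl _ _ _ _ _).trans ?_
      rw [← map_mul, ← map_mul, ← map_add, ← map_add]
      show ι _ = ι s
      congr 1
      field_simp
      rw [hD]; ring
    · rw [hl]
      refine (evl _ _ _ _ _).trans ?_
      rw [← map_mul, ← map_mul, ← map_add, ← map_add]
      show ι _ = ι t
      congr 1
      field_simp
      rw [hD]; ring
  refine ⟨aeval l Q, le_trans (totalDegree_aeval_le _ ?_ _) hQ, ?_⟩
  · intro i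
    rw [hl]
    fin_cases i
    · exact hlin _ _ _
    · exact hlin _ _ _
  · apply Finset.card_le_card_of_injOn
      (fun u => (a 0 + u.1 * b 0 + u.2 * c 0, a 1 + u.1 * b 1 + u.2 * c 1))
    · rintro ⟨s, t⟩ hu
      rw [Finset.mem_coe, Finset.mem_filter] at hu
      rw [Finset.mem_coe, Finset.mem_filter]
      refine ⟨Finset.mem_univ _, ?_⟩
      simp only [hev]
      have hu := hu.2
      simp only at hu
      rw [← hu]
      congr 1
      ext i
      fin_cases i
      · simp
      · simp
      · simp only [dot, Fin.reduceFinMk, Matrix.cons_val, Pi.add_apply, Pi.smul_apply, smul_eq_mul]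
        linear_combination h1 + s * h2 + t * h3
    · rintro ⟨s, t⟩ _ ⟨s', t'⟩ _ he
      simp only [Prod.mk.injEq] at he
      obtain ⟨e0, e1⟩ := he
      have hs : s = s' := by
        apply mul_right_cancel₀ h
        rw [hD]
        linear_combination c 1 * e0 - c 0 * e1
      have ht : t = t' := by
        apply mul_right_cancel₀ h
        rw [hD]
        linear_combination b 0 * e1 - b 1 * e0
      rw [hs, ht]

/-- The counting reduction. -/
lemma count_reduction (Good : (Fin 3 → F) × (Fin 3 → F) × (Fin 3 → F) → Prop) (S : Finset (F × F × F))
    (hS : ∀ p w, Good p → Mnr p ≠ 0 → OnPl w p → w ∈ S) (ε : ℝ) (hε : 0 < ε) (hε1 : ε ≤ 1)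
    (hSc : (S.card : ℝ) ≤ 99 * (Fintype.card F : ℝ) ^ 2 / ε ^ 2) :
    ((Finset.univ.filter (fun p : (Fin 3 → F) × (Fin 3 → F) × (Fin 3 → F) =>
      LinearIndependent F ![p.2.1, p.2.2] ∧ Good p)).card : ℝ) /
    ((Finset.univ.filter (fun p : (Fin 3 → F) × (Fin 3 → F) × (Fin 3 → F) =>
      LinearIndependent F ![p.2.1, p.2.2])).card : ℝ) ≤ 100 / (ε ^ 2 * Fintype.card F) := by
  have hq2 : (2:ℝ) ≤ Fintype.card F := by exact_mod_cast Fintype.one_lt_card (α := F)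
  obtain ⟨LI, hLI⟩ : ∃ LI : (Fin 3 → F) × (Fin 3 → F) × (Fin 3 → F) → Prop,
    ∀ p, LI p ↔ LinearIndependent F ![p.2.1, p.2.2] := ⟨_, fun _ => Iff.rfl⟩
  obtain ⟨NV, hNV⟩ : ∃ NV : (Fin 3 → F) × (Fin 3 → F) × (Fin 3 → F) → Prop,
    ∀ p, NV p ↔ Mnr p ≠ 0 := ⟨_, fun _ => Iff.rfl⟩
  have N1 := card_li3 (F := F)
  have N2 := card_nv (F := F)
  simp only [← hLI, ← hNV] at N1 N2 ⊢
  have hsub : Finset.univ.filter (fun p => LI p ∧ Good p) ⊆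
      ((Finset.univ.filter LI) \ (Finset.univ.filter NV)) ∪
      S.biUnion (fun w => Finset.univ.filter (fun p => Mnr p ≠ 0 ∧ OnPl w p)) := by
    intro p hp
    rw [Finset.mem_filter] at hp
    obtain ⟨-, hp1, hp2⟩ := hp
    rw [Finset.mem_union]
    by_cases hn : NV p
    · right
      rw [hNV] at hn
      obtain ⟨w, hw⟩ := exists_onPl p hn
      rw [Finset.mem_biUnion]
      refine ⟨w, hS p w hp2 hn hw, ?_⟩
      rw [Finset.mem_filter]
      exact ⟨Finset.mem_univ _, hn, hw⟩
    · left
      rw [Finset.mem_sdiff, Finset.mem_filter, Finset.mem_filter]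
      exact ⟨⟨Finset.mem_univ _, hp1⟩, fun h => hn h.2⟩
  have hnl : Finset.univ.filter NV ⊆ Finset.univ.filter LI := by
    intro p hp
    rw [Finset.mem_filter] at hp ⊢
    refine ⟨Finset.mem_univ _, ?_⟩
    rw [hLI]
    exact li_of_mnr p ((hNV p).mp hp.2)
  have c1 : (((Finset.univ.filter LI) \ (Finset.univ.filter NV)).card : ℝ) =
      (Finset.univ.filter LI).card - (Finset.univ.filter NV).card := by
    rw [Finset.card_sdiff_of_subset hnl, Nat.cast_sub (Finset.card_le_card hnl)]
  have c2 : ((S.biUnion (fun w => Finset.univ.filter (fun p => Mnr p ≠ 0 ∧ OnPl w p))).card : ℝ) ≤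
      S.card * ((Fintype.card F : ℝ) ^ 2 *
      (((Fintype.card F : ℝ) ^ 2 - 1) * ((Fintype.card F : ℝ) ^ 2 - Fintype.card F))) := by
    have h1 : ((S.biUnion (fun w => Finset.univ.filter (fun p => Mnr p ≠ 0 ∧ OnPl w p))).card : ℝ) ≤
      ∑ w ∈ S, ((Finset.univ.filter (fun p => Mnr p ≠ 0 ∧ OnPl w p)).card : ℝ) := by
      exact_mod_cast Finset.card_biUnion_le
    refine le_trans h1 ?_
    rw [← nsmul_eq_mul]
    apply Finset.sum_le_card_nsmul
    intro w _
    exact card_fiber w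
  have c3 : ((Finset.univ.filter (fun p => LI p ∧ Good p)).card : ℝ) ≤
      (((Finset.univ.filter LI) \ (Finset.univ.filter NV)).card : ℝ) +
      ((S.biUnion (fun w => Finset.univ.filter (fun p => Mnr p ≠ 0 ∧ OnPl w p))).card : ℝ) := by
    exact_mod_cast le_trans (Finset.card_le_card hsub) (Finset.card_union_le _ _)
  rw [c1] at c3
  generalize ((Finset.univ.filter (fun p => LI p ∧ Good p)).card : ℝ) = G at *
  generalize ((S.biUnion (fun w => Finset.univ.filter (fun p => Mnr p ≠ 0 ∧ OnPl w p))).card : ℝ) = H at *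
  have N1' : ((Finset.univ.filter LI).card : ℝ) = (Fintype.card F : ℝ) ^ 3 * (((Fintype.card F : ℝ) ^ 3 - 1) * ((Fintype.card F : ℝ) ^ 3 - Fintype.card F)) := by
    rw [← N1]
  have N2' : (Fintype.card F : ℝ) ^ 5 *
      (((Fintype.card F : ℝ) ^ 2 - 1) * ((Fintype.card F : ℝ) ^ 2 - Fintype.card F)) ≤ ((Finset.univ.filter NV).card : ℝ) := N2
  clear N1 N2 c1
  generalize ((Finset.univ.filter LI).card : ℝ) = N at *
  generalize ((Finset.univ.filter NV).card : ℝ) = M at *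
  generalize (S.card : ℝ) = s at *
  generalize (Fintype.card F : ℝ) = q at *
  clear hsub hnl hS hLI hNV
  have q0 : 0 < q := by linarith
  have hA : 0 < q ^ 2 - 1 := by nlinarith
  have hB : 0 < q ^ 2 - q := by nlinarith
  have hC : 0 < q ^ 3 - 1 := by nlinarith
  have hD : 0 < q ^ 3 - q := by nlinarith
  have hN : 0 < N := by rw [N1']; positivity
  -- vertical planes
  have v1 : N - M ≤ N / q := by
    have : N / q = q ^ 2 * ((q ^ 3 - 1) * (q ^ 3 - q)) := by rw [N1']; field_simp
    rw [this]
    have h2 : q ^ 3 * ((q ^ 3 - 1) * (q ^ 3 - q)) - q ^ 5 * ((q ^ 2 - 1) * (q ^ 2 - q)) ≤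
        q ^ 2 * ((q ^ 3 - 1) * (q ^ 3 - q)) := by
      have : q ^ 2 * ((q ^ 3 - 1) * (q ^ 3 - q)) - (q ^ 3 * ((q ^ 3 - 1) * (q ^ 3 - q)) - q ^ 5 * ((q ^ 2 - 1) * (q ^ 2 - q)))
        = q ^ 3 * ((q ^ 2 - 1) * (q - 1)) := by ring
      have : 0 ≤ q ^ 3 * ((q ^ 2 - 1) * (q - 1)) :=
        mul_nonneg (by positivity) (mul_nonneg hA.le (by linarith))
      linarith
    linarith
  have v2 : q ^ 5 * ((q ^ 2 - 1) * (q ^ 2 - q)) ≤ N := by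
    rw [N1']
    have : q ^ 3 * ((q ^ 3 - 1) * (q ^ 3 - q)) - q ^ 5 * ((q ^ 2 - 1) * (q ^ 2 - q)) = q ^ 4 * (q ^ 2 - 1) ^ 2 := by ring
    have : 0 ≤ q ^ 4 * (q ^ 2 - 1) ^ 2 := by positivity
    linarith
  have v3 : H ≤ 99 / (ε ^ 2 * q) * N := by
    have h1 : H ≤ 99 * q ^ 2 / ε ^ 2 * (q ^ 2 * ((q ^ 2 - 1) * (q ^ 2 - q))) :=
      le_trans c2 (mul_le_mul_of_nonneg_right hSc (by positivity))
    have h2 : 99 * q ^ 2 / ε ^ 2 * (q ^ 2 * ((q ^ 2 - 1) * (q ^ 2 - q))) =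
        99 / (ε ^ 2 * q) * (q ^ 5 * ((q ^ 2 - 1) * (q ^ 2 - q))) := by
      field_simp
    rw [h2] at h1
    exact le_trans h1 (mul_le_mul_of_nonneg_left v2 (by positivity))
  rw [div_le_iff₀ hN]
  have v4 : N / q ≤ 1 / (ε ^ 2 * q) * N := by
    have h1 : 1 / q ≤ 1 / (ε ^ 2 * q) := by
      apply one_div_le_one_div_of_le (by positivity)
      have : ε ^ 2 ≤ 1 := pow_le_one₀ hε.le hε1
      nlinarith
    have h2 := mul_le_mul_of_nonneg_right h1 hN.le
    have h3 : 1 / q * N = N / q := by ring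
    linarith
  have v5 : 100 / (ε ^ 2 * q) * N = 99 / (ε ^ 2 * q) * N + 1 / (ε ^ 2 * q) * N := by ring
  linarith

end Helpers
end Paper

namespace Paper
section Helpers
open Classical

lemma agr_eq {U V : Type*} [Fintype U] (f g : U → V) :
    agr f g = ((Finset.univ.filter (fun x => f x = g x)).card : ℝ) / Fintype.card U := by
  rw [agr, Nat.card_eq_fintype_card, Fintype.card_subtype]

lemma agr_le_one {U V : Type*} [Fintype U] (f g : U → V) : agr f g ≤ 1 := by
  rw [agr_eq]
  apply div_le_one_of_le₀
  · exact_mod_cast Finset.card_le_univ _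
  · positivity

lemma agrRM2_attained {Fq Fq' : Type} [Field Fq] [Fintype Fq] [Field Fq']
    (ι : Fq →+* Fq') (d : ℕ) (g : Fq → Fq → Fq') :
    ∃ p : MvPolynomial (Fin 2) Fq', p.totalDegree ≤ d ∧
    agrRM2 ι d g = agr (fun st : Fq × Fq => g st.1 st.2)
      fun st : Fq × Fq => MvPolynomial.eval ![ι st.1, ι st.2] p := by
  have hne : {r : ℝ | ∃ p : MvPolynomial (Fin 2) Fq', p.totalDegree ≤ d ∧
    r = agr (fun st : Fq × Fq => g st.1 st.2)
      fun st : Fq × Fq => MvPolynomial.eval ![ι st.1, ι st.2] p}.Nonempty := ⟨_, 0, by simp, rfl⟩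
  have hfin : {r : ℝ | ∃ p : MvPolynomial (Fin 2) Fq', p.totalDegree ≤ d ∧
    r = agr (fun st : Fq × Fq => g st.1 st.2)
      fun st : Fq × Fq => MvPolynomial.eval ![ι st.1, ι st.2] p}.Finite := by
    apply Set.Finite.subset (Set.finite_range (fun A : Finset (Fq × Fq) => (A.card : ℝ) / Fintype.card (Fq × Fq)))
    rintro r ⟨p, -, hr⟩
    rw [agr_eq] at hr
    exact ⟨_, hr.symm⟩
  obtain ⟨p, hp, he⟩ := hne.csSup_mem hfin
  exact ⟨p, hp, he⟩

lemma card_triple {F K : Type*} [Field F] [Fintype F] (f g : (Fin 3 → F) → K) :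
    (Finset.univ.filter (fun p : F × F × F => f ![p.1, p.2.1, p.2.2] = g ![p.1, p.2.1, p.2.2])).card =
      (Finset.univ.filter (fun x => f x = g x)).card := by
  have hx : ∀ x : Fin 3 → F, ![x 0, x 1, x 2] = x := by
    intro x; ext i; fin_cases i <;> rfl
  apply Finset.card_bij (fun p _ => ![p.1, p.2.1, p.2.2])
  · intro p hp
    rw [Finset.mem_filter] at hp ⊢
    exact ⟨Finset.mem_univ _, hp.2⟩
  · rintro ⟨x, y, z⟩ _ ⟨x', y', z'⟩ _ he
    have a0 := congrFun he 0
    have a1 := congrFun he 1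
    have a2 := congrFun he 2
    simp only [Matrix.cons_val] at a0 a1 a2
    rw [a0, a1, a2]
  · intro x hxm
    rw [Finset.mem_filter] at hxm
    refine ⟨(x 0, x 1, x 2), ?_, hx x⟩
    rw [Finset.mem_filter]
    refine ⟨Finset.mem_univ _, ?_⟩
    simp only [hx]
    exact hxm.2

/-- The bound on the number of good non-vertical planes. -/
lemma S_bound {F K : Type} [Field F] [Fintype F] [Field K] [Fintype K] (ι : F →+* K) (d : ℕ)
    (f : (Fin 3 → F) → K) (ε : ℝ) (hε : 0 < ε) (hε1 : ε ≤ 5 / 6)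
    (hd : ((d : ℝ) / Fintype.card F) ≤ ε ^ 100)
    (hf : ∀ G : (Fin 3 → F) → K, IsDegLE ι 3 d G → agr f G ≤ ε)
    (S : Finset (F × F × F))
    (hS : ∀ w ∈ S, ∃ g : MvPolynomial (Fin 2) K, g.totalDegree ≤ d ∧
      1.2 * ε * (Fintype.card F : ℝ) ^ 2 ≤
      ((Finset.univ.filter (fun p : F × F => f ![p.1, p.2, dot w (p.1, p.2, 1)] =
        MvPolynomial.eval ![ι p.1, ι p.2] g)).card : ℝ)) :
    (S.card : ℝ) ≤ 99 * (Fintype.card F : ℝ) ^ 2 / ε ^ 2 := by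
  have hq : (0:ℝ) < Fintype.card F := by exact_mod_cast card_pos_F
  have hf' : ∀ P : MvPolynomial (Fin 3) K, P.totalDegree ≤ d →
      ((Finset.univ.filter (fun p : F × F × F => f ![p.1, p.2.1, p.2.2] =
        MvPolynomial.eval ![ι p.1, ι p.2.1, ι p.2.2] P)).card : ℝ) ≤ ε * (Fintype.card F : ℝ) ^ 3 := by
    intro P hP
    have h1 := hf (fun x => MvPolynomial.eval (fun i => ι (x i)) P) ⟨P, hP, fun _ => rfl⟩
    rw [agr_eq, ← card_triple, div_le_iff₀ (by exact_mod_cast Fintype.card_pos), Fintype.card_fun] at h1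
    simp only [ev3, Matrix.cons_val, Fintype.card_fin, Nat.cast_pow] at h1
    exact h1
  choose! g hg hg2 using hS
  rcases Nat.eq_zero_or_pos d with rfl | hd1
  · have hgc : ∀ w ∈ S, g w = MvPolynomial.C ((g w).coeff 0) := by
      intro w hw
      exact MvPolynomial.totalDegree_eq_zero_iff_eq_C.mp (Nat.le_zero.mp (hg w hw))
    refine S_bound_zero (fun x y z => f ![x, y, z]) ε hε ?_ S (fun w => (g w).coeff 0) ?_
    · intro k
      have := hf' (MvPolynomial.C k) (by simp)
      simpa only [MvPolynomial.eval_C] using this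
    · intro w hw
      have := hg2 w hw
      rw [hgc w hw] at this
      simpa only [MvPolynomial.eval_C] using this
  · refine S_bound_pos ι d (fun x y z => f ![x, y, z]) ε hε (by linarith) hd1 ?_ hf' S g hg hg2
    have h1 : ε ^ 96 ≤ (5 / 6 : ℝ) ^ 96 := pow_le_pow_left₀ hε.le hε1 _
    have h2 : (5 / 6 : ℝ) ^ 96 ≤ 1 / 1000000 := by norm_num
    have h3 : ε ^ 100 ≤ ε ^ 4 * (1 / 1000000) := by
      calc ε ^ 100 = ε ^ 4 * ε ^ 96 := by ring
        _ ≤ _ := mul_le_mul_of_nonneg_left (le_trans h1 h2) (by positivity)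
    have h4 := le_trans hd h3
    rw [div_le_iff₀ hq] at h4
    linarith

end Helpers

/-- Plane versus point: if `f : F_q³ → F_{q'}` has agreement at most `ε ≥ (d/q)^τ` with
every degree-`d` function, then the probability over a uniformly random affine plane `P`
(parametrized by triples `(a, b, c)` with `b, c` linearly independent, each plane
corresponding to the same number of triples) that `agr(f|_P, RM_{q'}[d, F_q²]) ≥ 1.2·ε`
is at most `100/(ε²·q)`. -/
theorem plane_vs_point_strong :
    ∃ τ : ℝ, 0 < τ ∧ τ < 1 / 20 ∧
      ∀ (Fq Fq' : Type) [Field Fq] [Fintype Fq] [Field Fq'] [Fintype Fq']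
        (ι : Fq →+* Fq') (d : ℕ), d < Fintype.card Fq →
        ∀ (f : (Fin 3 → Fq) → Fq') (ε : ℝ),
          ((d : ℝ) / Fintype.card Fq) ^ τ ≤ ε →
          (∀ F : (Fin 3 → Fq) → Fq', IsDegLE ι 3 d F → agr f F ≤ ε) →
          (Nat.card {p : (Fin 3 → Fq) × (Fin 3 → Fq) × (Fin 3 → Fq) //
              LinearIndependent Fq ![p.2.1, p.2.2] ∧
              1.2 * ε ≤ agrRM2 ι d fun s t => f (p.1 + s • p.2.1 + t • p.2.2)} : ℝ) /
            (Nat.card {p : (Fin 3 → Fq) × (Fin 3 → Fq) × (Fin 3 → Fq) //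
              LinearIndependent Fq ![p.2.1, p.2.2]} : ℝ) ≤
          100 / (ε ^ 2 * Fintype.card Fq) := by
  classical
  refine ⟨((100 : ℕ) : ℝ)⁻¹, by norm_num, by norm_num, ?_⟩
  intro F K _ _ _ _ ι d _ f ε hτ hf
  have hq : (0:ℝ) < Fintype.card F := by exact_mod_cast card_pos_F
  -- positivity of `ε`
  have hε : 0 < ε := by
    have h1 := hf (fun _ => f 0) ⟨MvPolynomial.C (f 0), by simp, fun _ => by simp⟩
    refine lt_of_lt_of_le ?_ h1
    rw [agr_eq]
    apply div_pos
    · have : 0 < (Finset.univ.filter (fun x => f x = f 0)).card :=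
        Finset.card_pos.mpr ⟨0, by rw [Finset.mem_filter]; exact ⟨Finset.mem_univ _, rfl⟩⟩
      exact_mod_cast this
    · exact_mod_cast Fintype.card_pos
  have hd : ((d : ℝ) / Fintype.card F) ≤ ε ^ 100 := by
    have h0 : (0:ℝ) ≤ (d : ℝ) / Fintype.card F := by positivity
    have h1 := pow_le_pow_left₀ (Real.rpow_nonneg h0 _) hτ 100
    rwa [Real.rpow_inv_natCast_pow h0 (by norm_num)] at h1
  by_cases hε1 : ε ≤ 5 / 6
  · obtain ⟨Good, hGood⟩ : ∃ Good : (Fin 3 → F) × (Fin 3 → F) × (Fin 3 → F) → Prop,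
      ∀ p, Good p ↔ 1.2 * ε ≤ agrRM2 ι d fun s t => f (p.1 + s • p.2.1 + t • p.2.2) :=
      ⟨_, fun _ => Iff.rfl⟩
    obtain ⟨Sp, hSp⟩ : ∃ Sp : F × F × F → Prop, ∀ w, Sp w ↔
      ∃ g : MvPolynomial (Fin 2) K, g.totalDegree ≤ d ∧
      1.2 * ε * (Fintype.card F : ℝ) ^ 2 ≤
      ((Finset.univ.filter (fun p : F × F => f ![p.1, p.2, dot w (p.1, p.2, 1)] =
        MvPolynomial.eval ![ι p.1, ι p.2] g)).card : ℝ) := ⟨_, fun _ => Iff.rfl⟩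
    obtain ⟨S, hS⟩ : ∃ S : Finset (F × F × F), ∀ w, w ∈ S ↔
      ∃ g : MvPolynomial (Fin 2) K, g.totalDegree ≤ d ∧
      1.2 * ε * (Fintype.card F : ℝ) ^ 2 ≤
      ((Finset.univ.filter (fun p : F × F => f ![p.1, p.2, dot w (p.1, p.2, 1)] =
        MvPolynomial.eval ![ι p.1, ι p.2] g)).card : ℝ) := by
      classical
      refine ⟨Finset.univ.filter Sp, fun w => ?_⟩
      rw [Finset.mem_filter, ← hSp]
      exact ⟨fun h => h.2, fun h => ⟨Finset.mem_univ _, h⟩⟩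
    have hSc := S_bound ι d f ε hε hε1 hd hf S (fun w hw => by
      obtain ⟨g, hg, hg2⟩ := (hS w).mp hw
      refine ⟨g, hg, le_trans hg2 (le_of_eq ?_)⟩
      congr!)
    have key := count_reduction Good S (by
      intro p w hp hm hw
      rw [hGood] at hp
      rw [hS]
      obtain ⟨Q, hQ, hQ2⟩ := agrRM2_attained ι d (fun s t => f (p.1 + s • p.2.1 + t • p.2.2))
      obtain ⟨g, hg, hg2⟩ := transfer ι d f p hm w hw Q hQ
      refine ⟨g, hg, ?_⟩
      rw [hQ2, agr_eq, le_div_iff₀ (by exact_mod_cast Fintype.card_pos), Fintype.card_prod] at hp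
      have e : (((Fintype.card F * Fintype.card F : ℕ)) : ℝ) = (Fintype.card F : ℝ) ^ 2 := by
        push_cast; ring
      rw [e] at hp
      refine le_trans hp ?_
      have hg3 := Nat.cast_le (α := ℝ).mpr hg2
      convert hg3) ε hε (by linarith) hSc
    simp only [← hGood]
    rw [Nat.card_eq_fintype_card, Nat.card_eq_fintype_card, Fintype.card_subtype, Fintype.card_subtype]
    convert key
  · push Not at hε1
    have : IsEmpty {p : (Fin 3 → F) × (Fin 3 → F) × (Fin 3 → F) //
              LinearIndependent F ![p.2.1, p.2.2] ∧
              1.2 * ε ≤ agrRM2 ι d fun s t => f (p.1 + s • p.2.1 + t • p.2.2)} := by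
      constructor
      rintro ⟨p, -, hp⟩
      obtain ⟨Q, hQ, hQ2⟩ := agrRM2_attained ι d (fun s t => f (p.1 + s • p.2.1 + t • p.2.2))
      rw [hQ2] at hp
      have := le_trans hp (agr_le_one _ _)
      linarith
    rw [Nat.card_of_isEmpty, Nat.cast_zero, zero_div]
    positivity

end Paper
end

section
/- There exists a constant τ ∈ (0, 1/20) such that the following holds. Let F_q ⊆ F_{q'} be finite fields and let d < q. Let f : F_q² → F_{q'} and let T be a degree-d lines table on F_q², i.e., an assignment of a degree-≤d function T[L] : L → F_{q'} to every affine line L ⊆ F_q². If Pr_L[f|_L = T[L]] = ε (probability over a uniformly random affine line L of F_q²) and ε⁶ ≥ √(d/q), then there exists a degree-≤d function Q : F_q² → F_{q'} such that Pr_{a ∈ F_q²}[Q(a) = f(a)] ≥ ε − 1.01·(d/q)^τ. -/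
namespace Paper

open Polynomial in
/-- `f` restricted to the parametrized line `a + t b` is a polynomial of degree at most `d`. -/
def Good {Fq Fq' : Type} [Field Fq] [Field Fq'] (ι : Fq →+* Fq') (d : ℕ)
    (f : (Fin 2 → Fq) → Fq') (a b : Fin 2 → Fq) : Prop :=
  ∃ p : Polynomial Fq', p.natDegree ≤ d ∧ ∀ t, f (a + t • b) = p.eval (ι t)

section

variable {Fq Fq' : Type} [Field Fq] [Field Fq'] {ι : Fq →+* Fq'} {d : ℕ}
  {f : (Fin 2 → Fq) → Fq'}

/-- Affine reparametrization of a good line. -/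
lemma Good.reparam {a b : Fin 2 → Fq} (h : Good ι d f a b) (s c : Fq) :
    Good ι d f (a + s • b) (c • b) := by
  obtain ⟨p, hp, hpe⟩ := h
  refine ⟨p.comp (Polynomial.C (ι s) + Polynomial.C (ι c) * Polynomial.X), ?_, ?_⟩
  · refine Polynomial.natDegree_comp_le.trans ?_
    have : (Polynomial.C (ι s) + Polynomial.C (ι c) * Polynomial.X).natDegree ≤ 1 := by
      rw [add_comm]; exact Polynomial.natDegree_linear_le
    nlinarith
  · intro t
    have : a + s • b + t • c • b = a + (s + c * t) • b := by
      ext i; simp; ring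
    rw [this, hpe]
    simp

/-- Restricting a bivariate polynomial to a line. -/
noncomputable def restr (P : MvPolynomial (Fin 2) Fq') (a b : Fin 2 → Fq') : Polynomial Fq' :=
  MvPolynomial.aeval (fun i => Polynomial.C (b i) * Polynomial.X + Polynomial.C (a i)) P

lemma restr_natDegree_le (P : MvPolynomial (Fin 2) Fq') (a b : Fin 2 → Fq') (n : ℕ)
    (h : P.totalDegree ≤ n) : (restr P a b).natDegree ≤ n := by
  have := MvPolynomial.aeval_natDegree_le P h
    (fun i => Polynomial.C (b i) * Polynomial.X + Polynomial.C (a i)) (n := 1)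
    (fun i => Polynomial.natDegree_linear_le)
  simpa [restr] using this

lemma restr_eval (P : MvPolynomial (Fin 2) Fq') (a b : Fin 2 → Fq') (t : Fq') :
    (restr P a b).eval t = MvPolynomial.eval (fun i => a i + t * b i) P := by
  unfold restr
  rw [MvPolynomial.aeval_def, ← Polynomial.coe_evalRingHom, MvPolynomial.hom_eval₂,
    MvPolynomial.eval, MvPolynomial.coe_eval₂Hom]
  congr 1
  · ext x; simp
  · ext i; simp; ring

lemma restr_coeff_top (P : MvPolynomial (Fin 2) Fq') (a b : Fin 2 → Fq') (n : ℕ)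
    (h : P.totalDegree ≤ n) :
    (restr P a b).coeff n = MvPolynomial.eval b (MvPolynomial.homogeneousComponent n P) := by
  have key : ∀ m : Fin 2 →₀ ℕ, m.degree ≤ n →
      (∏ i, (Polynomial.C (b i) * Polynomial.X + Polynomial.C (a i)) ^ m i).coeff n =
        if m.degree = n then ∏ i, b i ^ m i else 0 := by
    intro m hm
    have hd : m.degree = m 0 + m 1 := by simp [Finsupp.degree_eq_sum]
    have hn : ∀ i, ((Polynomial.C (b i) * Polynomial.X + Polynomial.C (a i)) ^ m i).natDegree
        ≤ m i := by
      intro i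
      refine Polynomial.natDegree_pow_le.trans ?_
      have := Polynomial.natDegree_linear_le (a := b i) (b := a i)
      nlinarith
    rw [Fin.prod_univ_two, Fin.prod_univ_two]
    split_ifs with h1
    · rw [← h1, hd, Polynomial.coeff_mul_add_eq_of_natDegree_le (hn 0) (hn 1)]
      have hc : ∀ i, ((Polynomial.C (b i) * Polynomial.X + Polynomial.C (a i)) ^ m i).coeff (m i)
          = b i ^ m i := by
        intro i
        have := Polynomial.coeff_pow_of_natDegree_le (m := m i)
          (Polynomial.natDegree_linear_le (a := b i) (b := a i))
        simpa using this
      rw [hc, hc]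
    · apply Polynomial.coeff_eq_zero_of_natDegree_lt
      refine Polynomial.natDegree_mul_le.trans_lt ?_
      have := hn 0
      have := hn 1
      omega
  have e1 : restr P a b = ∑ m ∈ P.support, Polynomial.C (P.coeff m) *
      ∏ i, (Polynomial.C (b i) * Polynomial.X + Polynomial.C (a i)) ^ m i := by
    unfold restr
    rw [MvPolynomial.aeval_def, MvPolynomial.eval₂_eq']
    rfl
  rw [e1, Polynomial.finsetSum_coeff, MvPolynomial.homogeneousComponent_apply, map_sum,
    Finset.sum_filter]
  refine Finset.sum_congr rfl fun m hm => ?_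
  have hmd : m.degree ≤ n := by
    have := MvPolynomial.le_totalDegree hm
    rw [Finsupp.degree]
    exact this.trans h
  rw [Polynomial.coeff_C_mul, key m hmd]
  split_ifs
  · rw [MvPolynomial.eval_monomial, Finsupp.prod_fintype _ _ (by simp)]
  · simp

lemma totalDegree_aeval_le_s12 (A : MvPolynomial (Fin 2) Fq') (hA : A.totalDegree ≤ 1)
    (p : Polynomial Fq') (hp : p.natDegree ≤ d) :
    (Polynomial.aeval A p).totalDegree ≤ d := by
  rw [Polynomial.aeval_eq_sum_range]
  refine MvPolynomial.totalDegree_finsetSum_le fun i hi => ?_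
  refine (MvPolynomial.totalDegree_smul_le _ _).trans ?_
  refine (MvPolynomial.totalDegree_pow _ _).trans ?_
  have := Finset.mem_range.mp hi
  nlinarith

lemma poly_eq_of_agree (p r : Polynomial Fq') (n : ℕ) (hp : p.natDegree ≤ n)
    (hr : r.natDegree ≤ n) (S : Finset Fq) (hS : n < S.card)
    (h : ∀ s ∈ S, p.eval (ι s) = r.eval (ι s)) : p = r := by
  classical
  rw [← sub_eq_zero]
  refine Polynomial.eq_zero_of_natDegree_lt_card_of_eval_eq_zero' _ (S.image ι) ?_ ?_
  · intro i hi
    obtain ⟨s, hs, rfl⟩ := Finset.mem_image.mp hi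
    simp [h s hs]
  · rw [Finset.card_image_of_injective _ ι.injective]
    exact (Polynomial.natDegree_sub_le_of_le hp hr).trans_lt (by simpa using hS)

/-- Interpolation from rows and columns. `l0`, `l1` are the coordinates for the basis. -/
lemma interp (α β : Fin 2 → Fq) (b0 b1 : Fin 2 → Fq)
    (hcoord : ∀ s t : Fq, (α 0 * (s • b0 + t • b1) 0 + α 1 * (s • b0 + t • b1) 1 = s) ∧
      (β 0 * (s • b0 + t • b1) 0 + β 1 * (s • b0 + t • b1) 1 = t))
    (S : Finset Fq) (hS : S.card = d + 1) (hSg : ∀ s ∈ S, Good ι d f (s • b0) b1) :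
    ∃ P : MvPolynomial (Fin 2) Fq', P.totalDegree ≤ 2 * d ∧
      ∀ t : Fq, Good ι d f (t • b1) b0 → ∀ s : Fq,
        f (s • b0 + t • b1) = MvPolynomial.eval (fun i => ι ((s • b0 + t • b1) i)) P := by
  classical
  choose! p hp hpe using hSg
  let lin : (Fin 2 → Fq) → MvPolynomial (Fin 2) Fq' := fun γ =>
    MvPolynomial.C (ι (γ 0)) * MvPolynomial.X 0 + MvPolynomial.C (ι (γ 1)) * MvPolynomial.X 1
  have hlin : ∀ γ, (lin γ).totalDegree ≤ 1 := by
    intro γ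
    refine (MvPolynomial.totalDegree_add _ _).trans (max_le ?_ ?_) <;>
    · refine (MvPolynomial.totalDegree_mul _ _).trans ?_
      simp
  have hbas : ∀ s ∈ S, (Lagrange.basis S ι s).natDegree ≤ d := by
    intro s hs
    rw [Polynomial.natDegree_le_iff_degree_le, Lagrange.degree_basis ι.injective.injOn hs, hS]
    simp
  refine ⟨∑ s ∈ S, Polynomial.aeval (lin α) (Lagrange.basis S ι s) *
    Polynomial.aeval (lin β) (p s), ?_, ?_⟩
  · refine MvPolynomial.totalDegree_finsetSum_le fun s hs => ?_
    refine (MvPolynomial.totalDegree_mul _ _).trans ?_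
    have h1 := totalDegree_aeval_le_s12 (lin α) (hlin α) _ (hbas s hs)
    have h2 := totalDegree_aeval_le_s12 (lin β) (hlin β) _ (hp s hs)
    omega
  · intro t ⟨r, hr, hre⟩ s
    have hevlin : ∀ γ x : Fin 2 → Fq, MvPolynomial.eval (fun i => ι (x i)) (lin γ) =
        ι (γ 0 * x 0 + γ 1 * x 1) := by
      intro γ x; simp [lin]
    have hev : ∀ (γ x : Fin 2 → Fq) (w : Polynomial Fq'), MvPolynomial.eval (fun i => ι (x i))
        (Polynomial.aeval (lin γ) w) = w.eval (ι (γ 0 * x 0 + γ 1 * x 1)) := by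
      intro γ x w
      rw [← hevlin, Polynomial.aeval_def, Polynomial.hom_eval₂, Polynomial.eval,
        MvPolynomial.algebraMap_eq]
      congr 1
      ext x; simp
    rw [map_sum]
    simp only [map_mul, hev, (hcoord s t).1, (hcoord s t).2]
    have hrd : r.degree < S.card := by
      rw [hS]
      refine (Polynomial.degree_le_of_natDegree_le hr).trans_lt ?_
      exact_mod_cast Nat.lt_succ_self d
    have hr2 := Lagrange.eq_interpolate_of_eval_eq (v := ι) (s := S)
      (fun s => r.eval (ι s)) ι.injective.injOn hrd (fun i _ => rfl)
    rw [add_comm, hre, hr2, Lagrange.interpolate_apply, Polynomial.eval_finset_sum]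
    refine Finset.sum_congr rfl fun i hi => ?_
    rw [Polynomial.eval_mul, Polynomial.eval_C, mul_comm, ← hpe i hi, ← hre, add_comm]

end

section

variable {Fq Fq' : Type} [Field Fq] [Fintype Fq] [Field Fq'] {ι : Fq →+* Fq'} {d : ℕ}
  {f : (Fin 2 → Fq) → Fq'}

open Classical in
/-- Number of base points `a` such that the line through `a` in direction `b` is good. -/
noncomputable def cnt (ι : Fq →+* Fq') (d : ℕ) (f : (Fin 2 → Fq) → Fq') (b : Fin 2 → Fq) : ℕ :=
  (Finset.univ.filter fun a => Good ι d f a b).card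

lemma cnt_le (b : Fin 2 → Fq) : cnt ι d f b ≤ Fintype.card Fq ^ 2 := by
  classical
  refine (Finset.card_le_univ _).trans ?_
  simp

open Classical in
lemma exists_dirs (h : (2 * d + 1) * Fintype.card Fq ^ 2 * (Fintype.card Fq - 1) <
      ∑ b ∈ Finset.univ.erase (0 : Fin 2 → Fq), cnt ι d f b) :
    ∃ b0 b1 : Fin 2 → Fq, b0 ≠ 0 ∧ (∀ c : Fq, b1 ≠ c • b0) ∧
      2 * d * Fintype.card Fq < cnt ι d f b0 ∧ 2 * d * Fintype.card Fq < cnt ι d f b1 := by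
  by_contra hcon
  push Not at hcon
  obtain ⟨r, hr⟩ : ∃ r, Fintype.card Fq = r + 1 :=
    ⟨Fintype.card Fq - 1, by have := Fintype.card_pos (α := Fq); omega⟩
  have hV : (Finset.univ.erase (0 : Fin 2 → Fq)).card = (r + 1) ^ 2 - 1 := by
    rw [Finset.card_erase_of_mem (Finset.mem_univ _), Finset.card_univ]
    simp [hr]
  have hle : ∀ b, cnt ι d f b ≤ (r + 1) ^ 2 := fun b => hr ▸ cnt_le b
  simp only [hr, Nat.add_sub_cancel] at h hcon
  by_cases hb : ∃ b0 : Fin 2 → Fq, b0 ≠ 0 ∧ 2 * d * (r + 1) < cnt ι d f b0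
  · obtain ⟨b0, hb0, hN⟩ := hb
    let M : Finset (Fin 2 → Fq) := (Finset.univ.erase (0 : Fq)).image fun c => c • b0
    have hMc : M.card = r := by
      rw [Finset.card_image_of_injective _ (smul_left_injective _ hb0),
        Finset.card_erase_of_mem (Finset.mem_univ _), Finset.card_univ, hr]
      rfl
    have hMs : M ⊆ Finset.univ.erase (0 : Fin 2 → Fq) := by
      intro b hb
      obtain ⟨c, hc, rfl⟩ := Finset.mem_image.mp hb
      simp only [Finset.mem_erase, Finset.mem_univ, and_true] at hc ⊢
      exact smul_ne_zero hc hb0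
    rw [← Finset.sum_sdiff hMs] at h
    have h1 : ∑ b ∈ M, cnt ι d f b ≤ r * (r + 1) ^ 2 := by
      have := Finset.sum_le_card_nsmul M (cnt ι d f) _ fun b _ => hle b
      rwa [hMc, smul_eq_mul] at this
    have h2 : ∑ b ∈ Finset.univ.erase (0 : Fin 2 → Fq) \ M, cnt ι d f b
        ≤ ((r + 1) ^ 2 - 1 - r) * (2 * d * (r + 1)) := by
      have := Finset.sum_le_card_nsmul (Finset.univ.erase (0 : Fin 2 → Fq) \ M) (cnt ι d f)
        (2 * d * (r + 1)) ?_
      · rwa [Finset.card_sdiff_of_subset hMs, hMc, hV, smul_eq_mul] at this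
      · intro b hb
        simp only [Finset.mem_sdiff, Finset.mem_erase, Finset.mem_univ, and_true, M,
          Finset.mem_image, not_exists, not_and] at hb
        refine hcon b0 b hb0 ?_ hN
        intro c hc
        by_cases hc0 : c = 0
        · subst hc0; simp at hc; exact hb.1 hc
        · exact hb.2 c hc0 hc.symm
    have h3 : (r + 1) ^ 2 - 1 - r = r * (r + 1) := by
      have : (r + 1) ^ 2 = r * (r + 1) + r + 1 := by ring
      omega
    rw [h3] at h2
    nlinarith
  · push Not at hb
    have h2 := Finset.sum_le_card_nsmul (Finset.univ.erase (0 : Fin 2 → Fq)) (cnt ι d f)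
      (2 * d * (r + 1)) (fun b hb' => hb b (Finset.ne_of_mem_erase hb'))
    rw [hV, smul_eq_mul] at h2
    have h3 : (r + 1) ^ 2 - 1 = r * (r + 1) + r := by
      have : (r + 1) ^ 2 = r * (r + 1) + r + 1 := by ring
      omega
    rw [h3] at h2
    have hrd : 2 * d ≤ r ∨ r < 2 * d := le_or_gt _ _
    rcases hrd with hrd | hrd
    · have h4 : r * (2 * d * (r + 1)) ≤ r * (r * (r + 1)) := by gcongr
      nlinarith [Nat.zero_le (r * (r+1))]
    · obtain ⟨b0, hb0⟩ : ∃ b0 : Fin 2 → Fq, b0 ≠ 0 := ⟨fun _ => 1, fun h => by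
        simpa using congrFun h 0⟩
      have h5 := Finset.sum_le_card_nsmul (Finset.univ.erase (0 : Fin 2 → Fq)) (cnt ι d f)
        _ (fun b _ => hle b)
      rw [hV, smul_eq_mul, h3] at h5
      have h6 : r * (r + 1) + r ≤ (2 * d + 1) * r := by nlinarith
      nlinarith [Nat.mul_le_mul_right ((r + 1) ^ 2) h6]

open Classical in
lemma many_cosets (b0 b1 : Fin 2 → Fq) (hspan : ∀ x, ∃ s t : Fq, x = s • b0 + t • b1)
    (h : 2 * d * Fintype.card Fq < cnt ι d f b1) :
    2 * d < (Finset.univ.filter fun s : Fq => Good ι d f (s • b0) b1).card := by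
  have hsub : (Finset.univ.filter fun a => Good ι d f a b1) ⊆
      ((Finset.univ.filter fun s : Fq => Good ι d f (s • b0) b1) ×ˢ
        (Finset.univ : Finset Fq)).image fun x => x.1 • b0 + x.2 • b1 := by
    intro a ha
    simp only [Finset.mem_filter, Finset.mem_univ, true_and] at ha
    obtain ⟨s, t, rfl⟩ := hspan a
    refine Finset.mem_image.mpr ⟨(s, t), ?_, rfl⟩
    simp only [Finset.mem_product, Finset.mem_filter, Finset.mem_univ, true_and, and_true]
    have := ha.reparam (-t) 1
    simpa using this
  have h1 := (Finset.card_le_card hsub).trans Finset.card_image_le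
  rw [Finset.card_product, Finset.card_univ] at h1
  exact lt_of_mul_lt_mul_right (h.trans_le h1) (Nat.zero_le _)

open Classical in
lemma zeros_le (W : MvPolynomial (Fin 2) Fq') (hW : W ≠ 0) :
    (Finset.univ.filter fun b : Fin 2 → Fq =>
      MvPolynomial.eval (fun i => ι (b i)) W = 0).card ≤ W.totalDegree * Fintype.card Fq := by
  have hz := MvPolynomial.schwartz_zippel_totalDegree hW (Finset.univ.image ι)
  rw [Finset.card_image_of_injective _ ι.injective, Finset.card_univ] at hz
  have hq : (0 : ℚ≥0) < Fintype.card Fq := by exact_mod_cast Fintype.card_pos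
  rw [div_le_div_iff₀ (by positivity) hq, pow_two, ← mul_assoc] at hz
  have hz2 := le_of_mul_le_mul_right hz hq
  refine le_trans ?_ (by exact_mod_cast hz2)
  refine Finset.card_le_card_of_injOn (fun b i => ι (b i)) ?_ ?_
  · intro b hb
    simp only [Finset.coe_filter, Finset.mem_univ, true_and, Set.mem_ofPred_eq] at hb
    simp [hb]
  · intro b _ b' _ h
    funext i
    exact ι.injective (congrFun h i)

open Classical in
/-- Core: if there are many good lines, one polynomial explains all of them. -/
lemma core (hq : 2 * d < Fintype.card Fq)
    (h : (2 * d + 1) * Fintype.card Fq ^ 2 * (Fintype.card Fq - 1) <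
      ∑ b ∈ Finset.univ.erase (0 : Fin 2 → Fq), cnt ι d f b) :
    ∃ P : MvPolynomial (Fin 2) Fq', P.totalDegree ≤ d ∧
      ∀ a b : Fin 2 → Fq, b ≠ 0 → Good ι d f a b → ∀ t : Fq,
        f (a + t • b) = MvPolynomial.eval (fun i => ι ((a + t • b) i)) P := by
  obtain ⟨b0, b1, hb0, hb1, hN0, hN1⟩ := exists_dirs h
  set D : Fq := b0 0 * b1 1 - b0 1 * b1 0 with hD
  have hD0 : D ≠ 0 := by
    intro h0
    by_cases h00 : b0 0 = 0
    · have h01 : b0 1 ≠ 0 := by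
        intro h01
        apply hb0
        ext i; fin_cases i <;> simp [h00, h01]
      refine hb1 (b1 1 / b0 1) ?_
      have : b1 0 = 0 := by
        rw [hD, h00, zero_mul, zero_sub, neg_eq_zero] at h0
        exact (mul_eq_zero.mp h0).resolve_left h01
      ext i; fin_cases i
      · simp [this, h00]
      · simp; field_simp
    · refine hb1 (b1 0 / b0 0) ?_
      ext i; fin_cases i
      · simp; field_simp
      · simp
        field_simp
        linear_combination h0
  let α : Fin 2 → Fq := ![b1 1 / D, - b1 0 / D]
  let β : Fin 2 → Fq := ![- b0 1 / D, b0 0 / D]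
  have hcoord : ∀ s t : Fq, (α 0 * (s • b0 + t • b1) 0 + α 1 * (s • b0 + t • b1) 1 = s) ∧
      (β 0 * (s • b0 + t • b1) 0 + β 1 * (s • b0 + t • b1) 1 = t) := by
    intro s t
    constructor
    · simp [α]
      field_simp
      rw [hD]; ring
    · simp [β]
      field_simp
      rw [hD]; ring
  have hdecomp : ∀ x : Fin 2 → Fq, x = (α 0 * x 0 + α 1 * x 1) • b0 +
      (β 0 * x 0 + β 1 * x 1) • b1 := by
    intro x
    ext i
    fin_cases i
    · simp [α, β]
      field_simp
      rw [hD]; ring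
    · simp [α, β]
      field_simp
      rw [hD]; ring
  have hspan : ∀ x, ∃ s t : Fq, x = s • b0 + t • b1 := fun x => ⟨_, _, hdecomp x⟩
  have hC := many_cosets b0 b1 hspan hN1
  have hR := many_cosets b1 b0 (fun x => by
    obtain ⟨s, t, h⟩ := hspan x
    exact ⟨t, s, by rw [h, add_comm]⟩) hN0
  obtain ⟨S, hSs, hSc⟩ := Finset.exists_subset_card_eq (n := d + 1)
    (s := Finset.univ.filter fun s : Fq => Good ι d f (s • b0) b1) (by omega)
  obtain ⟨P, hPd, hP⟩ := interp (ι := ι) (d := d) (f := f) α β b0 b1 hcoord S hSc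
    (fun s hs => by simpa using hSs hs)
  -- every good line is explained by `P`
  have hall : ∀ a b : Fin 2 → Fq, b ≠ 0 → Good ι d f a b → ∀ t : Fq,
      f (a + t • b) = MvPolynomial.eval (fun i => ι ((a + t • b) i)) P := by
    intro a b hb hg
    obtain ⟨sa, ta, rfl⟩ := hspan a
    obtain ⟨sb, tb, rfl⟩ := hspan b
    by_cases htb : tb = 0
    · subst htb
      have hsb : sb ≠ 0 := by
        rintro rfl; simp at hb
      have hg' : Good ι d f (ta • b1) b0 := by
        have := hg.reparam (- sa / sb) (1 / sb)
        convert this using 1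
        · ext i; simp; field_simp; ring
        · ext i; simp; field_simp
      intro t
      have := hP ta hg' (sa + t * sb)
      have e : sa • b0 + ta • b1 + t • (sb • b0 + (0 : Fq) • b1) =
        (sa + t * sb) • b0 + ta • b1 := by
        ext i; simp; ring
      rw [e]; exact this
    · obtain ⟨p, hp, hpe⟩ := hg
      have hre : ∀ u : Fq, (restr P (fun i => ι ((sa • b0 + ta • b1) i))
          (fun i => ι ((sb • b0 + tb • b1) i))).eval (ι u) = MvPolynomial.eval
          (fun i => ι ((sa • b0 + ta • b1 + u • (sb • b0 + tb • b1)) i)) P := by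
        intro u
        rw [restr_eval]
        congr 2
        ext i; simp; ring
      have hpeq : p = restr P (fun i => ι ((sa • b0 + ta • b1) i))
          (fun i => ι ((sb • b0 + tb • b1) i)) := by
        refine poly_eq_of_agree (ι := ι) p _ (2 * d) (by omega) (restr_natDegree_le _ _ _ _ hPd)
          ((Finset.univ.filter fun t : Fq => Good ι d f (t • b1) b0).image
            fun t => (t - ta) / tb) ?_ ?_
        · rwa [Finset.card_image_of_injective]
          intro x y hxy
          simpa [div_left_inj' htb] using hxy
        · intro u hu
          obtain ⟨t, ht, rfl⟩ := Finset.mem_image.mp hu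
          simp only [Finset.mem_filter, Finset.mem_univ, true_and] at ht
          rw [← hpe, hre]
          have e : sa • b0 + ta • b1 + ((t - ta) / tb) • (sb • b0 + tb • b1) =
              (sa + (t - ta) / tb * sb) • b0 + t • b1 := by
            ext i; simp; field_simp; ring
          rw [e]
          exact hP t ht _
      intro t
      rw [hpe, hpeq, hre]
  refine ⟨P, ?_, hall⟩
  by_contra hdeg
  push Not at hdeg
  set n := P.totalDegree with hn
  have hW : MvPolynomial.homogeneousComponent n P ≠ 0 := by
    have hP0 : P ≠ 0 := by
      rintro rfl; simp at hn; omega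
    obtain ⟨m, hm, hmn⟩ := Finset.exists_mem_eq_sup P.support
      (MvPolynomial.support_nonempty.mpr hP0) (fun s => s.sum fun _ e => e)
    intro h0
    have := congrArg (MvPolynomial.coeff m) h0
    rw [MvPolynomial.coeff_homogeneousComponent, if_pos] at this
    · exact MvPolynomial.mem_support_iff.mp hm (by simpa using this)
    · rw [hn, MvPolynomial.totalDegree, hmn]; rfl
  have hz := zeros_le (ι := ι) _ hW
  have hWd := (MvPolynomial.homogeneousComponent_isHomogeneous n P).totalDegree_le
  set Z := (Finset.univ.filter fun b : Fin 2 → Fq =>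
      MvPolynomial.eval (fun i => ι (b i)) (MvPolynomial.homogeneousComponent n P) = 0) with hZ
  have hvan : ∀ a b : Fin 2 → Fq, b ≠ 0 → Good ι d f a b → b ∈ Z := by
    intro a b hb hg
    have hl := hall a b hb hg
    obtain ⟨p, hp, hpe⟩ := hg
    have hpeq : p = restr P (fun i => ι (a i)) (fun i => ι (b i)) := by
      refine poly_eq_of_agree (ι := ι) p _ (2 * d) (by omega) (restr_natDegree_le _ _ _ _ hPd)
        Finset.univ (by rwa [Finset.card_univ]) ?_
      intro t _
      rw [← hpe, hl, restr_eval]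
      congr 2
      ext i; simp
    simp only [hZ, Finset.mem_filter, Finset.mem_univ, true_and]
    rw [← restr_coeff_top P (fun i => ι (a i)) _ n le_rfl, ← hpeq]
    exact Polynomial.coeff_eq_zero_of_natDegree_lt (by omega)
  have h0Z : (0 : Fin 2 → Fq) ∈ Z := by
    simp only [hZ, Finset.mem_filter, Finset.mem_univ, true_and, Pi.zero_apply, map_zero]
    have := restr_coeff_top P (fun _ => (0 : Fq')) (fun _ => 0) n le_rfl
    rw [← this]
    apply Polynomial.coeff_eq_zero_of_natDegree_lt
    have : restr P (fun _ => (0 : Fq')) (fun _ => 0) =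
        Polynomial.C (MvPolynomial.eval (fun _ => 0) P) := by
      unfold restr
      rw [MvPolynomial.aeval_def, ← MvPolynomial.eval₂_id, MvPolynomial.hom_eval₂]
      simp
    rw [this, Polynomial.natDegree_C]
    omega
  have hsum : ∑ b ∈ Finset.univ.erase (0 : Fin 2 → Fq), cnt ι d f b ≤
      (Z.card - 1) * Fintype.card Fq ^ 2 := by
    rw [← Finset.card_erase_of_mem h0Z, ← smul_eq_mul]
    refine le_trans ?_ (Finset.sum_le_card_nsmul _ (cnt ι d f) _ fun b _ => cnt_le b)
    refine le_of_eq (Finset.sum_subset ?_ ?_).symm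
    · exact Finset.erase_subset_erase _ (Finset.subset_univ _)
    · intro b hb hbZ
      have hb0 := Finset.ne_of_mem_erase hb
      unfold cnt
      rw [Finset.card_eq_zero, Finset.filter_eq_empty_iff]
      intro a _ hg
      exact hbZ (Finset.mem_erase.mpr ⟨hb0, hvan a b hb0 hg⟩)
  have hlt := h.trans_le hsum
  have hlt2 : (2 * d + 1) * (Fintype.card Fq - 1) < Z.card - 1 := by
    refine lt_of_mul_lt_mul_right (a := Fintype.card Fq ^ 2) ?_ (Nat.zero_le _)
    calc _ = _ := by ring
      _ < _ := hlt
  obtain ⟨r, hr⟩ : ∃ r, Fintype.card Fq = r + 1 := ⟨Fintype.card Fq - 1, by omega⟩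
  rw [hr] at hlt2 hz hq
  simp only [Nat.add_sub_cancel] at hlt2
  have hz2 : Z.card ≤ 2 * d * (r + 1) := hz.trans (Nat.mul_le_mul_right _ (hWd.trans hPd))
  have : (2 * d + 1) * r < 2 * d * (r + 1) := by omega
  nlinarith

end

lemma real_part (x ε : ℝ) (hx0 : 0 < x) (hx1 : x ≤ 1) (hε : ε ≤ 3 * x) (hε1 : ε ≤ 1)
    (hε0 : 0 ≤ ε) (h : Real.sqrt x ≤ ε ^ 6) : ε ≤ 1.01 * x ^ (1 / 200 : ℝ) := by
  have hx12 : x ≤ ε ^ 12 := by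
    have := Real.sqrt_le_left (x := x) (y := ε ^ 6) (by positivity)
    calc x ≤ (ε ^ 6) ^ 2 := (Real.sqrt_le_left (by positivity)).mp h
      _ = ε ^ 12 := by ring
  have hx4 : 1 / 4 ≤ x := by
    by_contra hlt
    push Not at hlt
    have he : ε ≤ 3 / 4 := by linarith
    have h11 : ε ^ 11 ≤ (3 / 4) ^ 11 := by gcongr
    have : ε ^ 12 ≤ ε * (3 / 4) ^ 11 := by
      calc ε ^ 12 = ε * ε ^ 11 := by ring
        _ ≤ _ := by gcongr
    norm_num at this
    nlinarith
  have hp : (1 / 1.01 : ℝ) ≤ x ^ (1 / 200 : ℝ) := by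
    have h1 : (1 / 1.01 : ℝ) = ((1 / 1.01 : ℝ) ^ (200 : ℕ)) ^ (1 / 200 : ℝ) := by
      have := Real.pow_rpow_inv_natCast (x := (1 / 1.01 : ℝ)) (n := 200) (by norm_num) (by norm_num)
      rw [one_div (200 : ℝ)]
      exact_mod_cast this.symm
    rw [h1]
    refine Real.rpow_le_rpow (by positivity) (le_trans ?_ hx4) (by norm_num)
    norm_num
  calc ε ≤ 1 := hε1
    _ = 1.01 * (1 / 1.01) := by norm_num
    _ ≤ _ := by gcongr

/-- Line versus point test with a (deterministic) degree-`d` lines table, `m = 2`.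
A lines table is encoded per parametrization `(a, b) ↦ (t ↦ T a b t)` with `b ≠ 0`;
it must be a degree-`≤ d` function on each line and must depend only on the line as a
function on points (the consistency hypothesis). Since every affine line corresponds to
the same number of parametrizations, uniform probability over pairs `(a,b)` with `b ≠ 0`
equals uniform probability over affine lines. -/
theorem line_vs_point_table_two :
    ∃ τ : ℝ, 0 < τ ∧ τ < 1 / 20 ∧
      ∀ (Fq Fq' : Type) [Field Fq] [Fintype Fq] [Field Fq'] [Fintype Fq']
        (ι : Fq →+* Fq') (d : ℕ), d < Fintype.card Fq →
        ∀ (f : (Fin 2 → Fq) → Fq') (T : (Fin 2 → Fq) → (Fin 2 → Fq) → Fq → Fq'),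
          (∀ a b : Fin 2 → Fq, b ≠ 0 →
            ∃ p : Polynomial Fq', p.natDegree ≤ d ∧ ∀ t, T a b t = Polynomial.eval (ι t) p) →
          (∀ (a b a' b' : Fin 2 → Fq) (t t' : Fq), b ≠ 0 → b' ≠ 0 →
            Set.range (fun s : Fq => a + s • b) = Set.range (fun s : Fq => a' + s • b') →
            a + t • b = a' + t' • b' → T a b t = T a' b' t') →
          ∀ ε : ℝ,
            (Nat.card {ab : (Fin 2 → Fq) × (Fin 2 → Fq) //
                ab.2 ≠ 0 ∧ ∀ t, f (ab.1 + t • ab.2) = T ab.1 ab.2 t} : ℝ) /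
              (Nat.card {ab : (Fin 2 → Fq) × (Fin 2 → Fq) // ab.2 ≠ 0} : ℝ) = ε →
            Real.sqrt ((d : ℝ) / Fintype.card Fq) ≤ ε ^ 6 →
            ∃ Q : (Fin 2 → Fq) → Fq', IsDegLE ι 2 d Q ∧
              ε - 1.01 * ((d : ℝ) / Fintype.card Fq) ^ τ ≤ agr Q f := by
  refine ⟨1 / 200, by norm_num, by norm_num, ?_⟩
  intro Fq Fq' _ _ _ _ ι d hd f T hT _ ε hε hsq
  classical
  set q := Fintype.card Fq with hq
  have hq2 : 2 ≤ q := Fintype.one_lt_card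
  obtain ⟨r, hr⟩ : ∃ r, q = r + 1 := ⟨q - 1, by omega⟩
  have hr1 : 1 ≤ r := by omega
  have hVcard : Fintype.card (Fin 2 → Fq) = q ^ 2 := by simp [hq]
  set N := ∑ b ∈ Finset.univ.erase (0 : Fin 2 → Fq), cnt ι d f b with hN
  have hErase : (Finset.univ.erase (0 : Fin 2 → Fq)).card = r * (r + 2) := by
    rw [Finset.card_erase_of_mem (Finset.mem_univ _), Finset.card_univ, hVcard, hr]
    have : (r + 1) ^ 2 = r * (r + 2) + 1 := by ring
    omega
  -- denominators and numerators
  have hden : Nat.card {ab : (Fin 2 → Fq) × (Fin 2 → Fq) // ab.2 ≠ 0} = q ^ 2 * (r * (r + 2)) := by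
    rw [Nat.card_eq_fintype_card, Fintype.card_subtype, ← hErase, ← hVcard, ← Finset.card_univ,
      ← Finset.card_product]
    congr 1
    ext ⟨a, b⟩
    simp
  have hnum : Nat.card {ab : (Fin 2 → Fq) × (Fin 2 → Fq) //
      ab.2 ≠ 0 ∧ ∀ t, f (ab.1 + t • ab.2) = T ab.1 ab.2 t} ≤ N := by
    rw [Nat.card_eq_fintype_card, Fintype.card_subtype]
    have h1 : N = ((Finset.univ.erase (0 : Fin 2 → Fq)).sigma
        fun b => Finset.univ.filter fun a => Good ι d f a b).card := by
      rw [Finset.card_sigma]; rfl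
    rw [h1]
    refine Finset.card_le_card_of_injOn (fun ab => ⟨ab.2, ab.1⟩) ?_ ?_
    · rintro ⟨a, b⟩ hab
      simp only [Finset.coe_filter, Finset.mem_univ, true_and, Set.mem_ofPred_eq] at hab
      obtain ⟨p, hp, hpe⟩ := hT a b hab.1
      simp only [Finset.mem_coe, Finset.mem_sigma, Finset.mem_erase, Finset.mem_univ, and_true,
        Finset.mem_filter, true_and]
      exact ⟨hab.1, p, hp, fun t => (hab.2 t).trans (hpe t)⟩
    · rintro ⟨a, b⟩ _ ⟨a', b'⟩ _ h
      simp only [Sigma.mk.injEq, heq_eq_eq] at h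
      simp [h.1, h.2]
  have hDpos : (0 : ℝ) < (q : ℝ) ^ 2 * ((r : ℝ) * (r + 2)) := by
    have : 0 < q := by omega
    positivity
  rw [hden] at hε
  push_cast at hε
  have hε0 : 0 ≤ ε := by rw [← hε]; positivity
  have hεN : ε * ((q : ℝ) ^ 2 * ((r : ℝ) * (r + 2))) ≤ N := by
    rw [← hε, div_mul_cancel₀ _ hDpos.ne']
    exact_mod_cast hnum
  have hNle : N ≤ r * (r + 2) * q ^ 2 := by
    have := Finset.sum_le_card_nsmul (Finset.univ.erase (0 : Fin 2 → Fq)) (cnt ι d f) _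
      (fun b _ => cnt_le b)
    rwa [hErase, smul_eq_mul] at this
  have hxτ : (0 : ℝ) ≤ ((d : ℝ) / q) ^ (1 / 200 : ℝ) := by positivity
  have hqpos : (0 : ℝ) < q := by exact_mod_cast (by omega : 0 < q)
  have hrpos : (0 : ℝ) < r := by exact_mod_cast hr1
  have hqr : (q : ℝ) = r + 1 := by rw [hr]; push_cast; ring
  by_cases hmain : (2 * d + 1) * q ^ 2 * (q - 1) < N
  · have h2d : 2 * d < q := by
      have h1 := hmain.trans_le hNle
      rw [hr, Nat.add_sub_cancel] at h1
      have h2 : (2 * d + 1) * ((r + 1) ^ 2 * r) < (r + 2) * ((r + 1) ^ 2 * r) := by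
        calc _ = (2 * d + 1) * (r + 1) ^ 2 * r := by ring
          _ < _ := h1
          _ = _ := by ring
      have := lt_of_mul_lt_mul_right h2 (Nat.zero_le _)
      omega
    obtain ⟨P, hPd, hP⟩ := core h2d hmain
    refine ⟨fun x => MvPolynomial.eval (fun i => ι (x i)) P, ⟨P, hPd, fun _ => rfl⟩, ?_⟩
    refine le_trans (by linarith) (?_ : ε ≤ _)
    unfold agr
    rw [hVcard, Nat.card_eq_fintype_card, Fintype.card_subtype]
    set S := Finset.univ.filter fun x : Fin 2 → Fq =>
      MvPolynomial.eval (fun i => ι (x i)) P = f x with hS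
    have hNS : N ≤ r * (r + 2) * S.card := by
      rw [← hErase, ← smul_eq_mul]
      refine Finset.sum_le_card_nsmul _ _ _ fun b hb => ?_
      refine Finset.card_le_card fun a ha => ?_
      simp only [Finset.mem_filter, Finset.mem_univ, true_and, hS] at ha ⊢
      have := hP a b (Finset.ne_of_mem_erase hb) ha 0
      simpa using this.symm
    have hNS' : (N : ℝ) ≤ r * (r + 2) * S.card := by exact_mod_cast hNS
    push_cast
    rw [le_div_iff₀ (by positivity)]
    refine le_of_mul_le_mul_right ?_ (by positivity : (0 : ℝ) < (r : ℝ) * (r + 2))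
    calc _ = ε * ((q : ℝ) ^ 2 * ((r : ℝ) * (r + 2))) := by ring
      _ ≤ _ := hεN.trans hNS'
      _ = _ := by ring
  · push Not at hmain
    have hεle : ε * (q + 1) ≤ 2 * d + 1 := by
      have h1 : (N : ℝ) ≤ (2 * d + 1) * (q : ℝ) ^ 2 * r := by
        have : q - 1 = r := by omega
        rw [this] at hmain
        exact_mod_cast hmain
      refine le_of_mul_le_mul_right ?_ (by positivity : (0 : ℝ) < (q : ℝ) ^ 2 * r)
      calc _ = ε * ((q : ℝ) ^ 2 * ((r : ℝ) * (r + 2))) := by rw [hqr]; ring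
        _ ≤ _ := hεN.trans h1
        _ = _ := by ring
    have hagr0 : ∀ g : (Fin 2 → Fq) → Fq', 0 ≤ agr g f := fun g => by unfold agr; positivity
    have hconst : ∀ c : Fq', IsDegLE ι 2 d (fun _ => c) := fun c =>
      ⟨MvPolynomial.C c, by simp, fun x => by simp⟩
    rcases Nat.eq_zero_or_pos d with hd0 | hd1
    · subst hd0
      by_cases hN0 : N = 0
      · refine ⟨fun _ => 0, hconst 0, le_trans ?_ (hagr0 _)⟩
        rw [hN0] at hεN
        have : ε ≤ 0 := by
          by_contra hpos
          push Not at hpos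
          have := mul_pos hpos hDpos
          push_cast at hεN
          linarith
        linarith
      · obtain ⟨b, hb, hbc⟩ := Finset.exists_ne_zero_of_sum_ne_zero hN0
        have hb0 := Finset.ne_of_mem_erase hb
        unfold cnt at hbc
        obtain ⟨a, ha⟩ := Finset.card_ne_zero.mp hbc
        simp only [Finset.mem_filter, Finset.mem_univ, true_and] at ha
        obtain ⟨p, hp, hpe⟩ := ha
        have hpc := Polynomial.eq_C_of_natDegree_le_zero hp
        refine ⟨fun _ => p.coeff 0, hconst _, ?_⟩
        refine le_trans (by linarith) (?_ : ε ≤ _)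
        unfold agr
        rw [hVcard, Nat.card_eq_fintype_card, Fintype.card_subtype]
        have hcard : q ≤ (Finset.univ.filter fun x : Fin 2 → Fq => p.coeff 0 = f x).card := by
          rw [hq, ← Finset.card_univ]
          refine Finset.card_le_card_of_injOn (fun t => a + t • b) ?_ ?_
          · intro t _
            simp only [Finset.coe_filter, Finset.mem_univ, true_and, Set.mem_ofPred_eq]
            rw [hpe, hpc]; simp
          · intro t _ t' _ h
            exact smul_left_injective _ hb0 (add_left_cancel h)
        have hcard' : (q : ℝ) ≤ (Finset.univ.filter fun x : Fin 2 → Fq => p.coeff 0 = f x).card := by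
          exact_mod_cast hcard
        push_cast at hεle ⊢
        rw [le_div_iff₀ (by positivity)]
        refine le_trans ?_ hcard'
        nlinarith
    · refine ⟨fun _ => 0, hconst 0, le_trans ?_ (hagr0 _)⟩
      have hd1' : (1 : ℝ) ≤ d := by exact_mod_cast hd1
      have hdq : (d : ℝ) ≤ q := by exact_mod_cast hd.le
      have hε1 : ε ≤ 1 := by
        refine le_of_mul_le_mul_right ?_ hDpos
        refine hεN.trans ?_
        rw [one_mul]
        calc (N : ℝ) ≤ r * (r + 2) * (q : ℝ) ^ 2 := by exact_mod_cast hNle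
          _ = _ := by ring
      have := real_part ((d : ℝ) / q) ε (by positivity) (by rw [div_le_one hqpos]; exact hdq)
        (by rw [← mul_div_assoc, le_div_iff₀ hqpos]; nlinarith) hε1 hε0 hsq
      linarith

end Paper
end
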